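/- Let γ ∈ (0,1), β ∈ [0,1), 1 < r ≤ q < ∞ with β = 1/r − 1/q, and let ω be a weight on ℝ^{n+1}. Then ω ∈ A_{r,q}⁺(γ) if and only if M_β^{γ+} is bounded from L^r(ℝ^{n+1}, ω^r) to L^q(ℝ^{n+1}, ω^q), i.e., there exists a positive constant C such that ‖M_β^{γ+}(f)‖_{L^q(ℝ^{n+1},ω^q)} ≤ C ‖f‖_{L^r(ℝ^{n+1},ω^r)} for every f ∈ L^r(ℝ^{n+1}, ω^r). -/

import Mathlib

open MeasureTheory ENNReal NNReal Set

noncomputable section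

/-- The `γ`-upper part `R⁺(γ)` of the parabolic rectangle `R(x,t,L)`. -/
def parUp (n : ℕ) (p : ℝ) (x : Fin n → ℝ) (t L γ : ℝ) : Set ((Fin n → ℝ) × ℝ) :=
  {z : (Fin n → ℝ) × ℝ | ‖z.1 - x‖ ≤ L ∧ z.2 ∈ Set.Ioo (t + γ * L ^ p) (t + L ^ p)}

/-- The `γ`-lower part `R⁻(γ)` of the parabolic rectangle `R(x,t,L)`. -/
def parLow (n : ℕ) (p : ℝ) (x : Fin n → ℝ) (t L γ : ℝ) : Set ((Fin n → ℝ) × ℝ) :=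
  {z : (Fin n → ℝ) × ℝ | ‖z.1 - x‖ ≤ L ∧ z.2 ∈ Set.Ioo (t - L ^ p) (t - γ * L ^ p)}

/-- The integral average `⨍_A f`, valued in `ℝ≥0∞`. -/
def setAvg {n : ℕ} (A : Set ((Fin n → ℝ) × ℝ)) (f : ((Fin n → ℝ) × ℝ) → ℝ≥0∞) : ℝ≥0∞ :=
  (∫⁻ z in A, f z) / volume A

/-- The backward-in-time translate `A − (0, a)`. -/
def timeShift {n : ℕ} (A : Set ((Fin n → ℝ) × ℝ)) (a : ℝ) : Set ((Fin n → ℝ) × ℝ) :=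
  {z : (Fin n → ℝ) × ℝ | (z.1, z.2 + a) ∈ A}

/-- `[u,v]_{TA_{r,q}^+(γ)}` for `1 < r ≤ q`. -/
def TArq (n : ℕ) (p γ r q : ℝ) (u v : ((Fin n → ℝ) × ℝ) → ℝ) : ℝ≥0∞ :=
  ⨆ (x : Fin n → ℝ) (t : ℝ) (L : ℝ) (_ : 0 < L),
    setAvg (parLow n p x t L γ) (fun z => ENNReal.ofReal (u z) ^ q) *
      (setAvg (parUp n p x t L γ)
          (fun z => ENNReal.ofReal (v z) ^ (-(r / (r - 1))))) ^ (q / (r / (r - 1)))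

/-- `[u,v]_{TA_{1,q}^+(γ)}`. -/
def TA1q (n : ℕ) (p γ q : ℝ) (u v : ((Fin n → ℝ) × ℝ) → ℝ) : ℝ≥0∞ :=
  ⨆ (x : Fin n → ℝ) (t : ℝ) (L : ℝ) (_ : 0 < L),
    setAvg (parLow n p x t L γ) (fun z => ENNReal.ofReal (u z) ^ q) *
      (essInf (fun z => ENNReal.ofReal (v z)) (volume.restrict (parUp n p x t L γ))) ^ (-q)

/-- The `TA_{r,q}^+(γ)` constant, for all `1 ≤ r ≤ q`. -/
def TAconst (n : ℕ) (p γ r q : ℝ) (u v : ((Fin n → ℝ) × ℝ) → ℝ) : ℝ≥0∞ :=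
  if r = 1 then TA1q n p γ q u v else TArq n p γ r q u v

/-- `[u,v]_{TA_{r,q}^-(γ)}` (time axis reversed), for `1 < r ≤ q`. -/
def TArqMinus (n : ℕ) (p γ r q : ℝ) (u v : ((Fin n → ℝ) × ℝ) → ℝ) : ℝ≥0∞ :=
  ⨆ (x : Fin n → ℝ) (t : ℝ) (L : ℝ) (_ : 0 < L),
    setAvg (parUp n p x t L γ) (fun z => ENNReal.ofReal (u z) ^ q) *
      (setAvg (parLow n p x t L γ)
          (fun z => ENNReal.ofReal (v z) ^ (-(r / (r - 1))))) ^ (q / (r / (r - 1)))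

/-- The parabolic Muckenhoupt `A_q^+(γ)` constant. -/
def parAq (n : ℕ) (p γ q : ℝ) (w : ((Fin n → ℝ) × ℝ) → ℝ) : ℝ≥0∞ :=
  ⨆ (x : Fin n → ℝ) (t : ℝ) (L : ℝ) (_ : 0 < L),
    setAvg (parLow n p x t L γ) (fun z => ENNReal.ofReal (w z)) *
      (setAvg (parUp n p x t L γ) (fun z => ENNReal.ofReal (w z) ^ (1 / (1 - q)))) ^ (q - 1)

/-- Membership in `A_∞^+(γ) := ⋃_{q ∈ (1,∞)} A_q^+(γ)`. -/
def memAinf (n : ℕ) (p γ : ℝ) (w : ((Fin n → ℝ) × ℝ) → ℝ) : Prop :=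
  ∃ q : ℝ, 1 < q ∧ parAq n p γ q w < ∞

/-- The uncentered forward-in-time parabolic fractional maximal function `M_β^{γ+} f`. -/
def uMax (n : ℕ) (p γ β : ℝ) (f : ((Fin n → ℝ) × ℝ) → ℝ) (z : (Fin n → ℝ) × ℝ) : ℝ≥0∞ :=
  ⨆ (x : Fin n → ℝ) (t : ℝ) (L : ℝ) (_ : 0 < L) (_ : z ∈ parLow n p x t L γ),
    volume (parUp n p x t L γ) ^ β *
      setAvg (parUp n p x t L γ) (fun w => ENNReal.ofReal |f w|)

/-- The uncentered back-in-time parabolic fractional maximal function `M_β^{γ−} f`. -/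
def uMaxBack (n : ℕ) (p γ β : ℝ) (f : ((Fin n → ℝ) × ℝ) → ℝ) (z : (Fin n → ℝ) × ℝ) : ℝ≥0∞ :=
  ⨆ (x : Fin n → ℝ) (t : ℝ) (L : ℝ) (_ : 0 < L) (_ : z ∈ parUp n p x t L γ),
    volume (parLow n p x t L γ) ^ β *
      setAvg (parLow n p x t L γ) (fun w => ENNReal.ofReal |f w|)

/-- The centered forward-in-time parabolic fractional maximal function `𝓜_β^{γ+} f`. -/
def cMax (n : ℕ) (p γ β : ℝ) (f : ((Fin n → ℝ) × ℝ) → ℝ) (z : (Fin n → ℝ) × ℝ) : ℝ≥0∞ :=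
  ⨆ (L : ℝ) (_ : 0 < L),
    volume (parUp n p z.1 z.2 L γ) ^ β *
      setAvg (parUp n p z.1 z.2 L γ) (fun w => ENNReal.ofReal |f w|)

/-- `‖f‖_{L^r(ℝ^{n+1}, w^r)}` as a lintegral. -/
def wLp {n : ℕ} (r : ℝ) (w f : ((Fin n → ℝ) × ℝ) → ℝ) : ℝ≥0∞ :=
  (∫⁻ z, ENNReal.ofReal |f z| ^ r * ENNReal.ofReal (w z) ^ r) ^ (1 / r)

/-- The weighted `L^q(w^q)` norm of an `ℝ≥0∞`-valued function. -/
def wLpE {n : ℕ} (q : ℝ) (w : ((Fin n → ℝ) × ℝ) → ℝ)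
    (g : ((Fin n → ℝ) × ℝ) → ℝ≥0∞) : ℝ≥0∞ :=
  (∫⁻ z, g z ^ q * ENNReal.ofReal (w z) ^ q) ^ (1 / q)

/-- The weighted weak `L^{q,∞}(w^q)` norm of an `ℝ≥0∞`-valued function. -/
def wWeak {n : ℕ} (q : ℝ) (w : ((Fin n → ℝ) × ℝ) → ℝ)
    (g : ((Fin n → ℝ) × ℝ) → ℝ≥0∞) : ℝ≥0∞ :=
  ⨆ (lam : ℝ≥0) (_ : 0 < lam),
    (lam : ℝ≥0∞) * (∫⁻ z in {z | (lam : ℝ≥0∞) < g z}, ENNReal.ofReal (w z) ^ q) ^ (1 / q)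

/-- The parabolic forward-in-time fractional integral `I_β^{γ+} f` (unsigned version). -/
def parI (n : ℕ) (p γ β : ℝ) (f : ((Fin n → ℝ) × ℝ) → ℝ) (z : (Fin n → ℝ) × ℝ) : ℝ≥0∞ :=
  ∫⁻ w in {w : (Fin n → ℝ) × ℝ | γ * ‖w.1‖ ^ p < w.2},
    ENNReal.ofReal (f (z.1 - w.1, z.2 - w.2) *
      (max ‖w.1‖ (|w.2| ^ (1 / p))) ^ (-(((n : ℝ) + p) * (1 - β))))

/-- The parabolic forward-in-time fractional integral `I_β^{γ+} f` (signed version). -/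
def parIR (n : ℕ) (p γ β : ℝ) (f : ((Fin n → ℝ) × ℝ) → ℝ) (z : (Fin n → ℝ) × ℝ) : ℝ :=
  ∫ w in {w : (Fin n → ℝ) × ℝ | γ * ‖w.1‖ ^ p < w.2},
    f (z.1 - w.1, z.2 - w.2) * (max ‖w.1‖ (|w.2| ^ (1 / p))) ^ (-(((n : ℝ) + p) * (1 - β)))


namespace PW

/-! ### Abstract Calderon-Zygmund covering -/

section CZ
variable {X I : Type*} [MeasurableSpace X] [MeasurableSpace I] [Countable I]
  [MeasurableSingletonClass I]

theorem sat_measurable {f : X → I} (hf : Measurable f) {D : Set X}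
    (hD : ∀ z z', z ∈ D → f z' = f z → z' ∈ D) : MeasurableSet D := by
  have : D = f ⁻¹' (f '' D) := by
    ext z; constructor
    · intro h; exact ⟨z, h, rfl⟩
    · rintro ⟨y, hy, e⟩; exact hD y z hy e.symm
  rw [this]
  exact hf (Set.to_countable _).measurableSet

theorem sat_measure_le {f : X → I} (hf : Measurable f) {D : Set X} (μ ν : Measure X)
    (hD : ∀ z z', z ∈ D → f z' = f z → z' ∈ D)
    (hle : ∀ z ∈ D, μ {z' | f z' = f z} ≤ ν {z' | f z' = f z}) : μ D ≤ ν D := by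
  have e : D = ⋃ c ∈ f '' D, f ⁻¹' {c} := by
    ext z
    simp only [mem_iUnion, mem_preimage, mem_singleton_iff, exists_prop]
    constructor
    · intro h; exact ⟨f z, ⟨z, h, rfl⟩, rfl⟩
    · rintro ⟨c, ⟨y, hy, rfl⟩, e⟩; exact hD y z hy e
  have key : ∀ κ : Measure X, κ D = ∑' c : f '' D, κ (f ⁻¹' {(c : I)}) := by
    intro κ
    conv_lhs => rw [e]
    apply measure_biUnion (Set.to_countable _)
    · intro a _ b _ hab
      apply Disjoint.preimage
      simpa using hab
    · intro b _
      exact hf (measurableSet_singleton b)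
  rw [key μ, key ν]
  apply ENNReal.tsum_le_tsum
  rintro ⟨c, ⟨y, hy, rfl⟩⟩
  exact hle y hy

theorem cz (f : ℤ → X → I) (hf : ∀ j, Measurable (f j))
    (hnest : ∀ j j' z z', j ≤ j' → f j z' = f j z → f j' z' = f j' z)
    (μ ν : Measure X) (G : ℤ → Set X)
    (hG : ∀ j z z', z ∈ G j → f j z' = f j z → z' ∈ G j)
    (hle : ∀ j, ∀ z ∈ G j, μ {z' | f j z' = f j z} ≤ ν {z' | f j z' = f j z}) :
    μ (⋃ j, G j) ≤ ν (⋃ j, G j) := by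
  have hfin : ∀ J : ℤ, μ (⋃ j, ⋃ (_ : j ≤ J), G j) ≤ ν (⋃ j, ⋃ (_ : j ≤ J), G j) := by
    intro J
    set D : ℤ → Set X := fun j => {z | j ≤ J ∧ z ∈ G j ∧ ∀ j', j < j' → j' ≤ J → z ∉ G j'} with hDd
    have hDs : ∀ j z z', z ∈ D j → f j z' = f j z → z' ∈ D j := by
      rintro j z z' ⟨h0, h1, h2⟩ e
      refine ⟨h0, hG j z z' h1 e, fun j' a b c => h2 j' a b (hG j' z' z c ?_)⟩
      exact (hnest j j' z z' a.le e).symm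
    have e : (⋃ j, ⋃ (_ : j ≤ J), G j) = ⋃ j, D j := by
      ext z
      simp only [mem_iUnion, exists_prop]
      constructor
      · rintro ⟨j, hj, hz⟩
        obtain ⟨k, ⟨hk1, hk2⟩, hk3⟩ := Int.exists_greatest_of_bdd
          (P := fun j => j ≤ J ∧ z ∈ G j) ⟨J, fun z h => h.1⟩ ⟨j, hj, hz⟩
        exact ⟨k, hk1, hk2, fun j' a b c => by have := hk3 j' ⟨b, c⟩; omega⟩
      · rintro ⟨j, h1, h2, _⟩; exact ⟨j, h1, h2⟩
    have hdisj : Pairwise (Function.onFun Disjoint D) := by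
      intro a b hab
      rw [Function.onFun, Set.disjoint_left]
      rintro z ⟨h1, h2, h3⟩ ⟨k1, k2, k3⟩
      rcases lt_or_gt_of_ne hab with h | h
      · exact h3 b h k1 k2
      · exact k3 a h h1 h2
    have hm : ∀ j, MeasurableSet (D j) := fun j => sat_measurable (hf j) (hDs j)
    rw [e, measure_iUnion hdisj hm, measure_iUnion hdisj hm]
    apply ENNReal.tsum_le_tsum
    intro j
    exact sat_measure_le (hf j) μ ν (hDs j) (fun z hz => hle j z hz.2.1)
  have e : (⋃ j, G j) = ⋃ J : ℤ, ⋃ j, ⋃ (_ : j ≤ J), G j := by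
    ext z
    simp only [mem_iUnion, exists_prop]
    constructor
    · rintro ⟨j, h⟩; exact ⟨j, j, le_rfl, h⟩
    · rintro ⟨_, j, _, h⟩; exact ⟨j, h⟩
  have hmono : Monotone (fun J : ℤ => ⋃ j, ⋃ (_ : j ≤ J), G j) := by
    intro a b hab z
    simp only [mem_iUnion, exists_prop]
    rintro ⟨j, h1, h2⟩; exact ⟨j, h1.trans hab, h2⟩
  rw [e, hmono.measure_iUnion, hmono.measure_iUnion]
  exact iSup_mono hfin

end CZ

/-! ### Dyadic parabolic grid -/

/-- ambient space -/
abbrev XX (n : ℕ) := (Fin n → ℝ) × ℝ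

/-- dyadic time scale -/
def tau (p : ℝ) (j : ℤ) : ℝ := (2:ℝ) ^ (⌊(j:ℝ) * p⌋)

/-- dyadic length -/
def len (j : ℤ) : ℝ := (2:ℝ) ^ j

theorem tau_pos (p : ℝ) (j : ℤ) : 0 < tau p j := by unfold tau; positivity
theorem len_pos (j : ℤ) : 0 < len j := by unfold len; positivity

/-- index of the cell -/
def idx {n : ℕ} (p : ℝ) (j : ℤ) (z : XX n) : (Fin n → ℤ) × ℤ :=
  (fun i => ⌊z.1 i / len j⌋, ⌊z.2 / tau p j⌋)

/-- dyadic cell -/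
def cell {n : ℕ} (p : ℝ) (j : ℤ) (z : XX n) : Set (XX n) := {z' | idx p j z' = idx p j z}

/-- measure of cells -/
def mm (n : ℕ) (p : ℝ) (j : ℤ) : ℝ≥0∞ := ENNReal.ofReal (len j ^ n * tau p j)

theorem mm_pos (n : ℕ) (p : ℝ) (j : ℤ) : mm n p j ≠ 0 := by
  unfold mm
  have := len_pos j; have := tau_pos p j
  simp only [ne_eq, ENNReal.ofReal_eq_zero, not_le]; positivity

theorem mm_top (n : ℕ) (p : ℝ) (j : ℤ) : mm n p j ≠ ∞ := ENNReal.ofReal_ne_top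

theorem idx_measurable {n : ℕ} (p : ℝ) (j : ℤ) : Measurable (idx (n := n) p j) := by
  unfold idx
  apply Measurable.prodMk
  · apply measurable_pi_lambda
    intro i
    apply Int.measurable_floor.comp
    fun_prop
  · apply Int.measurable_floor.comp
    fun_prop

theorem floor_nest (x a : ℝ) (k : ℕ) : ⌊x / (a * 2 ^ k)⌋ = ⌊x / a⌋ / (2 ^ k : ℕ) := by
  rw [← div_div]
  have := Int.floor_div_natCast (x / a) (2 ^ k)
  push_cast at this ⊢
  rw [this]

theorem zpow_split {a b : ℤ} (h : a ≤ b) : (2:ℝ) ^ b = (2:ℝ) ^ a * 2 ^ (b - a).toNat := by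
  rw [← zpow_natCast, ← zpow_add₀ (by norm_num)]
  congr 1; omega

theorem idx_nest {n : ℕ} {p : ℝ} (hp : 0 < p) (j j' : ℤ) (z z' : XX n) (h : j ≤ j')
    (e : idx p j z' = idx p j z) : idx p j' z' = idx p j' z := by
  have hfl : ⌊(j:ℝ) * p⌋ ≤ ⌊(j':ℝ) * p⌋ := by
    apply Int.floor_le_floor
    have : (j:ℝ) ≤ j' := by exact_mod_cast h
    nlinarith
  simp only [idx, Prod.mk.injEq, tau, len] at e ⊢
  obtain ⟨e1, e2⟩ := e
  constructor
  · funext i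
    have := congrFun e1 i
    simp only [zpow_split h, floor_nest] at this ⊢
    rw [this]
  · simp only [zpow_split hfl, floor_nest] at e2 ⊢
    rw [e2]

theorem cell_eq {n : ℕ} (p : ℝ) (j : ℤ) (z : XX n) :
    cell p j z = (Set.pi univ fun i => Ico (⌊z.1 i / len j⌋ * len j) ((⌊z.1 i / len j⌋ + 1) * len j))
      ×ˢ Ico (⌊z.2 / tau p j⌋ * tau p j) ((⌊z.2 / tau p j⌋ + 1) * tau p j) := by
  have key : ∀ (x a : ℝ) (k : ℤ), 0 < a → (⌊x / a⌋ = k ↔ x ∈ Ico (k * a) ((k + 1) * a)) := by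
    intro x a k ha
    rw [Int.floor_eq_iff, le_div_iff₀ ha, div_lt_iff₀ ha, mem_Ico]
  ext y
  simp only [cell, idx, mem_ofPred_eq, Prod.mk.injEq, mem_prod, mem_pi, mem_univ, true_implies]
  rw [key _ _ _ (tau_pos p j), funext_iff]
  simp only [key _ _ _ (len_pos j)]

theorem cell_measurable {n : ℕ} (p : ℝ) (j : ℤ) (z : XX n) : MeasurableSet (cell p j z) :=
  idx_measurable p j (measurableSet_singleton _)

theorem mem_cell {n : ℕ} (p : ℝ) (j : ℤ) (z : XX n) : z ∈ cell p j z := rfl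

theorem vol_cell {n : ℕ} (p : ℝ) (j : ℤ) (z : XX n) : volume (cell p j z) = mm n p j := by
  rw [cell_eq, Measure.volume_eq_prod, Measure.prod_prod, Real.volume_pi_Ico, Real.volume_Ico]
  simp only [mm]
  rw [ENNReal.ofReal_mul (by have := len_pos j; positivity),
    ENNReal.ofReal_pow (len_pos j).le]
  congr 1
  · simp [add_mul]
  · congr 1; ring

/-- neighbourhood of size A at scale j -/
def NB {n : ℕ} (p : ℝ) (z : XX n) (j : ℤ) (A : ℝ) : Set (XX n) :=
  {y | ‖y.1 - z.1‖ ≤ A * len j ∧ |y.2 - z.2| ≤ A * tau p j}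

theorem NB_eq {n : ℕ} (p : ℝ) (z : XX n) (j : ℤ) (A : ℝ) :
    NB p z j A = Metric.closedBall z.1 (A * len j) ×ˢ Metric.closedBall z.2 (A * tau p j) := by
  ext y; simp [NB, dist_eq_norm]

theorem NB_measurable {n : ℕ} (p : ℝ) (z : XX n) (j : ℤ) (A : ℝ) :
    MeasurableSet (NB p z j A) := by
  rw [NB_eq]; exact measurableSet_closedBall.prod measurableSet_closedBall

theorem vol_NB {n : ℕ} (p : ℝ) (z : XX n) (j : ℤ) {A : ℝ} (hA : 0 ≤ A) :
    volume (NB p z j A) = ENNReal.ofReal ((2 * A) ^ (n + 1)) * mm n p j := by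
  have := len_pos j
  have := tau_pos p j
  rw [NB_eq, Measure.volume_eq_prod, Measure.prod_prod, Real.volume_pi_closedBall _ (by positivity),
    Real.volume_closedBall, mm, ← ENNReal.ofReal_mul (by positivity),
    ← ENNReal.ofReal_mul (by positivity)]
  congr 1
  simp only [Fintype.card_fin]
  rw [← mul_assoc, mul_pow, ← mul_assoc, pow_succ]
  ring

theorem cell_sub_NB {n : ℕ} (p : ℝ) (j : ℤ) (z : XX n) : cell p j z ⊆ NB p z j 1 := by
  have h1 := len_pos j
  have h2 := tau_pos p j
  have key : ∀ (x y a : ℝ), 0 < a → ⌊x / a⌋ = ⌊y / a⌋ → |x - y| ≤ a := by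
    intro x y a ha h
    have := Int.abs_sub_lt_one_of_floor_eq_floor h
    rw [← _root_.sub_div, abs_div, abs_of_pos ha, div_lt_one ha] at this
    exact this.le
  intro y hy
  simp only [cell, idx, mem_ofPred_eq, Prod.mk.injEq] at hy
  refine ⟨?_, ?_⟩
  · rw [one_mul, pi_norm_le_iff_of_nonneg h1.le]
    intro i
    exact key _ _ _ h1 (congrFun hy.1 i)
  · rw [one_mul]; exact key _ _ _ h2 hy.2

/-! ### scale comparisons -/

theorem len_add (j a : ℤ) : len (j + a) = len j * len a := by
  unfold len; rw [zpow_add₀ (by norm_num)]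

theorem tau_le (p : ℝ) (j : ℤ) : tau p j ≤ (2:ℝ) ^ ((j:ℝ) * p) := by
  unfold tau
  rw [← Real.rpow_intCast]
  exact Real.rpow_le_rpow_of_exponent_le (by norm_num) (Int.floor_le _)

theorem le_tau (p : ℝ) (j : ℤ) : (2:ℝ) ^ ((j:ℝ) * p) ≤ 2 * tau p j := by
  have : 2 * tau p j = (2:ℝ) ^ (((⌊(j:ℝ) * p⌋ + 1 : ℤ)) : ℝ) := by
    rw [Real.rpow_intCast, zpow_add₀ (by norm_num)]; unfold tau; ring
  rw [this]
  apply Real.rpow_le_rpow_of_exponent_le (by norm_num)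
  push_cast
  exact (Int.lt_floor_add_one _).le

theorem tau_shift {p : ℝ} (j a : ℤ) : tau p (j + a) ≤ 2 * (2:ℝ) ^ ((a:ℝ) * p) * tau p j := by
  have h1 := tau_le p (j + a)
  have h2 := le_tau p j
  have : (2:ℝ) ^ (((j + a : ℤ):ℝ) * p) = (2:ℝ) ^ ((j:ℝ) * p) * (2:ℝ) ^ ((a:ℝ) * p) := by
    rw [← Real.rpow_add (by norm_num)]; congr 1; push_cast; ring
  rw [this] at h1
  have h3 : (0:ℝ) < (2:ℝ) ^ ((a:ℝ) * p) := by positivity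
  nlinarith

theorem tau_small {p : ℝ} (hp : 1 ≤ p) (j : ℤ) (a : ℕ) : tau p (j - a) ≤ tau p j * len (-a) := by
  unfold tau len
  rw [← zpow_add₀ (by norm_num)]
  apply zpow_le_zpow_right₀ (by norm_num)
  have : ⌊((j - a : ℤ) : ℝ) * p⌋ ≤ ⌊(j:ℝ) * p - (a : ℤ)⌋ := by
    apply Int.floor_le_floor
    push_cast
    nlinarith [(Nat.cast_nonneg a : (0:ℝ) ≤ a)]
  rw [Int.floor_sub_intCast] at this
  omega

theorem tau_mono {p : ℝ} (hp : 0 ≤ p) {j j' : ℤ} (h : j ≤ j') : tau p j ≤ tau p j' := by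
  unfold tau
  apply zpow_le_zpow_right₀ (by norm_num)
  apply Int.floor_le_floor
  have : (j:ℝ) ≤ j' := by exact_mod_cast h
  nlinarith

theorem len_mono {j j' : ℤ} (h : j ≤ j') : len j ≤ len j' := by
  unfold len
  exact zpow_le_zpow_right₀ (by norm_num) h

theorem mm_shift (n : ℕ) (p : ℝ) (a : ℤ) : ∃ C : ℝ≥0∞, C ≠ ∞ ∧ C ≠ 0 ∧
    ∀ j, mm n p (j + a) ≤ C * mm n p j := by
  have ha := len_pos a
  refine ⟨ENNReal.ofReal (len a ^ n * (2 * (2:ℝ) ^ ((a:ℝ) * p))), ENNReal.ofReal_ne_top, ?_, ?_⟩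
  · simp only [ne_eq, ENNReal.ofReal_eq_zero, not_le]; positivity
  · intro j
    have := len_pos j
    unfold mm
    rw [← ENNReal.ofReal_mul (by positivity)]
    apply ENNReal.ofReal_le_ofReal
    rw [len_add, mul_pow]
    have := tau_shift (p := p) j a
    calc len j ^ n * len a ^ n * tau p (j + a)
        ≤ len j ^ n * len a ^ n * (2 * (2:ℝ) ^ ((a:ℝ) * p) * tau p j) := by gcongr
      _ = _ := by ring

/-- time shift of a point by b steps -/
def sh {n : ℕ} (p : ℝ) (j : ℤ) (b : ℤ) (z : XX n) : XX n := (z.1, z.2 + b * tau p j)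

theorem idx_sh {n : ℕ} (p : ℝ) (j b : ℤ) (z : XX n) :
    idx p j (sh p j b z) = ((idx p j z).1, (idx p j z).2 + b) := by
  have := (tau_pos p j).ne'
  simp only [idx, sh, Prod.mk.injEq, true_and]
  rw [add_div, mul_div_assoc, div_self this, mul_one, Int.floor_add_intCast]

theorem cell_congr {n : ℕ} {p : ℝ} {j : ℤ} {z z' : XX n} (h : z' ∈ cell p j z) :
    cell p j z' = cell p j z := by
  have h : idx p j z' = idx p j z := h
  unfold cell; rw [h]

theorem cell_sh_congr {n : ℕ} {p : ℝ} {j : ℤ} {z z' : XX n} (b : ℤ) (h : z' ∈ cell p j z) :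
    cell p j (sh p j b z') = cell p j (sh p j b z) := by
  have h : idx p j z' = idx p j z := h
  unfold cell; rw [idx_sh, idx_sh, h]

theorem sat_cell {n : ℕ} {p : ℝ} {j : ℤ} {z z' : XX n} (h : z' ∈ cell p j z) :
    z ∈ cell p j z' := by
  have h : idx p j z' = idx p j z := h
  exact h.symm

theorem cell_mono {n : ℕ} {p : ℝ} (hp : 0 < p) {j j' : ℤ} (h : j ≤ j') (z : XX n) :
    cell p j z ⊆ cell p j' z := fun z' hz' => idx_nest hp j j' z z' h hz'

theorem czg {n : ℕ} {p : ℝ} (hp : 0 < p) (μ ν : Measure (XX n)) (G : ℤ → Set (XX n))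
    (hG : ∀ j z z', z ∈ G j → z' ∈ cell p j z → z' ∈ G j)
    (hle : ∀ j, ∀ z ∈ G j, μ (cell p j z) ≤ ν (cell p j z)) :
    μ (⋃ j, G j) ≤ ν (⋃ j, G j) :=
  cz (fun j => idx p j) (idx_measurable p) (idx_nest hp) μ ν G hG hle

theorem satg_measurable {n : ℕ} {p : ℝ} {j : ℤ} {D : Set (XX n)}
    (hD : ∀ z z', z ∈ D → z' ∈ cell p j z → z' ∈ D) : MeasurableSet D :=
  sat_measurable (idx_measurable p j) hD

theorem fun_measurable {n : ℕ} {p : ℝ} {j : ℤ} {β : Type*} [MeasurableSpace β] {g : XX n → β}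
    (hg : ∀ z z', z' ∈ cell p j z → g z' = g z) : Measurable g := by
  intro s _
  apply satg_measurable (p := p) (j := j)
  intro z z' hz hz'
  simp only [mem_preimage] at hz ⊢
  rwa [hg z z' hz']

end PW

namespace PW

/-! ### Dyadic level sums -/

/-- powers of two in `ℝ≥0∞` -/
def e2 (k : ℤ) : ℝ≥0∞ := (2:ℝ≥0∞) ^ k

theorem e2_pos (k : ℤ) : e2 k ≠ 0 := (ENNReal.zpow_pos (by norm_num) (by norm_num) k).ne'
theorem e2_top (k : ℤ) : e2 k ≠ ∞ := (ENNReal.zpow_lt_top (by norm_num) (by norm_num) k).ne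
theorem e2_add (a b : ℤ) : e2 (a + b) = e2 a * e2 b :=
  ENNReal.zpow_add (by norm_num) (by norm_num) a b
theorem e2_succ (a : ℤ) : e2 (a + 1) = 2 * e2 a := by rw [e2_add]; simp [e2, mul_comm]
theorem e2_neg (a : ℤ) : e2 (-a) = (e2 a)⁻¹ := ENNReal.zpow_neg _ _
theorem e2_mono {a b : ℤ} (h : a ≤ b) : e2 a ≤ e2 b :=
  ENNReal.zpow_le_of_le (by norm_num) h
theorem e2_exists {x : ℝ≥0∞} (h0 : x ≠ 0) (h1 : x ≠ ∞) : ∃ k, e2 k < x ∧ x ≤ e2 (k + 1) := by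
  obtain ⟨k, hk⟩ := ENNReal.exists_mem_Ioc_zpow h0 h1 (y := 2) (by norm_num) (by norm_num)
  exact ⟨k, hk.1, hk.2⟩
theorem e2_lt {a b : ℤ} (h : e2 a < e2 b) : a < b := by
  by_contra hh
  exact absurd (e2_mono (not_lt.1 hh)) (not_le.2 h)

/-- level sum -/
def lev (s : ℝ) (x : ℝ≥0∞) : ℝ≥0∞ := ∑' k : ℤ, if e2 k < x then e2 k ^ s else 0

theorem lev_mono (s : ℝ) {x y : ℝ≥0∞} (h : x ≤ y) : lev s x ≤ lev s y := by
  apply ENNReal.tsum_le_tsum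
  intro k
  split_ifs with h1 h2
  · exact le_rfl
  · exact absurd (h1.trans_le h) h2
  · exact bot_le
  · exact le_rfl

theorem le_lev {s : ℝ} (hs : 0 < s) (x : ℝ≥0∞) : x ^ s ≤ 2 ^ s * lev s x := by
  have hfin : ∀ x : ℝ≥0∞, x ≠ ∞ → x ^ s ≤ 2 ^ s * lev s x := by
    intro x hx
    rcases eq_or_ne x 0 with rfl | h0
    · rw [ENNReal.zero_rpow_of_pos hs]; exact bot_le
    obtain ⟨k, h1, h2⟩ := e2_exists h0 hx
    calc x ^ s ≤ (e2 (k + 1)) ^ s := by gcongr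
      _ = 2 ^ s * e2 k ^ s := by rw [e2_succ, ENNReal.mul_rpow_of_nonneg _ _ hs.le]
      _ ≤ 2 ^ s * lev s x := by
        gcongr
        unfold lev
        refine le_trans ?_ (ENNReal.le_tsum k)
        rw [if_pos h1]
  rcases ne_or_eq x ∞ with hx | rfl
  · exact hfin x hx
  · by_contra hc
    have hc' : 2 ^ s * lev s ∞ ≠ ∞ := (not_le.1 hc).ne_top
    set c := 2 ^ s * lev s ∞ with hcd
    have h1 := hfin ((c + 1) ^ (1 / s)) (by
      apply ENNReal.rpow_ne_top_of_nonneg (by positivity); simp [hc'])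
    rw [← ENNReal.rpow_mul, one_div_mul_cancel hs.ne', ENNReal.rpow_one] at h1
    have h2 : c + 1 ≤ c := h1.trans (by
      rw [hcd]; gcongr; exact lev_mono s le_top)
    exact absurd h2 (not_le.2 (ENNReal.lt_add_right hc' one_ne_zero))

theorem lev_le {s : ℝ} (hs : 0 < s) : ∃ C : ℝ≥0∞, C ≠ ∞ ∧ C ≠ 0 ∧ ∀ x, lev s x ≤ C * x ^ s := by
  have h2s : (2:ℝ≥0∞)⁻¹ ^ s < 1 := by
    apply ENNReal.rpow_lt_one _ hs
    simp
  refine ⟨(1 - (2:ℝ≥0∞)⁻¹ ^ s)⁻¹, ?_, ?_, ?_⟩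
  · rw [ne_eq, ENNReal.inv_eq_top]; exact (tsub_pos_of_lt h2s).ne'
  · simp
  intro x
  rcases eq_or_ne x 0 with rfl | h0
  · simp [lev]
  rcases eq_or_ne x ∞ with rfl | hx
  · rw [ENNReal.top_rpow_of_pos hs, ENNReal.mul_top (by simp)]; exact le_top
  obtain ⟨k0, h1, h2⟩ := e2_exists h0 hx
  have hinj : Function.Injective (fun i : ℕ => k0 - (i : ℤ)) := by
    intro a b hab; simp only at hab; omega
  have : lev s x = ∑' i : ℕ, if e2 (k0 - i) < x then e2 (k0 - i) ^ s else 0 := by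
    unfold lev
    rw [← hinj.tsum_eq (f := fun k => if e2 k < x then e2 k ^ s else 0)]
    intro k hk
    simp only [Function.mem_support, ne_eq, ite_eq_right_iff, Classical.not_imp] at hk
    have : k < k0 + 1 := e2_lt (hk.1.trans_le h2)
    exact ⟨(k0 - k).toNat, by simp only; omega⟩
  rw [this, ← ENNReal.tsum_geometric, ← ENNReal.tsum_mul_right]
  apply ENNReal.tsum_le_tsum
  intro i
  split_ifs with h
  · rw [sub_eq_add_neg, e2_add, ENNReal.mul_rpow_of_nonneg _ _ hs.le, mul_comm]
    gcongr
    rw [e2_neg]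
    apply le_of_eq
    simp only [e2, zpow_natCast]
    rw [ENNReal.inv_pow, ← ENNReal.rpow_natCast, ← ENNReal.rpow_mul, mul_comm, ENNReal.rpow_mul,
      ENNReal.rpow_natCast]
  · exact bot_le

theorem lintegral_le_lev {X : Type*} [MeasurableSpace X] (μ : Measure X) {s : ℝ} (hs : 0 < s)
    {g : X → ℝ≥0∞} (hg : Measurable g) :
    ∫⁻ z, g z ^ s ∂μ ≤ 2 ^ s * ∑' k : ℤ, e2 k ^ s * μ {z | e2 k < g z} := by
  calc ∫⁻ z, g z ^ s ∂μ ≤ ∫⁻ z, 2 ^ s * lev s (g z) ∂μ := lintegral_mono (fun z => le_lev hs _)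
    _ = 2 ^ s * ∫⁻ z, lev s (g z) ∂μ := by
        rw [lintegral_const_mul']
        exact ENNReal.rpow_ne_top_of_nonneg hs.le (by norm_num)
    _ = 2 ^ s * ∑' k : ℤ, e2 k ^ s * μ {z | e2 k < g z} := by
        congr 1
        unfold lev
        have hm : ∀ k, MeasurableSet {z | e2 k < g z} := fun k => measurableSet_lt measurable_const hg
        rw [lintegral_tsum]
        · congr 1; funext k
          rw [← setLIntegral_const, ← lintegral_indicator (hm k)]
          congr 1; funext z; simp only [indicator_apply, mem_ofPred_eq]
        · intro k
          exact (Measurable.ite (hm k) measurable_const measurable_const).aemeasurable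

theorem lev_lintegral_le {X : Type*} [MeasurableSpace X] {s : ℝ} (hs : 0 < s) :
    ∃ C : ℝ≥0∞, C ≠ ∞ ∧ C ≠ 0 ∧ ∀ (μ : Measure X) (g : X → ℝ≥0∞), Measurable g →
     ∑' k : ℤ, e2 k ^ s * μ {z | e2 k < g z} ≤ C * ∫⁻ z, g z ^ s ∂μ := by
  obtain ⟨C, h1, h2, h3⟩ := lev_le hs
  refine ⟨C, h1, h2, fun μ g hg => ?_⟩
  have hm : ∀ k, MeasurableSet {z | e2 k < g z} := fun k => measurableSet_lt measurable_const hg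
  calc _ = ∫⁻ z, lev s (g z) ∂μ := by
        unfold lev
        rw [lintegral_tsum]
        · congr 1; funext k
          rw [← setLIntegral_const, ← lintegral_indicator (hm k)]
          congr 1; funext z; simp only [indicator_apply, mem_ofPred_eq]
        · intro k
          exact (Measurable.ite (hm k) measurable_const measurable_const).aemeasurable
    _ ≤ ∫⁻ z, C * g z ^ s ∂μ := lintegral_mono (fun z => h3 _)
    _ = _ := lintegral_const_mul' _ _ h1

/-! ### The maximal function -/

/-- maximal function -/
def MM {n : ℕ} (p A : ℝ) (u : XX n → ℝ≥0∞) (y : XX n) : ℝ≥0∞ :=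
  ⨆ j : ℤ, (∫⁻ z in NB p y j A, u z) / mm n p j

theorem MM_measurable {n : ℕ} (p A : ℝ) {u : XX n → ℝ≥0∞} (hu : Measurable u) :
    Measurable (MM p A u) := by
  unfold MM
  refine Measurable.iSup fun j => Measurable.div ?_ measurable_const
  set S : Set (XX n × XX n) := {q | ‖q.2.1 - q.1.1‖ ≤ A * len j ∧ |q.2.2 - q.1.2| ≤ A * tau p j} with hS
  have hSm : MeasurableSet S := by
    rw [hS]
    apply MeasurableSet.inter
    · exact measurableSet_le (f := fun q : XX n × XX n => ‖q.2.1 - q.1.1‖) (by fun_prop) measurable_const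
    · exact measurableSet_le (f := fun q : XX n × XX n => |q.2.2 - q.1.2|) (by fun_prop) measurable_const
  have : (fun y : XX n => ∫⁻ z in NB p y j A, u z) =
      fun y => ∫⁻ z, S.indicator (fun q => u q.2) (y, z) := by
    funext y
    rw [← lintegral_indicator (NB_measurable p y j A)]
    congr 1
  rw [this]
  apply Measurable.lintegral_prod_right
  exact (hu.comp measurable_snd).indicator hSm

theorem le_MM {n : ℕ} (p A : ℝ) (u : XX n → ℝ≥0∞) (y : XX n) (j : ℤ) :
    ∫⁻ z in NB p y j A, u z ≤ MM p A u y * mm n p j := by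
  rw [← ENNReal.div_le_iff (mm_pos n p j) (mm_top n p j)]
  exact le_iSup (fun j => (∫⁻ z in NB p y j A, u z) / mm n p j) j

theorem MM_weak {n : ℕ} {p : ℝ} (hp : 1 ≤ p) {A : ℝ} (hA : 0 < A) :
    ∃ C : ℝ≥0∞, C ≠ ∞ ∧ C ≠ 0 ∧ ∀ (u : XX n → ℝ≥0∞) (t : ℝ≥0∞), t ≠ 0 → t ≠ ∞ →
      t * volume {y | t < MM p A u y} ≤ C * ∫⁻ z, u z := by
  refine ⟨ENNReal.ofReal ((2 * (2 * A)) ^ (n + 1)), ENNReal.ofReal_ne_top, ?_, ?_⟩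
  · simp only [ne_eq, ENNReal.ofReal_eq_zero, not_le]; positivity
  intro u t ht0 ht
  set C := ENNReal.ofReal ((2 * (2 * A)) ^ (n + 1)) with hC
  have hC0 : C ≠ 0 := by
    rw [hC]; simp only [ne_eq, ENNReal.ofReal_eq_zero, not_le]; positivity
  rcases eq_or_ne (∫⁻ z, u z) ∞ with hI | hI
  · rw [hI, ENNReal.mul_top hC0]; exact le_top
  set I := ∫⁻ z, u z with hId
  let B : XX n × ℤ → Set (XX n) := fun a => NB p a.1 a.2 A
  let T : Set (XX n × ℤ) := {a | t * mm n p a.2 < ∫⁻ z in B a, u z}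
  let δ : XX n × ℤ → ℝ := fun a => len a.2
  have hne : ∀ a, (interior (B a)).Nonempty := by
    intro a
    have h1 : 0 < A * len a.2 := mul_pos hA (len_pos _)
    have h2 : 0 < A * tau p a.2 := mul_pos hA (tau_pos _ _)
    refine ⟨a.1, ?_⟩
    simp only [B]
    rw [NB_eq, interior_prod_eq]
    exact ⟨Metric.ball_subset_interior_closedBall (Metric.mem_ball_self h1),
      Metric.ball_subset_interior_closedBall (Metric.mem_ball_self h2)⟩
  have hR : ∀ a ∈ T, δ a ≤ max 1 (I / t).toReal := by
    intro a ha
    have ha : t * mm n p a.2 < ∫⁻ z in B a, u z := ha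
    have h1 : mm n p a.2 ≤ I / t := by
      rw [ENNReal.le_div_iff_mul_le (Or.inl ht0) (Or.inl ht), mul_comm]
      exact ha.le.trans (setLIntegral_le_lintegral _ _)
    rcases le_or_gt 0 a.2 with h | h
    · apply le_max_of_le_right
      have h3 : δ a ≤ len a.2 ^ n * tau p a.2 := by
        have e1 : 1 ≤ len a.2 := by
          have := len_mono h; simpa [len] using this
        have e2 : len a.2 ≤ tau p a.2 := by
          unfold len tau
          apply zpow_le_zpow_right₀ (by norm_num)
          rw [Int.le_floor]
          have : (0:ℝ) ≤ a.2 := by exact_mod_cast h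
          nlinarith
        have e3 : 1 ≤ len a.2 ^ n := one_le_pow₀ e1
        simp only [δ]
        nlinarith [len_pos a.2]
      have : I / t ≠ ∞ := ENNReal.div_ne_top hI ht0
      have h4 := (ENNReal.ofReal_le_iff_le_toReal this).1 h1
      exact h3.trans h4
    · apply le_max_of_le_left
      have h7 := len_mono h.le; simpa only [δ, len, zpow_zero] using h7
  obtain ⟨v, hvT, hvd, hv⟩ := Vitali.exists_disjoint_subfamily_covering_enlargement B T δ (3 / 2)
    (by norm_num) (fun a _ => (len_pos _).le) _ hR (fun a _ => (hne a).mono interior_subset)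
  have hvc : v.Countable := hvd.countable_of_nonempty_interior (fun a _ => hne a)
  have hcov : {y | t < MM p A u y} ⊆ ⋃ b ∈ v, NB p b.1 b.2 (2 * A) := by
    intro y hy
    have hy : t < MM p A u y := hy
    unfold MM at hy
    obtain ⟨j, hj⟩ := lt_iSup_iff.1 hy
    rw [ENNReal.lt_div_iff_mul_lt (Or.inl (mm_pos n p j)) (Or.inl (mm_top n p j))] at hj
    obtain ⟨b, hb, ⟨x, hx1, hx2⟩, hδ⟩ := hv (y, j) hj
    have hjb : j ≤ b.2 := by
      by_contra hh
      have : len (b.2 + 1) ≤ len j := len_mono (by omega)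
      rw [len_add] at this
      have h1 : len 1 = 2 := by simp [len]
      rw [h1] at this
      simp only [δ] at hδ
      nlinarith [len_pos b.2]
    have hl := len_mono hjb
    have ht := tau_mono (p := p) (by linarith) hjb
    simp only [mem_iUnion, exists_prop]
    refine ⟨b, hb, ?_, ?_⟩
    · have e : y.1 - b.1.1 = (x.1 - b.1.1) - (x.1 - y.1) := by abel
      rw [e]
      refine (norm_sub_le _ _).trans ?_
      have := hx1.1; have := hx2.1
      nlinarith
    · have e : y.2 - b.1.2 = (x.2 - b.1.2) - (x.2 - y.2) := by abel
      rw [e]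
      refine (abs_sub _ _).trans ?_
      have := hx1.2; have := hx2.2
      nlinarith
  have hvcc : Countable v := hvc.to_subtype
  calc t * volume {y | t < MM p A u y} ≤ t * ∑' b : v, volume (NB p b.1.1 b.1.2 (2 * A)) := by
        gcongr
        refine (measure_mono hcov).trans ?_
        exact measure_biUnion_le _ hvc _
    _ = C * ∑' b : v, t * mm n p b.1.2 := by
        rw [← ENNReal.tsum_mul_left, ← ENNReal.tsum_mul_left]
        congr 1; funext b
        rw [vol_NB _ _ _ (by positivity)]; ring
    _ ≤ C * ∑' b : v, ∫⁻ z in B b.1, u z := by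
        gcongr with b
        exact (hvT b.2).le
    _ = C * ∫⁻ z in ⋃ b ∈ v, B b, u z := by
        rw [lintegral_biUnion hvc (fun b _ => NB_measurable _ _ _ _) hvd]
    _ ≤ C * I := by gcongr; exact setLIntegral_le_lintegral _ _

theorem MM_add_le {n : ℕ} (p A : ℝ) {u v : XX n → ℝ≥0∞} (hu : Measurable u) (y : XX n) :
    MM p A (fun z => u z + v z) y ≤ MM p A u y + MM p A v y := by
  unfold MM
  refine iSup_le fun j => ?_
  rw [lintegral_add_left hu, ENNReal.add_div]
  exact add_le_add (le_iSup (fun j => (∫⁻ z in NB p y j A, u z) / mm n p j) j)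
    (le_iSup (fun j => (∫⁻ z in NB p y j A, v z) / mm n p j) j)

theorem MM_bdd {n : ℕ} (p : ℝ) {A : ℝ} (hA : 0 ≤ A) {u : XX n → ℝ≥0∞} {c : ℝ≥0∞}
    (hu : ∀ z, u z ≤ c) (y : XX n) :
    MM p A u y ≤ c * ENNReal.ofReal ((2 * A) ^ (n + 1)) := by
  unfold MM
  refine iSup_le fun j => ?_
  rw [ENNReal.div_le_iff (mm_pos n p j) (mm_top n p j), mul_assoc, ← vol_NB p y j hA,
    ← setLIntegral_const]
  exact lintegral_mono hu

theorem MM_strong {n : ℕ} {p : ℝ} (hp : 1 ≤ p) {A : ℝ} (hA : 0 < A) {s : ℝ} (hs : 1 < s) :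
    ∃ C : ℝ≥0∞, C ≠ ∞ ∧ C ≠ 0 ∧ ∀ (u : XX n → ℝ≥0∞), Measurable u →
      ∫⁻ y, MM p A u y ^ s ≤ C * ∫⁻ z, u z ^ s := by
  obtain ⟨C1, hC1, hC1', h1⟩ := MM_weak (n := n) hp hA
  obtain ⟨C2, hC2, hC2', h2⟩ := lev_le (s := s - 1) (by linarith)
  set D := ENNReal.ofReal ((2 * A) ^ (n + 1)) with hD
  have hD0 : D ≠ 0 := by
    rw [hD]; simp only [ne_eq, ENNReal.ofReal_eq_zero, not_le]; positivity
  have hDt : D ≠ ∞ := ENNReal.ofReal_ne_top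
  set c : ℝ≥0∞ := (2 * D)⁻¹ with hc
  have hc0 : c ≠ 0 := by rw [hc]; simp [ENNReal.mul_ne_top, hDt]
  have hct : c ≠ ∞ := by rw [hc]; simp [hD0]
  have hcD : c * D = 2⁻¹ := by
    rw [hc, ENNReal.mul_inv (Or.inl (by norm_num)) (Or.inl (by norm_num)), mul_assoc,
      ENNReal.inv_mul_cancel hD0 hDt, mul_one]
  have hs1 : (2:ℝ≥0∞) ^ s ≠ ∞ := ENNReal.rpow_ne_top_of_nonneg (by linarith) (by norm_num)
  have hs2 : (2:ℝ≥0∞) ^ s ≠ 0 := by simp [ENNReal.rpow_eq_zero_iff]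
  have hs3 : (c⁻¹) ^ (s - 1) ≠ ∞ := ENNReal.rpow_ne_top_of_nonneg (by linarith) (by simp [hc0])
  have hs4 : (c⁻¹) ^ (s - 1) ≠ 0 := by
    rw [ne_eq, ENNReal.rpow_eq_zero_iff]; simp [hct, hc0]
  refine ⟨2 ^ s * (2 * C1 * (C2 * (c⁻¹) ^ (s - 1))), ?_, ?_, ?_⟩
  · exact ENNReal.mul_ne_top hs1 (ENNReal.mul_ne_top (ENNReal.mul_ne_top (by norm_num) hC1)
      (ENNReal.mul_ne_top hC2 hs3))
  · simp only [ne_eq, mul_eq_zero]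
    simp [hs2, hC1', hC2', hs4]
  intro u hu
  have hlev : ∀ k : ℤ, e2 k ^ s * volume {z | e2 k < MM p A u z} ≤
      2 * C1 * ∫⁻ z, u z * (if e2 k < c⁻¹ * u z then e2 k ^ (s - 1) else 0) := by
    intro k
    set a := c * e2 k with ha
    have hsetm : MeasurableSet {z | a < u z} := measurableSet_lt measurable_const hu
    set u1 : XX n → ℝ≥0∞ := {z | a < u z}.indicator u with hu1
    set u2 : XX n → ℝ≥0∞ := {z | a < u z}ᶜ.indicator u with hu2
    have hu1m : Measurable u1 := hu.indicator hsetm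
    have hu2b : ∀ z, u2 z ≤ a := by
      intro z
      rw [hu2]
      by_cases hz : a < u z
      · rw [indicator_of_notMem]; exact bot_le
        simpa using hz
      · rw [indicator_of_mem]; exact not_lt.1 hz
        simpa using hz
    have hsum : u = fun z => u1 z + u2 z := by
      funext z; rw [hu1, hu2, indicator_self_add_compl_apply]
    have hsub : {z | e2 k < MM p A u z} ⊆ {z | e2 k / 2 < MM p A u1 z} := by
      intro z hz
      have hz : e2 k < MM p A u z := hz
      have h3 : MM p A u z ≤ MM p A u1 z + e2 k / 2 := by
        conv_lhs => rw [hsum]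
        refine (MM_add_le p A hu1m z).trans ?_
        gcongr
        refine (MM_bdd p hA.le hu2b z).trans (le_of_eq ?_)
        rw [← hD, ha, mul_assoc, mul_comm (e2 k), ← mul_assoc, hcD, mul_comm, div_eq_mul_inv]
      have h4 := hz.trans_le h3
      by_contra hcon
      have hcon : ¬ (e2 k / 2 < MM p A u1 z) := hcon
      have h5 : MM p A u1 z + e2 k / 2 ≤ e2 k / 2 + e2 k / 2 := by
        gcongr; exact not_lt.1 hcon
      rw [ENNReal.add_halves] at h5
      exact absurd h4 (not_lt.2 h5)
    have hw := h1 u1 (e2 k / 2) (by simp [e2_pos]) (ENNReal.div_ne_top (e2_top k) (by norm_num))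
    have hpow : e2 k ^ s = e2 k ^ (s - 1) * (2 * (e2 k / 2)) := by
      rw [ENNReal.mul_div_cancel (by norm_num) (by norm_num)]
      conv_rhs => rw [← ENNReal.rpow_one (e2 k), ← ENNReal.rpow_mul, one_mul]
      rw [← ENNReal.rpow_add _ _ (e2_pos k) (e2_top k)]
      congr 1; ring
    calc e2 k ^ s * volume {z | e2 k < MM p A u z}
        ≤ e2 k ^ s * volume {z | e2 k / 2 < MM p A u1 z} := by gcongr
      _ = e2 k ^ (s - 1) * (2 * (e2 k / 2 * volume {z | e2 k / 2 < MM p A u1 z})) := by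
          rw [hpow]; ring
      _ ≤ e2 k ^ (s - 1) * (2 * (C1 * ∫⁻ z, u1 z)) := by gcongr
      _ = 2 * C1 * (e2 k ^ (s - 1) * ∫⁻ z, u1 z) := by ring
      _ = _ := by
          rw [← lintegral_const_mul _ hu1m]
          congr 2; funext z
          have hiff : e2 k < c⁻¹ * u z ↔ a < u z := by
            rw [ha, mul_comm c⁻¹, ← div_eq_mul_inv,
              ENNReal.lt_div_iff_mul_lt (Or.inl hc0) (Or.inl hct), mul_comm]
          by_cases hz : a < u z
          · rw [if_pos (hiff.2 hz), hu1, indicator_of_mem (by exact hz)]; ring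
          · rw [if_neg (fun h => hz (hiff.1 h)), hu1, indicator_of_notMem (by exact hz)]; simp
  calc ∫⁻ y, MM p A u y ^ s ≤ 2 ^ s * ∑' k : ℤ, e2 k ^ s * volume {z | e2 k < MM p A u z} :=
        lintegral_le_lev _ (by linarith) (MM_measurable p A hu)
    _ ≤ 2 ^ s * ∑' k : ℤ, 2 * C1 * ∫⁻ z, u z * (if e2 k < c⁻¹ * u z then e2 k ^ (s - 1) else 0) := by
        gcongr 2 ^ s * ?_; exact ENNReal.tsum_le_tsum hlev
    _ = 2 ^ s * (2 * C1 * ∫⁻ z, u z * lev (s - 1) (c⁻¹ * u z)) := by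
        rw [ENNReal.tsum_mul_left, ← lintegral_tsum]
        · congr 3; funext z; rw [ENNReal.tsum_mul_left]; rfl
        · intro k
          apply Measurable.aemeasurable
          apply hu.mul
          exact Measurable.ite (measurableSet_lt measurable_const (hu.const_mul _))
            measurable_const measurable_const
    _ ≤ 2 ^ s * (2 * C1 * ∫⁻ z, (C2 * (c⁻¹) ^ (s - 1)) * u z ^ s) := by
        gcongr 2 ^ s * (2 * C1 * ?_)
        refine lintegral_mono fun z => ?_
        calc u z * lev (s - 1) (c⁻¹ * u z) ≤ u z * (C2 * (c⁻¹ * u z) ^ (s - 1)) := by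
              gcongr; exact h2 _
          _ = (C2 * (c⁻¹) ^ (s - 1)) * u z ^ s := by
              rw [ENNReal.mul_rpow_of_nonneg _ _ (by linarith)]
              have : u z ^ s = u z * u z ^ (s - 1) := by
                conv_rhs => rw [← ENNReal.rpow_one (u z), ← ENNReal.rpow_mul, one_mul]
                rw [← ENNReal.rpow_add_of_nonneg _ _ (by norm_num) (by linarith)]
                congr 1; ring
              rw [this]; ring
    _ = _ := by
        rw [lintegral_const_mul' _ _ (ENNReal.mul_ne_top hC2 hs3)]; ring

end PW

namespace PW

/-! ### Weights -/

/-- the pair of weights, with the Muckenhoupt bound -/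
structure Wt (n : ℕ) (p γ θ : ℝ) (A : ℝ≥0∞) (w σ : XX n → ℝ≥0∞) : Prop where
  hw : Measurable w
  hs : Measurable σ
  wtop : ∀ z, w z ≠ ∞
  s0 : ∀ z, σ z ≠ 0
  prod : ∀ z, σ z ≠ ∞ → w z * σ z ^ θ = 1
  th : 0 < θ
  At : A ≠ ∞
  hp : 1 < p
  g0 : 0 < γ
  g1 : γ < 1
  bound : ∀ x t L, 0 < L → (∫⁻ z in parLow n p x t L γ, w z) *
    (∫⁻ z in parUp n p x t L γ, σ z) ^ θ ≤ A * volume (parLow n p x t L γ) ^ (1 + θ)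

theorem vol_parLow (n : ℕ) (p : ℝ) (x : Fin n → ℝ) (t : ℝ) {L : ℝ} (hL : 0 ≤ L) (γ : ℝ) :
    volume (parLow n p x t L γ) = ENNReal.ofReal ((2 * L) ^ n * ((1 - γ) * L ^ p)) := by
  have : parLow n p x t L γ = Metric.closedBall x L ×ˢ Ioo (t - L ^ p) (t - γ * L ^ p) := by
    ext y; simp [parLow, dist_eq_norm]
  rw [this, Measure.volume_eq_prod, Measure.prod_prod, Real.volume_pi_closedBall _ hL,
    Real.volume_Ioo, ← ENNReal.ofReal_mul (by positivity)]
  congr 1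
  simp only [Fintype.card_fin]; ring

theorem vol_parUp (n : ℕ) (p : ℝ) (x : Fin n → ℝ) (t : ℝ) {L : ℝ} (hL : 0 ≤ L) (γ : ℝ) :
    volume (parUp n p x t L γ) = ENNReal.ofReal ((2 * L) ^ n * ((1 - γ) * L ^ p)) := by
  have : parUp n p x t L γ = Metric.closedBall x L ×ˢ Ioo (t + γ * L ^ p) (t + L ^ p) := by
    ext y; simp [parUp, dist_eq_norm]
  rw [this, Measure.volume_eq_prod, Measure.prod_prod, Real.volume_pi_closedBall _ hL,
    Real.volume_Ioo, ← ENNReal.ofReal_mul (by positivity)]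
  congr 1
  simp only [Fintype.card_fin]; ring

section
variable {n : ℕ} {p γ θ : ℝ} {A : ℝ≥0∞} {w σ : XX n → ℝ≥0∞}

theorem holder (H : Wt n p γ θ A w σ) {E : Set (XX n)}
    (hfin : ∫⁻ z in E, σ z ≠ ∞) :
    volume E ^ (1 + θ) ≤ (∫⁻ z in E, w z) * (∫⁻ z in E, σ z) ^ θ := by
  have hθ := H.th
  have h1 : ∀ᵐ z ∂(volume.restrict E), σ z < ∞ := ae_lt_top H.hs hfin
  have hc : Real.HolderConjugate (1 + θ) ((1 + θ) / θ) := by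
    rw [Real.holderConjugate_iff]
    constructor
    · linarith
    · field_simp
  have h2 := ENNReal.lintegral_mul_le_Lp_mul_Lq (volume.restrict E) hc
    (f := fun z => w z ^ (1 / (1 + θ))) (g := fun z => σ z ^ (θ / (1 + θ)))
    (H.hw.pow_const _).aemeasurable (H.hs.pow_const _).aemeasurable
  have e1 : ∫⁻ z in E, ((fun z => w z ^ (1 / (1 + θ))) * (fun z => σ z ^ (θ / (1 + θ)))) z
      = volume E := by
    rw [← setLIntegral_one]
    apply lintegral_congr_ae
    filter_upwards [h1] with z hz
    have := H.prod z hz.ne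
    simp only [Pi.mul_apply]
    have e : θ / (1 + θ) = θ * (1 / (1 + θ)) := by ring
    rw [e, ENNReal.rpow_mul, ← ENNReal.mul_rpow_of_nonneg _ _ (by positivity), this,
      ENNReal.one_rpow]
  have e2 : ∀ z, (w z ^ (1 / (1 + θ))) ^ (1 + θ) = w z := by
    intro z; rw [← ENNReal.rpow_mul, one_div_mul_cancel (by positivity), ENNReal.rpow_one]
  have e3 : ∀ z, (σ z ^ (θ / (1 + θ))) ^ ((1 + θ) / θ) = σ z := by
    intro z; rw [← ENNReal.rpow_mul]
    have : θ / (1 + θ) * ((1 + θ) / θ) = 1 := by field_simp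
    rw [this, ENNReal.rpow_one]
  rw [e1] at h2
  simp only [e2, e3] at h2
  calc volume E ^ (1 + θ) ≤ _ := ENNReal.rpow_le_rpow h2 (by positivity)
    _ = _ := by
      rw [ENNReal.mul_rpow_of_nonneg _ _ (by positivity), ← ENNReal.rpow_mul, ← ENNReal.rpow_mul]
      congr 1
      · rw [one_div_mul_cancel (by positivity), ENNReal.rpow_one]
      · congr 1; field_simp

theorem link1 (H : Wt n p γ θ A w σ) {x : Fin n → ℝ} {t L : ℝ} (hL : 0 < L) {U U' : Set (XX n)}
    (hU : U ⊆ parLow n p x t L γ) (hU' : U' ⊆ parUp n p x t L γ) :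
    (∫⁻ z in U, w z) * (∫⁻ z in U', σ z) ^ θ ≤ A * volume (parLow n p x t L γ) ^ (1 + θ) := by
  refine le_trans ?_ (H.bound x t L hL)
  have := H.th
  gcongr

theorem link2 (H : Wt n p γ θ A w σ) {x : Fin n → ℝ} {t L : ℝ} (hL : 0 < L) {U U' : Set (XX n)}
    (hU : U ⊆ parLow n p x t L γ) (hU' : U' ⊆ parUp n p x t L γ) :
    (∫⁻ z in U, w z) * volume U' ^ (1 + θ) ≤
      A * volume (parLow n p x t L γ) ^ (1 + θ) * ∫⁻ z in U', w z := by
  have hθ := H.th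
  have h1 := link1 H hL hU hU'
  have hfin : A * volume (parLow n p x t L γ) ^ (1 + θ) ≠ ∞ := by
    apply ENNReal.mul_ne_top H.At
    apply ENNReal.rpow_ne_top_of_nonneg (by positivity)
    rw [vol_parLow n p x t hL.le]; exact ENNReal.ofReal_ne_top
  rcases eq_or_ne (∫⁻ z in U', σ z) ∞ with h | h
  · have : ∫⁻ z in U, w z = 0 := by
      by_contra h0
      rw [h, ENNReal.top_rpow_of_pos hθ, ENNReal.mul_top h0] at h1
      exact hfin (top_le_iff.1 h1)
    rw [this, zero_mul]; exact bot_le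
  · calc _ ≤ (∫⁻ z in U, w z) * ((∫⁻ z in U', w z) * (∫⁻ z in U', σ z) ^ θ) := by
          gcongr; exact holder H h
      _ = ((∫⁻ z in U, w z) * (∫⁻ z in U', σ z) ^ θ) * (∫⁻ z in U', w z) := by ring
      _ ≤ _ := by gcongr

/-- basic time lag constant -/
def K0 (p γ : ℝ) : ℝ := 8 / (1 - γ) + 8 * 2 ^ p

theorem step (hp : 1 < p) (g0 : 0 < γ) (g1 : γ < 1) (b : ℝ) :
    ∃ C : ℝ≥0∞, C ≠ ∞ ∧ ∀ (j : ℤ) (z v : XX n),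
    ‖v.1‖ ≤ len j → K0 p γ * tau p j ≤ v.2 → v.2 ≤ b * tau p j →
    ∃ (x : Fin n → ℝ) (t L : ℝ), 0 < L ∧ NB p z j 1 ⊆ parLow n p x t L γ ∧
      NB p (z + v) j 1 ⊆ parUp n p x t L γ ∧ volume (parLow n p x t L γ) ≤ C * mm n p j := by
  refine ⟨ENNReal.ofReal ((2 * b ^ (1 / p)) ^ n * b), ENNReal.ofReal_ne_top, ?_⟩
  intro j z v h1 h2 h3
  have hτ := tau_pos p j
  have hl := len_pos j
  have hp0 : 0 < p := by linarith
  have hg : 0 < 1 - γ := by linarith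
  have hK : 0 < K0 p γ := by unfold K0; positivity
  have hv : 0 < v.2 := lt_of_lt_of_le (by positivity) h2
  have hb : 0 < b := by
    by_contra hh
    nlinarith
  set Lp := v.2 / (1 + γ) with hLp
  have hLp0 : 0 < Lp := by positivity
  set L := Lp ^ (1 / p) with hL
  have hL0 : 0 < L := by positivity
  have hLL : L ^ p = Lp := by
    rw [hL, ← Real.rpow_mul hLp0.le, one_div_mul_cancel hp0.ne', Real.rpow_one]
  have hvv : v.2 = (1 + γ) * Lp := by rw [hLp]; field_simp
  have hlp : len j ^ p = (2:ℝ) ^ ((j:ℝ) * p) := by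
    unfold len; rw [← Real.rpow_intCast, ← Real.rpow_mul (by norm_num)]
  have hLτ : Lp ≥ (4 / (1 - γ) + 4 * 2 ^ p) * tau p j := by
    have : 2 * Lp ≥ K0 p γ * tau p j := by nlinarith
    unfold K0 at this
    have e : (8 / (1 - γ) + 8 * 2 ^ p) = 2 * (4 / (1 - γ) + 4 * 2 ^ p) := by ring
    rw [e] at this
    nlinarith
  have hLτ1 : (1 - γ) * Lp ≥ 4 * tau p j := by
    have e : (4 / (1 - γ)) * tau p j ≤ Lp := by
      have : 0 < 4 * (2:ℝ) ^ p * tau p j := by positivity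
      nlinarith
    rw [div_mul_eq_mul_div, div_le_iff₀ hg] at e
    linarith
  have hLl : 2 * len j ≤ L := by
    rw [← Real.rpow_le_rpow_iff (by positivity) hL0.le hp0, hLL, Real.mul_rpow (by norm_num) hl.le,
      hlp]
    have h5 := le_tau p j
    have h6 : (0:ℝ) < 2 ^ p := by positivity
    have : 0 < (4 / (1 - γ)) * tau p j := by positivity
    nlinarith
  have hLub : Lp ≤ b * tau p j := by nlinarith
  refine ⟨z.1 + (1/2 : ℝ) • v.1, z.2 + v.2 / 2, L, hL0, ?_, ?_, ?_⟩
  · rintro y ⟨hy1, hy2⟩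
    rw [abs_le] at hy2
    refine ⟨?_, ?_, ?_⟩
    · have e : y.1 - (z.1 + (1/2:ℝ) • v.1) = (y.1 - z.1) - (1/2:ℝ) • v.1 := by abel
      rw [e]
      refine (norm_sub_le _ _).trans ?_
      rw [norm_smul]; norm_num
      linarith
    · rw [hLL]; linarith
    · rw [hLL]; linarith
  · rintro y ⟨hy1, hy2⟩
    rw [abs_le] at hy2
    simp only [Prod.snd_add, Prod.fst_add] at hy1 hy2
    refine ⟨?_, ?_, ?_⟩
    · have e : y.1 - (z.1 + (1/2:ℝ) • v.1) = (y.1 - (z.1 + v.1)) + (1/2:ℝ) • v.1 := by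
        have : v.1 = (1/2:ℝ) • v.1 + (1/2:ℝ) • v.1 := by rw [← add_smul]; norm_num
        nth_rewrite 2 [this]; abel
      rw [e]
      refine (norm_add_le _ _).trans ?_
      rw [norm_smul]; norm_num
      linarith
    · rw [hLL]; linarith
    · rw [hLL]; linarith
  · rw [vol_parLow n p _ _ hL0.le, mm, ← ENNReal.ofReal_mul (by positivity)]
    apply ENNReal.ofReal_le_ofReal
    rw [hLL]
    have hLle : L ≤ b ^ (1/p) * len j := by
      rw [← Real.rpow_le_rpow_iff hL0.le (by positivity) hp0, hLL, Real.mul_rpow (by positivity) hl.le,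
        hlp, ← Real.rpow_mul hb.le, one_div_mul_cancel hp0.ne', Real.rpow_one]
      have := tau_le p j
      nlinarith
    calc (2 * L) ^ n * ((1 - γ) * Lp) ≤ (2 * (b ^ (1/p) * len j)) ^ n * (b * tau p j) := by
          have : (1 - γ) * Lp ≤ b * tau p j := by nlinarith
          gcongr
      _ = _ := by rw [← mul_assoc 2, mul_pow (2 * b ^ (1/p))]; ring

theorem link (H : Wt n p γ θ A w σ) (m : ℕ) (b : ℝ) :
    ∃ C : ℝ≥0∞, C ≠ ∞ ∧ ∀ (j : ℤ) (z z' : XX n),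
    ‖z'.1 - z.1‖ ≤ (m + 1) * len j → K0 p γ * (m + 1) * tau p j ≤ z'.2 - z.2 →
    z'.2 - z.2 ≤ b * tau p j →
    (∫⁻ y in NB p z j 1, w y) * (∫⁻ y in NB p z' j 1, σ y) ^ θ ≤ C * mm n p j ^ (1 + θ) := by
  have hθ := H.th
  have hg : 0 < 1 - γ := by linarith [H.g1]
  have hK : 0 < K0 p γ := by unfold K0; positivity
  obtain ⟨C, hC, hstep⟩ := step (n := n) H.hp H.g0 H.g1 b
  set D := A * C ^ (1 + θ) with hD
  have hDt : D ≠ ∞ := ENNReal.mul_ne_top H.At (ENNReal.rpow_ne_top_of_nonneg (by positivity) hC)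
  have hA : ∀ (j : ℤ) (V : ℝ≥0∞), V ≤ C * mm n p j → A * V ^ (1 + θ) ≤ D * mm n p j ^ (1 + θ) := by
    intro j V hV
    rw [hD, mul_assoc, ← ENNReal.mul_rpow_of_nonneg _ _ (by positivity)]
    gcongr
  refine ⟨D ^ m * D, ENNReal.mul_ne_top (ENNReal.pow_ne_top hDt) hDt, ?_⟩
  intro j z z' h1 h2 h3
  have hτ := tau_pos p j
  have hl := len_pos j
  have hm : (0:ℝ) < m + 1 := by positivity
  set v : XX n := ((m + 1 : ℝ)⁻¹) • (z' - z) with hv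
  have hv1 : ‖v.1‖ ≤ len j := by
    simp only [hv, Prod.smul_fst, Prod.fst_sub]
    rw [norm_smul, Real.norm_of_nonneg (by positivity), inv_mul_le_iff₀ hm]
    exact h1
  have hv2 : K0 p γ * tau p j ≤ v.2 := by
    simp only [hv, Prod.smul_snd, Prod.snd_sub, smul_eq_mul]
    rw [le_inv_mul_iff₀ hm]; linarith
  have hv3 : v.2 ≤ b * tau p j := by
    refine le_trans ?_ h3
    simp only [hv, Prod.smul_snd, Prod.snd_sub, smul_eq_mul]
    rw [inv_mul_le_iff₀ hm]
    have : 0 < K0 p γ * (m + 1) * tau p j := by positivity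
    have hm1 : (1:ℝ) ≤ m + 1 := by have : (0:ℝ) ≤ m := by positivity
                                   linarith
    nlinarith
  have hchain : ∀ k : ℕ, (∫⁻ y in NB p z j 1, w y) ≤ D ^ k * ∫⁻ y in NB p (z + (k:ℝ) • v) j 1, w y := by
    intro k
    induction k with
    | zero => simp
    | succ k ih =>
      refine ih.trans ?_
      rw [pow_succ, mul_assoc]
      gcongr
      obtain ⟨x, t, L, hL, s1, s2, s3⟩ := hstep j (z + (k:ℝ) • v) v hv1 hv2 hv3
      have e : z + ((k + 1 : ℕ) : ℝ) • v = z + (k:ℝ) • v + v := by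
        push_cast; rw [add_smul, one_smul]; abel
      rw [e]
      have h5 := link2 H hL s1 s2
      have h6 : mm n p j ≤ volume (NB p (z + (k:ℝ) • v + v) j 1) := by
        rw [← vol_cell p j (z + (k:ℝ) • v + v)]
        exact measure_mono (cell_sub_NB _ _ _)
      have h7 : (∫⁻ y in NB p (z + (k:ℝ) • v) j 1, w y) * mm n p j ^ (1 + θ) ≤
          (D * ∫⁻ y in NB p (z + (k:ℝ) • v + v) j 1, w y) * mm n p j ^ (1 + θ) := by
        calc _ ≤ (∫⁻ y in NB p (z + (k:ℝ) • v) j 1, w y) *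
              volume (NB p (z + (k:ℝ) • v + v) j 1) ^ (1 + θ) := by gcongr
          _ ≤ _ := h5
          _ ≤ D * mm n p j ^ (1 + θ) * (∫⁻ y in NB p (z + (k:ℝ) • v + v) j 1, w y) := by
              gcongr ?_ * _; exact hA j _ s3
          _ = _ := by ring
      have hm0 : mm n p j ^ (1 + θ) ≠ 0 := by
        rw [ne_eq, ENNReal.rpow_eq_zero_iff]; simp [mm_pos, mm_top]
      have hmt : mm n p j ^ (1 + θ) ≠ ∞ := ENNReal.rpow_ne_top_of_nonneg (by positivity) (mm_top _ _ _)
      exact (ENNReal.mul_le_mul_iff_left hm0 hmt).1 h7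
  obtain ⟨x, t, L, hL, s1, s2, s3⟩ := hstep j (z + (m:ℝ) • v) v hv1 hv2 hv3
  have e : z + (m:ℝ) • v + v = z' := by
    have : (m:ℝ) • v + v = ((m:ℝ) + 1) • v := by rw [add_smul, one_smul]
    rw [add_assoc, this, hv, smul_smul, mul_inv_cancel₀ hm.ne', one_smul]; abel
  rw [e] at s2
  calc _ ≤ (D ^ m * ∫⁻ y in NB p (z + (m:ℝ) • v) j 1, w y) * (∫⁻ y in NB p z' j 1, σ y) ^ θ := by
        gcongr; exact hchain m
    _ = D ^ m * ((∫⁻ y in NB p (z + (m:ℝ) • v) j 1, w y) * (∫⁻ y in NB p z' j 1, σ y) ^ θ) := by ring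
    _ ≤ D ^ m * (D * mm n p j ^ (1 + θ)) := by
        gcongr D ^ m * ?_; exact (link1 H hL s1 s2).trans (hA j _ s3)
    _ = _ := by ring

theorem setLIntegral_pos {σ : XX n → ℝ≥0∞} (hs : Measurable σ) (s0 : ∀ z, σ z ≠ 0) {E : Set (XX n)}
    (hE : volume E ≠ 0) : ∫⁻ z in E, σ z ≠ 0 := by
  rw [ne_eq, lintegral_eq_zero_iff hs]
  intro h
  apply hE
  have : ∀ᵐ z ∂(volume.restrict E), False := by
    filter_upwards [h] with z hz using s0 z hz
  rw [ae_iff] at this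
  simpa using this

theorem w_fin (H : Wt n p γ θ A w σ) (j : ℤ) (z : XX n) : ∫⁻ y in NB p z j 1, w y ≠ ∞ := by
  have hθ := H.th
  have hg : 0 < 1 - γ := by linarith [H.g1]
  have hK : 0 < K0 p γ := by unfold K0; positivity
  obtain ⟨C, hC, h⟩ := link H 0 (K0 p γ)
  have h1 := h j z (z.1, z.2 + K0 p γ * tau p j) (by simp [(len_pos j).le]) (by simp) (by simp)
  set z' : XX n := (z.1, z.2 + K0 p γ * tau p j)
  intro htop
  have h0 : (∫⁻ y in NB p z' j 1, σ y) ^ θ ≠ 0 := by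
    rw [ne_eq, ENNReal.rpow_eq_zero_iff_of_pos hθ]
    apply setLIntegral_pos H.hs H.s0
    intro h
    have h2 := measure_mono (μ := volume) (cell_sub_NB p j z')
    rw [h, vol_cell] at h2
    exact mm_pos n p j (le_bot_iff.1 h2)
  rw [htop, ENNReal.top_mul h0] at h1
  exact ENNReal.mul_ne_top hC (ENNReal.rpow_ne_top_of_nonneg (by positivity) (mm_top n p j)) (top_le_iff.1 h1)

theorem wcell_fin (H : Wt n p γ θ A w σ) (j : ℤ) (z : XX n) : ∫⁻ y in cell p j z, w y ≠ ∞ :=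
  ne_top_of_le_ne_top (w_fin H j z) (lintegral_mono_set (cell_sub_NB p j z))

end
end PW

namespace PW

section
variable {n : ℕ} {p γ θ : ℝ} {A : ℝ≥0∞} {w σ : XX n → ℝ≥0∞}

/-- integer time lag -/
def SS (p γ : ℝ) : ℕ := ⌈K0 p γ⌉₊

theorem SS_ge (p γ : ℝ) : K0 p γ ≤ SS p γ := Nat.le_ceil _

theorem rpow_ne0 {x : ℝ≥0∞} {s : ℝ} (h0 : x ≠ 0) (h1 : x ≠ ∞) : x ^ s ≠ 0 := by
  rw [ne_eq, ENNReal.rpow_eq_zero_iff]; simp [h0, h1]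

theorem rpow_neTop {x : ℝ≥0∞} {s : ℝ} (h0 : x ≠ 0) (h1 : x ≠ ∞) : x ^ s ≠ ∞ := by
  rw [ne_eq, ENNReal.rpow_eq_top_iff]; simp [h0, h1]

theorem cell_link (H : Wt n p γ θ A w σ) : ∃ C : ℝ≥0∞, C ≠ ∞ ∧ ∀ (j : ℤ) (z : XX n),
    (∫⁻ y in cell p j z, w y) * (∫⁻ y in cell p j (sh p j (SS p γ) z), σ y) ^ θ ≤
      C * mm n p j ^ (1 + θ) := by
  obtain ⟨C, hC, h⟩ := link H 0 (SS p γ)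
  refine ⟨C, hC, fun j z => ?_⟩
  have hτ := tau_pos p j
  refine le_trans ?_ (h j z (sh p j (SS p γ) z) (by simp [sh, (len_pos j).le]) ?_ (by simp [sh]))
  · have := H.th
    gcongr
    · exact cell_sub_NB _ _ _
    · exact cell_sub_NB _ _ _
  · simp only [sh]
    have := SS_ge p γ
    push_cast
    nlinarith

theorem lem_i (H : Wt n p γ θ A w σ) : ∃ c : ℝ≥0∞, c ≠ 0 ∧ c ≠ ∞ ∧
    ∀ (j : ℤ) (z : XX n) (a : ℝ≥0∞), a * mm n p j ≤ ∫⁻ y in cell p j z, w y →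
      volume ({y | w y < c * a} ∩ cell p j (sh p j (SS p γ) z)) ≤ mm n p j / 4 := by
  obtain ⟨C, hC, hlink⟩ := cell_link H
  have hθ := H.th
  have h4 : (4⁻¹ : ℝ≥0∞) ^ θ ≠ 0 := rpow_ne0 (by simp) (by simp)
  have h4t : (4⁻¹ : ℝ≥0∞) ^ θ ≠ ∞ := rpow_neTop (by simp) (by simp)
  have hC1 : C + 1 ≠ ∞ := by simp [hC]
  refine ⟨(4⁻¹ : ℝ≥0∞) ^ θ / (C + 1), by simp [hC1, h4], ENNReal.div_ne_top h4t (by simp), ?_⟩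
  intro j z a ha
  set c := (4⁻¹ : ℝ≥0∞) ^ θ / (C + 1) with hc
  have hcC : c * C ≤ (4⁻¹ : ℝ≥0∞) ^ θ := by
    calc c * C ≤ c * (C + 1) := by gcongr; exact le_self_add
      _ = _ := ENNReal.div_mul_cancel (by simp) hC1
  have hct : c ≠ ∞ := ENNReal.div_ne_top h4t (by simp)
  have m0 := mm_pos n p j
  have mt := mm_top n p j
  rcases eq_or_ne a 0 with rfl | ha0
  · have : {y | w y < c * 0} = ∅ := by ext y; simp
    rw [this]; simp
  have hl := hlink j z
  set Q := cell p j (sh p j (SS p γ) z) with hQ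
  set Iw := ∫⁻ y in cell p j z, w y with hIw
  have hIw0 : Iw ≠ 0 := fun h => by
    rw [h] at ha
    have := le_bot_iff.1 ha
    simp [ha0, m0] at this
  have hIwt : Iw ≠ ∞ := wcell_fin H j z
  have hat : a ≠ ∞ := fun h => by
    rw [h, ENNReal.top_mul m0] at ha
    exact hIwt (top_le_iff.1 ha)
  have hσ : ∫⁻ y in Q, σ y ≠ ∞ := fun h => by
    rw [h, ENNReal.top_rpow_of_pos hθ, ENNReal.mul_top hIw0] at hl
    exact ENNReal.mul_ne_top hC (rpow_neTop m0 mt) (top_le_iff.1 hl)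
  set E := {y | w y < c * a} ∩ Q with hE
  have hEQ : E ⊆ Q := inter_subset_right
  have hEm : MeasurableSet E := (measurableSet_lt H.hw measurable_const).inter (cell_measurable _ _ _)
  have hEt : volume E ≠ ∞ := by
    apply ne_top_of_le_ne_top mt
    rw [← vol_cell p j (sh p j (SS p γ) z)]; exact measure_mono hEQ
  rcases eq_or_ne (volume E) 0 with hE0 | hE0
  · rw [hE0]; exact bot_le
  have h1 := holder H (E := E) (ne_top_of_le_ne_top hσ (lintegral_mono_set hEQ))
  have h2 : ∫⁻ z in E, w z ≤ c * a * volume E := by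
    rw [← setLIntegral_const]
    apply setLIntegral_mono' hEm
    intro y hy; exact hy.1.le
  have h3 : volume E * volume E ^ θ ≤ volume E * (c * a * (∫⁻ y in Q, σ y) ^ θ) := by
    calc volume E * volume E ^ θ = volume E ^ (1 + θ) := by
          rw [ENNReal.rpow_add _ _ hE0 hEt, ENNReal.rpow_one]
      _ ≤ _ := h1
      _ ≤ (c * a * volume E) * (∫⁻ y in Q, σ y) ^ θ := by gcongr
      _ = _ := by ring
  have h4 : volume E ^ θ ≤ c * a * (∫⁻ y in Q, σ y) ^ θ := (ENNReal.mul_le_mul_iff_right hE0 hEt).1 h3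
  have h5 : mm n p j * volume E ^ θ ≤ mm n p j * (c * C * mm n p j ^ θ) := by
    calc mm n p j * volume E ^ θ ≤ mm n p j * (c * a * (∫⁻ y in Q, σ y) ^ θ) := by gcongr
      _ = c * ((a * mm n p j) * (∫⁻ y in Q, σ y) ^ θ) := by ring
      _ ≤ c * (C * mm n p j ^ (1 + θ)) := by
          gcongr c * ?_
          refine le_trans ?_ hl
          gcongr
      _ = _ := by rw [ENNReal.rpow_add _ _ m0 mt, ENNReal.rpow_one]; ring
  have h6 := (ENNReal.mul_le_mul_iff_right m0 mt).1 h5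
  rw [← ENNReal.rpow_le_rpow_iff hθ]
  calc volume E ^ θ ≤ _ := h6
    _ ≤ (4⁻¹ : ℝ≥0∞) ^ θ * mm n p j ^ θ := by gcongr
    _ = _ := by rw [← ENNReal.mul_rpow_of_nonneg _ _ hθ.le, mul_comm, div_eq_mul_inv]

theorem lem_iii (H : Wt n p γ θ A w σ) : ∃ c : ℝ≥0∞, c ≠ 0 ∧ c ≤ 1 ∧
    ∀ (K : ℝ≥0∞) (j : ℤ) (z : XX n) (a : ℝ≥0∞), a ≠ ∞ →
      a * mm n p j ≤ ∫⁻ y in cell p j z, min (σ y) K →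
      volume ({y | min (σ y) K < c * a} ∩ cell p j (sh p j (-(SS p γ : ℤ)) z)) ≤ mm n p j / 4 := by
  obtain ⟨C, hC, hlink⟩ := cell_link H
  have hθ := H.th
  have hC1 : C + 1 ≠ ∞ := by simp [hC]
  set c1 : ℝ≥0∞ := ((4:ℝ≥0∞)⁻¹ / (C + 1)) ^ (1 / θ) with hc1
  have h40 : (4:ℝ≥0∞)⁻¹ / (C + 1) ≠ 0 := by simp [hC1]
  have h4t : (4:ℝ≥0∞)⁻¹ / (C + 1) ≠ ∞ := ENNReal.div_ne_top (by simp) (by simp)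
  have hc10 : c1 ≠ 0 := rpow_ne0 h40 h4t
  refine ⟨min c1 1, ?_, min_le_right _ _, ?_⟩
  · intro h
    rcases min_choice c1 1 with h' | h' <;> rw [h'] at h
    · exact hc10 h
    · exact one_ne_zero h
  set c := min c1 1 with hc
  have hc1' : c ≤ 1 := min_le_right _ _
  have hct : c ≠ ∞ := ne_top_of_le_ne_top (by simp) hc1'
  have hcC : c ^ θ * C ≤ 4⁻¹ := by
    calc c ^ θ * C ≤ c1 ^ θ * (C + 1) := by
          gcongr
          · exact min_le_left _ _
          · exact le_self_add
      _ = (4:ℝ≥0∞)⁻¹ / (C + 1) * (C + 1) := by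
          rw [hc1, ← ENNReal.rpow_mul, one_div_mul_cancel hθ.ne', ENNReal.rpow_one]
      _ = _ := ENNReal.div_mul_cancel (by simp) hC1
  intro K j z a hat ha
  have m0 := mm_pos n p j
  have mt := mm_top n p j
  have hs : sh p j (SS p γ) (sh p j (-(SS p γ : ℤ)) z) = z := by
    simp only [sh]; ext <;> simp
  have hl := hlink j (sh p j (-(SS p γ : ℤ)) z)
  rw [hs] at hl
  have haK : a ≤ K := by
    have : a * mm n p j ≤ K * mm n p j := by
      refine ha.trans ?_
      rw [← vol_cell p j z, ← setLIntegral_const]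
      exact lintegral_mono (fun y => min_le_right _ _)
    exact (ENNReal.mul_le_mul_iff_left m0 mt).1 this
  have haσ : a * mm n p j ≤ ∫⁻ y in cell p j z, σ y :=
    ha.trans (lintegral_mono (fun y => min_le_left _ _))
  set P := cell p j (sh p j (-(SS p γ : ℤ)) z) with hP
  set E := {y | min (σ y) K < c * a} ∩ P with hE
  have hEQ : E ⊆ P := inter_subset_right
  have hEm : MeasurableSet E :=
    (measurableSet_lt (H.hs.min measurable_const) measurable_const).inter (cell_measurable _ _ _)
  have hEt : volume E ≠ ∞ := by
    apply ne_top_of_le_ne_top mt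
    rw [← vol_cell p j (sh p j (-(SS p γ : ℤ)) z)]; exact measure_mono hEQ
  rcases eq_or_ne (volume E) 0 with hE0 | hE0
  · rw [hE0]; exact bot_le
  have hσE : ∫⁻ z in E, σ z ≤ c * a * volume E := by
    rw [← setLIntegral_const]
    apply setLIntegral_mono' hEm
    intro y hy
    have h1 : min (σ y) K < c * a := hy.1
    have h2 : c * a ≤ K := by
      calc c * a ≤ 1 * K := by gcongr
        _ = K := one_mul _
    rcases min_lt_iff.1 h1 with h | h
    · exact h.le
    · exact absurd h (not_lt.2 h2)
  have hcat : c * a * volume E ≠ ∞ := ENNReal.mul_ne_top (ENNReal.mul_ne_top hct hat) hEt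
  have h1 := holder H (E := E) (ne_top_of_le_ne_top hcat hσE)
  have hEθ0 : volume E ^ θ ≠ 0 := rpow_ne0 hE0 hEt
  have hEθt : volume E ^ θ ≠ ∞ := rpow_neTop hE0 hEt
  have h3 : volume E ^ θ * volume E ≤ volume E ^ θ * (c ^ θ * (a ^ θ * (∫⁻ y in P, w y))) := by
    calc volume E ^ θ * volume E = volume E ^ (1 + θ) := by
          rw [ENNReal.rpow_add _ _ hE0 hEt, ENNReal.rpow_one, mul_comm]
      _ ≤ _ := h1
      _ ≤ (∫⁻ y in P, w y) * (c * a * volume E) ^ θ := by gcongr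
      _ = _ := by
          rw [ENNReal.mul_rpow_of_nonneg _ _ hθ.le, ENNReal.mul_rpow_of_nonneg _ _ hθ.le]; ring
  have h4 := (ENNReal.mul_le_mul_iff_right hEθ0 hEθt).1 h3
  have h5 : mm n p j ^ θ * volume E ≤ mm n p j ^ θ * (c ^ θ * C * mm n p j) := by
    calc mm n p j ^ θ * volume E ≤ mm n p j ^ θ * (c ^ θ * (a ^ θ * (∫⁻ y in P, w y))) := by gcongr
      _ = c ^ θ * ((∫⁻ y in P, w y) * (a * mm n p j) ^ θ) := by
          rw [ENNReal.mul_rpow_of_nonneg _ _ hθ.le]; ring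
      _ ≤ c ^ θ * (C * mm n p j ^ (1 + θ)) := by
          gcongr c ^ θ * ?_
          refine le_trans ?_ hl
          gcongr
      _ = _ := by rw [ENNReal.rpow_add _ _ m0 mt, ENNReal.rpow_one]; ring
  have h6 := (ENNReal.mul_le_mul_iff_right (rpow_ne0 m0 mt) (rpow_neTop m0 mt)).1 h5
  calc volume E ≤ _ := h6
    _ ≤ 4⁻¹ * mm n p j := by gcongr
    _ = _ := by rw [mul_comm, div_eq_mul_inv]

/-! ### Null sets -/

theorem exists_cell_sub (hp : 1 < p) {O : Set (XX n)} (hO : IsOpen O) {z : XX n} (hz : z ∈ O)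
    (j0 : ℤ) : ∃ j < j0, cell p j z ⊆ O := by
  obtain ⟨ε, hε, hb⟩ := Metric.isOpen_iff.1 hO z hz
  obtain ⟨k, hk⟩ := exists_pow_lt_of_lt_one hε (by norm_num : (1/2:ℝ) < 1)
  refine ⟨-(k:ℤ) - |j0| - 1, by have := neg_abs_le j0; omega, ?_⟩
  set j := -(k:ℤ) - |j0| - 1 with hj
  have hj0 : j ≤ 0 := by have := abs_nonneg j0; omega
  have hl : len j < ε := by
    have h1 : len j ≤ len (-(k:ℤ)) := len_mono (by have := abs_nonneg j0; omega)
    have h2 : len (-(k:ℤ)) = (1/2:ℝ) ^ k := by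
      unfold len; rw [zpow_neg, zpow_natCast]; simp
    linarith
  have ht : tau p j < ε := by
    refine lt_of_le_of_lt ?_ hl
    unfold tau len
    apply zpow_le_zpow_right₀ (by norm_num)
    have : ⌊(j:ℝ) * p⌋ ≤ ⌊(j:ℝ)⌋ := by
      apply Int.floor_le_floor
      have : (j:ℝ) ≤ 0 := by exact_mod_cast hj0
      nlinarith
    simpa using this
  intro y hy
  apply hb
  have := cell_sub_NB p j z hy
  rw [Metric.mem_ball, Prod.dist_eq, max_lt_iff, dist_eq_norm, dist_eq_norm]
  have h1 := this.1; have h2 := this.2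
  rw [one_mul] at h1 h2
  exact ⟨h1.trans_lt hl, h2.trans_lt ht⟩

theorem null_lemma (hp : 1 < p) {g : XX n → ℝ≥0∞} (hg : Measurable g) {lam : ℝ≥0∞} (l0 : lam ≠ 0)
    (lt : lam ≠ ∞) (j0 : ℤ) :
    ∀ᵐ z : XX n, 2 * lam < g z → ∃ j < j0, lam * mm n p j < ∫⁻ y in cell p j z, g y := by
  set Z : Set (XX n) := {z | 2 * lam < g z ∧ ∀ j < j0, ∫⁻ y in cell p j z, g y ≤ lam * mm n p j} with hZ
  have hcm : ∀ j, Measurable (fun z : XX n => ∫⁻ y in cell p j z, g y) := by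
    intro j
    apply fun_measurable (p := p) (j := j)
    intro z z' h; rw [cell_congr h]
  have hZm : MeasurableSet Z := by
    have : Z = {z | 2 * lam < g z} ∩ ⋂ j : ℤ, ⋂ (_ : j < j0), {z | ∫⁻ y in cell p j z, g y ≤ lam * mm n p j} := by
      ext z; simp [hZ]
    rw [this]
    apply (measurableSet_lt measurable_const hg).inter
    exact MeasurableSet.iInter fun j => MeasurableSet.iInter fun _ =>
      measurableSet_le (hcm j) measurable_const
  have key : ∀ Z' ⊆ Z, MeasurableSet Z' → volume Z' ≠ ∞ → volume Z' = 0 := by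
    intro Z' hZ' hm hfin
    by_contra h0
    have hlt : volume Z' < 2 * volume Z' := by
      rw [two_mul]; exact ENNReal.lt_add_right hfin h0
    obtain ⟨O, hO1, hO2, hO3⟩ := Set.exists_isOpen_lt_of_lt Z' _ hlt
    set G : ℤ → Set (XX n) := fun j => {z | j < j0 ∧ cell p j z ⊆ O ∧
      ∫⁻ y in cell p j z, g y ≤ lam * mm n p j} with hG
    have hsat : ∀ j z z', z ∈ G j → z' ∈ cell p j z → z' ∈ G j := by
      rintro j z z' ⟨a, b, c⟩ h
      refine ⟨a, ?_, ?_⟩ <;> rw [cell_congr h] <;> assumption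
    have h1 := czg (p := p) (by linarith) (volume.withDensity g) (lam • volume) G hsat (by
      intro j z hz
      rw [withDensity_apply _ (cell_measurable _ _ _), Measure.smul_apply, vol_cell]
      exact hz.2.2)
    have hGm : MeasurableSet (⋃ j, G j) := MeasurableSet.iUnion fun j => satg_measurable (hsat j)
    rw [withDensity_apply _ hGm, Measure.smul_apply, smul_eq_mul] at h1
    have hZG : Z' ⊆ ⋃ j, G j := by
      intro z hz
      obtain ⟨j, hj, hc⟩ := exists_cell_sub hp hO2 (hO1 hz) j0
      exact mem_iUnion.2 ⟨j, hj, hc, (hZ' hz).2 j hj⟩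
    have hGO : (⋃ j, G j) ⊆ O := by
      intro z hz
      obtain ⟨j, hj⟩ := mem_iUnion.1 hz
      exact hj.2.1 (mem_cell p j z)
    have h2 : lam * (2 * volume Z') ≤ lam * volume O := by
      calc lam * (2 * volume Z') = ∫⁻ _ in Z', 2 * lam := by rw [setLIntegral_const]; ring
        _ ≤ ∫⁻ y in Z', g y := by
            apply setLIntegral_mono' hm
            intro y hy; exact (hZ' hy).1.le
        _ ≤ ∫⁻ y in ⋃ j, G j, g y := lintegral_mono_set hZG
        _ ≤ _ := h1
        _ ≤ _ := by gcongr
    have h3 := (ENNReal.mul_le_mul_iff_right l0 lt).1 h2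
    exact absurd hO3 (not_lt.2 h3)
  have hZ0 : volume Z = 0 := by
    rw [← measure_iUnion_null_iff (s := fun i => Z ∩ spanningSets volume i)
      |>.2 (fun i => key _ inter_subset_left (hZm.inter (measurableSet_spanningSets _ i)) (by
        apply ne_top_of_le_ne_top (measure_spanningSets_lt_top (volume : Measure (XX n)) i).ne
        exact measure_mono inter_subset_right)), ← inter_iUnion, iUnion_spanningSets, inter_univ]
  rw [ae_iff]
  convert hZ0 using 2
  ext z
  simp [hZ]

/-! ### more level sums -/

theorem lev_le_two {s : ℝ} (hs : 1 ≤ s) (x : ℝ≥0∞) : lev s x ≤ 2 * x ^ s := by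
  have hs0 : 0 < s := by linarith
  have h2s : (2:ℝ≥0∞)⁻¹ ^ s ≤ 2⁻¹ := by
    calc (2:ℝ≥0∞)⁻¹ ^ s ≤ (2:ℝ≥0∞)⁻¹ ^ (1:ℝ) :=
          ENNReal.rpow_le_rpow_of_exponent_ge (by simp) hs
      _ = _ := ENNReal.rpow_one _
  rcases eq_or_ne x 0 with rfl | h0
  · simp [lev]
  rcases eq_or_ne x ∞ with rfl | hx
  · rw [ENNReal.top_rpow_of_pos hs0, ENNReal.mul_top (by simp)]; exact le_top
  obtain ⟨k0, h1, h2⟩ := e2_exists h0 hx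
  have hinj : Function.Injective (fun i : ℕ => k0 - (i : ℤ)) := by
    intro a b hab; simp only at hab; omega
  have : lev s x = ∑' i : ℕ, if e2 (k0 - i) < x then e2 (k0 - i) ^ s else 0 := by
    unfold lev
    rw [← hinj.tsum_eq (f := fun k => if e2 k < x then e2 k ^ s else 0)]
    intro k hk
    simp only [Function.mem_support, ne_eq, ite_eq_right_iff, Classical.not_imp] at hk
    have : k < k0 + 1 := e2_lt (hk.1.trans_le h2)
    exact ⟨(k0 - k).toNat, by simp only; omega⟩
  have hgeo : ∑' i : ℕ, (2:ℝ≥0∞)⁻¹ ^ i = 2 := by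
    rw [ENNReal.tsum_geometric, ENNReal.one_sub_inv_two, inv_inv]
  rw [this, ← hgeo, ← ENNReal.tsum_mul_right]
  apply ENNReal.tsum_le_tsum
  intro i
  split_ifs with h
  · rw [sub_eq_add_neg, e2_add, ENNReal.mul_rpow_of_nonneg _ _ hs0.le, mul_comm]
    gcongr
    rw [e2_neg]
    simp only [e2, zpow_natCast]
    rw [ENNReal.inv_pow, ← ENNReal.rpow_natCast, ← ENNReal.rpow_mul, mul_comm, ENNReal.rpow_mul,
      ENNReal.rpow_natCast, ENNReal.rpow_natCast]
    exact pow_le_pow_left' h2s i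
  · exact bot_le

theorem telescope {ε : ℝ} (hε : 0 < ε) (k0 : ℤ) {x : ℝ≥0∞} (hx : x ≠ ∞) :
    x ^ ε ≤ e2 k0 ^ ε + (2 ^ ε - 1) * ∑' i : ℕ, if e2 (k0 + i) < x then e2 (k0 + i) ^ ε else 0 := by
  have h1 : (1:ℝ≥0∞) ≤ 2 ^ ε := ENNReal.one_le_rpow (by norm_num) hε
  have hind : ∀ N : ℕ, e2 (k0 + N) ^ ε = e2 k0 ^ ε + (2 ^ ε - 1) * ∑ i ∈ Finset.range N, e2 (k0 + i) ^ ε := by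
    intro N
    induction N with
    | zero => simp
    | succ N ih =>
      rw [Finset.sum_range_succ, mul_add, ← add_assoc, ← ih]
      have : e2 (k0 + (N + 1 : ℕ)) = 2 * e2 (k0 + N) := by
        rw [← e2_succ]; push_cast; rw [add_assoc]
      rw [this, ENNReal.mul_rpow_of_nonneg _ _ hε.le]
      nth_rewrite 2 [← one_mul (e2 (k0 + N) ^ ε)]
      rw [← add_mul, add_tsub_cancel_of_le h1]
  rcases le_or_gt x (e2 k0) with h | h
  · refine le_trans ?_ le_self_add
    gcongr
  · have hx0 : x ≠ 0 := (bot_le.trans_lt h).ne'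
    obtain ⟨k, hk1, hk2⟩ := e2_exists hx0 hx
    have hkk : k0 ≤ k := by
      have := e2_lt (h.trans_le hk2); omega
    obtain ⟨N, rfl⟩ := Int.le.dest hkk
    calc x ^ ε ≤ e2 (k0 + (N + 1 : ℕ)) ^ ε := by
          gcongr
          refine hk2.trans (le_of_eq ?_); push_cast; rw [add_assoc]
      _ = _ := hind (N + 1)
      _ ≤ _ := by
        gcongr
        refine le_trans ?_ (ENNReal.sum_le_tsum (Finset.range (N + 1)))
        apply Finset.sum_le_sum
        intro i hi
        rw [if_pos]
        refine lt_of_le_of_lt (e2_mono ?_) hk1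
        rw [Finset.mem_range] at hi; omega

theorem small_exp {D η : ℝ≥0∞} (hD : D ≠ ∞) (hη : η ≠ 0) : ∃ ε : ℝ, 0 < ε ∧ ε ≤ 1 ∧ D ^ ε ≤ 1 + η := by
  have hb : ∀ N : ℕ, 1 + N * η ≤ (1 + η) ^ N := by
    intro N
    induction N with
    | zero => simp
    | succ N ih =>
      calc (1:ℝ≥0∞) + (N + 1 : ℕ) * η = (1 + N * η) * 1 + 1 * η := by push_cast; ring
        _ ≤ (1 + η) ^ N * 1 + (1 + η) ^ N * η := by
            gcongr
            exact le_trans le_self_add ih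
        _ = _ := by ring
  obtain ⟨N, hN⟩ := ENNReal.exists_nat_mul_gt hη hD
  refine ⟨1 / ((N:ℝ) + 1), by positivity, ?_, ?_⟩
  · rw [div_le_one (by positivity)]; linarith [(Nat.cast_nonneg N : (0:ℝ) ≤ N)]
  · calc D ^ (1 / ((N:ℝ) + 1)) ≤ ((1 + η) ^ (N + 1)) ^ (1 / ((N:ℝ) + 1)) := by
          gcongr
          calc D ≤ N * η := hN.le
            _ ≤ 1 + N * η := le_add_self
            _ ≤ _ := hb N
            _ ≤ _ := pow_le_pow_right₀ le_self_add (by omega)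
      _ = 1 + η := by
          rw [← ENNReal.rpow_natCast, ← ENNReal.rpow_mul]
          push_cast
          rw [mul_one_div_cancel (by positivity), ENNReal.rpow_one]

end
end PW

namespace PW

section
variable {n : ℕ} {p γ θ : ℝ} {A : ℝ≥0∞} {w σ : XX n → ℝ≥0∞}

/-- Region ahead of `z`. -/
def WR {n : ℕ} (p A1 b1 b2 : ℝ) (j : ℤ) (z : XX n) (ρ : ℝ) : Set (XX n) :=
  {y | ‖y.1 - z.1‖ ≤ (A1 + ρ) * len j ∧ (b1 - ρ) * tau p j ≤ y.2 - z.2 ∧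
    y.2 - z.2 ≤ (b2 + ρ) * tau p j}

theorem WR_measurable (p A1 b1 b2 : ℝ) (j : ℤ) (z : XX n) (ρ : ℝ) :
    MeasurableSet (WR p A1 b1 b2 j z ρ) := by
  unfold WR
  apply MeasurableSet.inter
  · exact measurableSet_le (f := fun y : XX n => ‖y.1 - z.1‖) (by fun_prop) measurable_const
  apply MeasurableSet.inter
  · exact measurableSet_le (g := fun y : XX n => y.2 - z.2) measurable_const (by fun_prop)
  · exact measurableSet_le (f := fun y : XX n => y.2 - z.2) (by fun_prop) measurable_const

theorem WR_mono {p A1 b1 b2 : ℝ} {j : ℤ} {z : XX n} {ρ ρ' : ℝ} (h : ρ ≤ ρ') :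
    WR p A1 b1 b2 j z ρ ⊆ WR p A1 b1 b2 j z ρ' := by
  rintro y ⟨h1, h2, h3⟩
  have := len_pos j
  have := tau_pos p j
  refine ⟨?_, ?_, ?_⟩ <;> nlinarith

theorem WR_geo {p A1 b1 b2 : ℝ} (hp : 1 < p) {j : ℤ} {z y y0 : XX n} {ρ : ℝ} (s i : ℕ)
    (hy0 : y0 ∈ WR p A1 b1 b2 j z ρ)
    (h1 : ‖y.1 - y0.1‖ ≤ (s + 2) * len (j - (i + (s + 2) : ℕ)))
    (h2 : |y.2 - y0.2| ≤ (s + 2) * tau p (j - (i + (s + 2) : ℕ))) :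
    y ∈ WR p A1 b1 b2 j z (ρ + (1/2) ^ i) := by
  obtain ⟨a1, a2, a3⟩ := hy0
  have hl := len_pos j
  have ht := tau_pos p j
  have hs : ((s:ℝ) + 2) ≤ 2 ^ (s + 2) := by
    have : s + 2 < 2 ^ (s + 2) := Nat.lt_two_pow_self
    exact_mod_cast this.le
  have hlen : len (-((i + (s + 2) : ℕ) : ℤ)) = (1/2) ^ i * ((2:ℝ) ^ (s + 2))⁻¹ := by
    unfold len
    rw [zpow_neg, zpow_natCast, pow_add, mul_inv]; simp
  have hsm : ((s:ℝ) + 2) * len (-((i + (s + 2) : ℕ) : ℤ)) ≤ (1/2) ^ i := by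
    rw [hlen]
    have : ((s:ℝ) + 2) * ((2:ℝ) ^ (s + 2))⁻¹ ≤ 1 := by
      rw [mul_inv_le_iff₀ (by positivity)]; linarith
    have h0 : (0:ℝ) < (1/2) ^ i := by positivity
    nlinarith
  have e1 : ((s:ℝ) + 2) * len (j - (i + (s + 2) : ℕ)) ≤ (1/2) ^ i * len j := by
    rw [sub_eq_add_neg, len_add]
    nlinarith
  have e2 : ((s:ℝ) + 2) * tau p (j - (i + (s + 2) : ℕ)) ≤ (1/2) ^ i * tau p j := by
    have := tau_small hp.le j (i + (s + 2))
    have h0 : (0:ℝ) < s + 2 := by positivity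
    calc ((s:ℝ) + 2) * tau p (j - (i + (s + 2) : ℕ)) ≤
        (s + 2) * (tau p j * len (-((i + (s + 2) : ℕ) : ℤ))) := by gcongr
      _ = ((s + 2) * len (-((i + (s + 2) : ℕ) : ℤ))) * tau p j := by ring
      _ ≤ _ := by gcongr
  have h2' := abs_le.1 (h2.trans e2)
  refine ⟨?_, by linarith [h2'.1], by linarith [h2'.2]⟩
  have : y.1 - z.1 = (y.1 - y0.1) + (y0.1 - z.1) := by abel
  rw [this]
  refine (norm_add_le _ _).trans ?_
  linarith

theorem good_lambda (H : Wt n p γ θ A w σ) : ∃ C3 c : ℝ≥0∞, C3 ≠ ∞ ∧ c ≠ 0 ∧ c ≤ 1 ∧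
    ∀ (A1 b1 b2 : ℝ) (K : ℝ≥0∞) (j : ℤ) (z : XX n) (ρ : ℝ) (i : ℕ), ρ + (1/2) ^ i ≤ 1 →
    ∀ lam : ℝ≥0∞, lam ≠ 0 → lam ≠ ∞ →
    ∫⁻ y in WR p A1 b1 b2 j z 1, σ y ≤ lam * mm n p (j - (i + (SS p γ + 2) : ℕ)) →
    ∫⁻ y in WR p A1 b1 b2 j z ρ ∩ {y | 2 * lam < min (σ y) K}, min (σ y) K ≤
      C3 * lam * volume (WR p A1 b1 b2 j z (ρ + (1/2) ^ i) ∩ {y | c * lam ≤ min (σ y) K}) := by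
  have hp := H.hp
  obtain ⟨c, hc0, hc1, hiii⟩ := lem_iii H
  obtain ⟨Cd, hCd, hCd0, hdoub⟩ := mm_shift n p 1
  obtain ⟨C1, hC1, hC10, hweak⟩ := MM_weak (n := n) hp.le (A := (SS p γ : ℝ) + 1) (by positivity)
  refine ⟨2 * C1 * Cd, c, ENNReal.mul_ne_top (ENNReal.mul_ne_top (by norm_num) hC1) hCd, hc0, hc1, ?_⟩
  intro A1 b1 b2 K j z ρ i hρ lam l0 lt hS
  set s := SS p γ with hs
  set j0 := j - ((i + (s + 2) : ℕ) : ℤ) with hj0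
  set g : XX n → ℝ≥0∞ := fun y => min (σ y) K with hg
  have hgm : Measurable g := H.hs.min measurable_const
  set ρ' := ρ + (1/2) ^ i with hρ'
  set Wρ := WR p A1 b1 b2 j z ρ with hWρ
  set Wρ' := WR p A1 b1 b2 j z ρ' with hWρ'
  set W1 := WR p A1 b1 b2 j z 1 with hW1
  set G : ℤ → Set (XX n) := fun j' => {y | j' < j0 ∧ (cell p j0 y ∩ Wρ).Nonempty ∧
    lam * mm n p j' < ∫⁻ x in cell p j' y, g x ∧
    ∫⁻ x in cell p (j' + 1) y, g x ≤ lam * mm n p (j' + 1)} with hG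
  have hsat : ∀ j y y', y ∈ G j → y' ∈ cell p j y → y' ∈ G j := by
    rintro j' y y' ⟨a1, a2, a3, a4⟩ h
    refine ⟨a1, ?_, ?_, ?_⟩
    · rwa [cell_congr (cell_mono (by linarith) a1.le y h)]
    · rwa [cell_congr h]
    · rwa [cell_congr (cell_mono (by linarith) (by omega) y h)]
  have h1 := czg (p := p) (by linarith) (volume.withDensity g) ((lam * Cd) • volume) G hsat (by
    intro j' y hy
    rw [withDensity_apply _ (cell_measurable _ _ _), Measure.smul_apply, vol_cell]
    refine (lintegral_mono_set (cell_mono (by linarith) (by omega : j' ≤ j' + 1) y)).trans ?_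
    refine hy.2.2.2.trans ?_
    rw [smul_eq_mul, mul_assoc]
    gcongr
    exact hdoub j')
  have hGm : MeasurableSet (⋃ j, G j) := MeasurableSet.iUnion fun j => satg_measurable (hsat j)
  set Om := ⋃ j, G j with hOm
  rw [withDensity_apply _ hGm, Measure.smul_apply, smul_eq_mul] at h1
  -- cells stay inside the larger region
  have hin : ∀ y, (cell p j0 y ∩ Wρ).Nonempty → cell p j0 y ⊆ Wρ' := by
    rintro y ⟨y0, hy0, hy0W⟩ x hx
    have hx0 : x ∈ cell p j0 y0 := by rw [cell_congr hy0]; exact hx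
    obtain ⟨e1, e2⟩ := cell_sub_NB p j0 y0 hx0
    have := len_pos j0
    have := tau_pos p j0
    have hs0 : (0:ℝ) ≤ s := by positivity
    exact WR_geo hp s i hy0W (e1.trans (by nlinarith)) (e2.trans (by nlinarith))
  set Bad := Wρ' ∩ {y | c * lam ≤ g y} with hBad
  have hBm : MeasurableSet Bad :=
    (WR_measurable _ _ _ _ _ _ _).inter (measurableSet_le measurable_const hgm)
  have hsub : Om ⊆ {y | (2:ℝ≥0∞)⁻¹ < MM p ((s:ℝ) + 1) (Bad.indicator 1) y} := by
    intro y hy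
    obtain ⟨j', a1, ⟨y0, hy0, hy0W⟩, a3, a4⟩ := mem_iUnion.1 hy
    have hsmall := hiii K j' y lam lt a3.le
    set P := cell p j' (sh p j' (-(s:ℤ)) y) with hP
    have m0 := mm_pos n p j'
    have mt := mm_top n p j'
    have htau0 := tau_pos p j'
    have hlen0 := len_pos j'
    have htau := tau_mono (p := p) (by linarith) a1.le
    have hlen := len_mono a1.le
    have hPNB : P ⊆ NB p y j' ((s:ℝ) + 1) := by
      intro x hx
      obtain ⟨e1, e2⟩ := cell_sub_NB _ _ _ hx
      simp only [sh] at e1 e2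
      have hs0 : (0:ℝ) ≤ s := by positivity
      refine ⟨e1.trans (by nlinarith), ?_⟩
      rw [abs_le] at e2 ⊢
      push_cast at e2
      constructor <;> nlinarith
    have hPW : P ⊆ Wρ' := by
      intro x hx
      obtain ⟨e1, e2⟩ := cell_sub_NB _ _ _ hx
      obtain ⟨f1, f2⟩ := cell_sub_NB _ _ _ (sat_cell hy0)
      simp only [sh] at e1 e2
      have hs0 : (0:ℝ) ≤ s := by positivity
      refine WR_geo hp s i hy0W ?_ ?_
      · have : x.1 - y0.1 = (x.1 - y.1) + (y.1 - y0.1) := by abel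
        rw [this]
        refine (norm_add_le _ _).trans ?_
        nlinarith
      · rw [abs_le] at e2 f2 ⊢
        push_cast at e2
        constructor <;> nlinarith
    have hvol : volume P ≤ volume (Bad ∩ P) + mm n p j' / 4 := by
      refine le_trans ?_ (add_le_add le_rfl hsmall)
      refine le_trans (measure_mono ?_) (measure_union_le _ _)
      intro x hx
      rcases lt_or_ge (g x) (c * lam) with h | h
      · right; exact ⟨h, hx⟩
      · left; exact ⟨⟨hPW hx, h⟩, hx⟩
    rw [hP, vol_cell, ← hP] at hvol
    have hIn0 : volume (Bad ∩ P) ≤ MM p ((s:ℝ) + 1) (Bad.indicator 1) y * mm n p j' := by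
      refine le_trans ?_ (le_MM p _ _ y j')
      refine le_trans ?_ (lintegral_mono_set hPNB)
      rw [lintegral_indicator_one hBm, Measure.restrict_apply hBm]
    show (2:ℝ≥0∞)⁻¹ < _
    by_contra hcon
    have hcon := not_lt.1 hcon
    have : mm n p j' ≤ 2⁻¹ * mm n p j' + mm n p j' / 4 := by
      refine hvol.trans ?_
      gcongr
      exact hIn0.trans (by gcongr)
    have e : (2:ℝ≥0∞)⁻¹ * mm n p j' + mm n p j' / 4 = (2⁻¹ + 4⁻¹) * mm n p j' := by
      rw [div_eq_mul_inv]; ring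
    rw [e] at this
    have h34 : (2⁻¹ + 4⁻¹ : ℝ≥0∞) < 1 := by
      have : (4:ℝ≥0∞)⁻¹ < 2⁻¹ := by
        rw [ENNReal.inv_lt_inv]; norm_num
      calc (2⁻¹ + 4⁻¹ : ℝ≥0∞) < 2⁻¹ + 2⁻¹ := by
            exact ENNReal.add_lt_add_left (by simp) this
        _ = 1 := ENNReal.inv_two_add_inv_two
    have h35 : (2⁻¹ + 4⁻¹ : ℝ≥0∞) * mm n p j' < 1 * mm n p j' :=
      (ENNReal.mul_lt_mul_iff_left m0 mt).2 h34
    rw [one_mul] at h35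
    exact absurd h35 (not_lt.2 this)
  have hOmvol : volume Om ≤ 2 * (C1 * volume Bad) := by
    have := hweak (Bad.indicator 1) (2⁻¹) (by simp) (by simp)
    rw [lintegral_indicator_one hBm] at this
    calc volume Om = 2 * (2⁻¹ * volume Om) := by
          rw [← mul_assoc, ENNReal.mul_inv_cancel (by norm_num) (by norm_num), one_mul]
      _ ≤ 2 * (2⁻¹ * volume {y | (2:ℝ≥0∞)⁻¹ < MM p ((s:ℝ) + 1) (Bad.indicator 1) y}) := by
          gcongr
      _ ≤ _ := by gcongr
  have hae : (Wρ ∩ {y | 2 * lam < g y} : Set (XX n)) ≤ᵐ[volume] Om := by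
    filter_upwards [null_lemma hp hgm l0 lt j0] with y hy
    rintro ⟨hyW, hyl⟩
    obtain ⟨j1, hj1, hj1'⟩ := hy hyl
    obtain ⟨k, ⟨hk1, hk2⟩, hk3⟩ := Int.exists_greatest_of_bdd
      (P := fun j' => j' < j0 ∧ lam * mm n p j' < ∫⁻ x in cell p j' y, g x)
      ⟨j0, fun z h => h.1.le⟩ ⟨j1, hj1, hj1'⟩
    refine mem_iUnion.2 ⟨k, hk1, ⟨y, mem_cell p j0 y, hyW⟩, hk2, ?_⟩
    rcases lt_or_ge (k + 1) j0 with h | h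
    · by_contra hcon
      have := hk3 (k + 1) ⟨h, not_le.1 hcon⟩
      omega
    · have e : k + 1 = j0 := by omega
      rw [e]
      refine le_trans ?_ hS
      refine le_trans (lintegral_mono (fun x => min_le_left _ _)) (lintegral_mono_set ?_)
      exact (hin y ⟨y, mem_cell p j0 y, hyW⟩).trans (WR_mono hρ)
  calc ∫⁻ y in Wρ ∩ {y | 2 * lam < g y}, g y ≤ ∫⁻ y in Om, g y := lintegral_mono_set' hae
    _ ≤ lam * Cd * volume Om := h1
    _ ≤ lam * Cd * (2 * (C1 * volume Bad)) := by gcongr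
    _ = _ := by ring

theorem rh_step (H : Wt n p γ θ A w σ) : ∃ C4 : ℝ≥0∞, C4 ≠ ∞ ∧
    ∀ (A1 b1 b2 : ℝ) (K : ℝ≥0∞), K ≠ ∞ → ∀ (j : ℤ) (z : XX n) (ρ : ℝ) (i : ℕ), ρ + (1/2) ^ i ≤ 1 →
    ∀ ε : ℝ, 0 < ε → ε ≤ 1 → ∀ S : ℝ≥0∞, S = ∫⁻ y in WR p A1 b1 b2 j z 1, σ y → S ≠ 0 → S ≠ ∞ →
    ∫⁻ y in WR p A1 b1 b2 j z ρ, (min (σ y) K) ^ (1 + ε) ≤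
      (4 * (S / mm n p (j - (i + (SS p γ + 2) : ℕ)))) ^ ε * S +
      C4 * (2 ^ ε - 1) * ∫⁻ y in WR p A1 b1 b2 j z (ρ + (1/2) ^ i), (min (σ y) K) ^ (1 + ε) := by
  obtain ⟨C3, c, hC3, hc0, hc1, hgl⟩ := good_lambda H
  have hct : c ≠ ∞ := ne_top_of_le_ne_top (by simp) hc1
  have h2c : 2 * c⁻¹ ≠ ∞ := ENNReal.mul_ne_top (by norm_num) (by simp [hc0])
  refine ⟨2 * C3 * (2 * (2 * c⁻¹) ^ (2:ℝ)), ?_, ?_⟩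
  · exact ENNReal.mul_ne_top (ENNReal.mul_ne_top (by norm_num) hC3) (ENNReal.mul_ne_top (by norm_num)
      (ENNReal.rpow_ne_top_of_nonneg (by norm_num) h2c))
  intro A1 b1 b2 K hK j z ρ i hρ ε hε hε1 S hS hS0 hSt
  set m0 := mm n p (j - (i + (SS p γ + 2) : ℕ)) with hm0
  have hm00 : m0 ≠ 0 := mm_pos _ _ _
  have hm0t : m0 ≠ ∞ := mm_top _ _ _
  set g : XX n → ℝ≥0∞ := fun y => min (σ y) K with hg
  have hgm : Measurable g := H.hs.min measurable_const
  have hgt : ∀ y, g y ≠ ∞ := fun y => ne_top_of_le_ne_top hK (min_le_right _ _)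
  set Wρ := WR p A1 b1 b2 j z ρ with hWρ
  set Wρ' := WR p A1 b1 b2 j z (ρ + (1/2) ^ i) with hWρ'
  have hWm : MeasurableSet Wρ := WR_measurable _ _ _ _ _ _ _
  have hWm' : MeasurableSet Wρ' := WR_measurable _ _ _ _ _ _ _
  set lam0 := S / m0 with hlam0
  have hl0 : lam0 ≠ 0 := by simp [hlam0, hS0, hm0t]
  have hlt : lam0 ≠ ∞ := ENNReal.div_ne_top hSt hm00
  obtain ⟨k, hk1, hk2⟩ := e2_exists hl0 hlt
  set k0 := k + 1 with hk0
  have hgl' : ∀ i' : ℕ, ∫⁻ y in Wρ ∩ {y | 2 * e2 (k0 + i') < g y}, g y ≤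
      C3 * e2 (k0 + i') * volume (Wρ' ∩ {y | c * e2 (k0 + i') ≤ g y}) := by
    intro i'
    refine hgl A1 b1 b2 K j z ρ i hρ (e2 (k0 + i')) (e2_pos _) (e2_top _) ?_
    rw [← hS, ← ENNReal.div_le_iff hm00 hm0t]
    exact hk2.trans (e2_mono (by omega))
  have h2ε : ∀ i' : ℕ, e2 (k0 + 1 + i') = 2 * e2 (k0 + i') := by
    intro i'; rw [← e2_succ]; congr 1; ring
  have hpt : ∀ y, g y ^ (1 + ε) ≤ e2 (k0 + 1) ^ ε * g y + (2 ^ ε - 1) * ∑' i' : ℕ,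
      e2 (k0 + 1 + i') ^ ε * ({y | 2 * e2 (k0 + i') < g y}.indicator g y) := by
    intro y
    rw [ENNReal.rpow_add_of_nonneg _ _ (by norm_num) hε.le, ENNReal.rpow_one]
    calc g y * g y ^ ε ≤ g y * (e2 (k0 + 1) ^ ε + (2 ^ ε - 1) * ∑' i' : ℕ,
          if e2 (k0 + 1 + i') < g y then e2 (k0 + 1 + i') ^ ε else 0) := by
          gcongr g y * ?_; exact telescope hε (k0 + 1) (hgt y)
      _ = e2 (k0 + 1) ^ ε * g y + (2 ^ ε - 1) * (g y * ∑' i' : ℕ,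
          if e2 (k0 + 1 + i') < g y then e2 (k0 + 1 + i') ^ ε else 0) := by ring
      _ = _ := by
        congr 2
        rw [← ENNReal.tsum_mul_left]
        congr 1; funext i'
        rw [h2ε]
        by_cases h : 2 * e2 (k0 + i') < g y
        · rw [if_pos h, indicator_of_mem (by exact h), mul_comm]
        · rw [if_neg h, indicator_of_notMem (by exact h)]; simp
  have hsetm : ∀ i' : ℕ, MeasurableSet {y | 2 * e2 (k0 + i') < g y} := fun i' =>
    measurableSet_lt measurable_const hgm
  have hsetm' : ∀ i' : ℕ, MeasurableSet {y | c * e2 (k0 + i') ≤ g y} := fun i' =>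
    measurableSet_le measurable_const hgm
  have h21 : (2:ℝ≥0∞) ^ ε ≤ 2 := by
    calc (2:ℝ≥0∞) ^ ε ≤ 2 ^ (1:ℝ) := ENNReal.rpow_le_rpow_of_exponent_le (by norm_num) hε1
      _ = 2 := ENNReal.rpow_one _
  have hsum : ∑' i' : ℕ, e2 (k0 + i') ^ (1 + ε) * volume (Wρ' ∩ {y | c * e2 (k0 + i') ≤ g y}) ≤
      2 * (2 * c⁻¹) ^ (2:ℝ) * ∫⁻ y in Wρ', g y ^ (1 + ε) := by
    calc _ = ∑' i' : ℕ, ∫⁻ y in Wρ', {y | c * e2 (k0 + i') ≤ g y}.indicator (fun _ => e2 (k0 + i') ^ (1 + ε)) y := by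
          congr 1; funext i'
          rw [lintegral_indicator_const (hsetm' i'), Measure.restrict_apply (hsetm' i'), inter_comm]
      _ = ∫⁻ y in Wρ', ∑' i' : ℕ, {y | c * e2 (k0 + i') ≤ g y}.indicator (fun _ => e2 (k0 + i') ^ (1 + ε)) y := by
          rw [lintegral_tsum]
          intro i'
          exact (measurable_const.indicator (hsetm' i')).aemeasurable
      _ ≤ ∫⁻ y in Wρ', 2 * (2 * c⁻¹) ^ (2:ℝ) * g y ^ (1 + ε) := by
          refine lintegral_mono fun y => ?_
          have hterm : ∀ i' : ℕ, {y | c * e2 (k0 + i') ≤ g y}.indicator (fun _ => e2 (k0 + i') ^ (1 + ε)) y ≤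
              if e2 (k0 + i') < 2 * c⁻¹ * g y then e2 (k0 + i') ^ (1 + ε) else 0 := by
            intro i'
            by_cases h : c * e2 (k0 + i') ≤ g y
            · rw [indicator_of_mem (by exact h), if_pos]
              have hg0 : g y ≠ 0 := by
                intro h0
                rw [h0] at h
                have := le_bot_iff.1 h
                simp [hc0, e2_pos] at this
              have h1 : e2 (k0 + i') ≤ c⁻¹ * g y := by
                rw [mul_comm, ← div_eq_mul_inv, ENNReal.le_div_iff_mul_le (Or.inl hc0) (Or.inl hct), mul_comm]
                exact h
              refine lt_of_le_of_lt h1 ?_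
              rw [mul_assoc, two_mul]
              apply ENNReal.lt_add_right
              · exact ENNReal.mul_ne_top (by simp [hc0]) (hgt y)
              · simp [hct, hg0]
            · rw [indicator_of_notMem (by exact h)]; exact bot_le
          have hinj : Function.Injective (fun i : ℕ => k0 + (i : ℤ)) := by
            intro a b hab; simp only at hab; omega
          calc _ ≤ ∑' i' : ℕ, if e2 (k0 + i') < 2 * c⁻¹ * g y then e2 (k0 + i') ^ (1 + ε) else 0 :=
                ENNReal.tsum_le_tsum hterm
            _ ≤ lev (1 + ε) (2 * c⁻¹ * g y) :=
                ENNReal.tsum_comp_le_tsum_of_injective hinj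
                  (fun k => if e2 k < 2 * c⁻¹ * g y then e2 k ^ (1 + ε) else 0)
            _ ≤ 2 * (2 * c⁻¹ * g y) ^ (1 + ε) := lev_le_two (by linarith) _
            _ = 2 * (2 * c⁻¹) ^ (1 + ε) * g y ^ (1 + ε) := by
                rw [ENNReal.mul_rpow_of_nonneg _ _ (by linarith)]; ring
            _ ≤ _ := by
                gcongr 2 * ?_ * _
                apply ENNReal.rpow_le_rpow_of_exponent_le _ (by linarith)
                calc (1:ℝ≥0∞) ≤ 1 * 1 := by simp
                  _ ≤ 2 * c⁻¹ := by
                    gcongr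
                    · norm_num
                    · exact ENNReal.one_le_inv.2 hc1
      _ = _ := by
          rw [lintegral_const_mul' _ _]
          exact ENNReal.mul_ne_top (by norm_num) (ENNReal.rpow_ne_top_of_nonneg (by norm_num) h2c)
  calc ∫⁻ y in Wρ, g y ^ (1 + ε) ≤ ∫⁻ y in Wρ, (e2 (k0 + 1) ^ ε * g y + (2 ^ ε - 1) * ∑' i' : ℕ,
      e2 (k0 + 1 + i') ^ ε * ({y | 2 * e2 (k0 + i') < g y}.indicator g y)) := lintegral_mono hpt
    _ = e2 (k0 + 1) ^ ε * (∫⁻ y in Wρ, g y) + (2 ^ ε - 1) * ∑' i' : ℕ,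
      e2 (k0 + 1 + i') ^ ε * ∫⁻ y in Wρ ∩ {y | 2 * e2 (k0 + i') < g y}, g y := by
        have hmi : ∀ i' : ℕ, Measurable (fun y => e2 (k0 + 1 + i') ^ ε *
            ({y | 2 * e2 (k0 + i') < g y}.indicator g y)) := fun i' =>
          (hgm.indicator (hsetm i')).const_mul _
        rw [lintegral_add_left (hgm.const_mul _), lintegral_const_mul _ hgm, lintegral_const_mul _
          (Measurable.tsum hmi), lintegral_tsum (fun i' => (hmi i').aemeasurable)]
        congr 3; funext i'
        rw [lintegral_const_mul _ (hgm.indicator (hsetm i')), lintegral_indicator (hsetm i'),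
          Measure.restrict_restrict (hsetm i'), inter_comm]
    _ ≤ (4 * lam0) ^ ε * S + (2 ^ ε - 1) * ∑' i' : ℕ, (2 * C3) *
        (e2 (k0 + i') ^ (1 + ε) * volume (Wρ' ∩ {y | c * e2 (k0 + i') ≤ g y})) := by
        apply add_le_add
        · gcongr
          · rw [hk0, e2_succ, e2_succ, ← mul_assoc]
            have : (2:ℝ≥0∞) * 2 = 4 := by norm_num
            rw [this]; gcongr
          · rw [hS]
            refine le_trans (lintegral_mono (fun y => min_le_left _ _)) (lintegral_mono_set (WR_mono ?_))
            have : (0:ℝ) < (1/2) ^ i := by positivity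
            linarith
        · gcongr (2 ^ ε - 1) * ?_
          apply ENNReal.tsum_le_tsum
          intro i'
          rw [h2ε, ENNReal.mul_rpow_of_nonneg _ _ hε.le]
          calc _ ≤ 2 * e2 (k0 + i') ^ ε * (C3 * e2 (k0 + i') * volume (Wρ' ∩ {y | c * e2 (k0 + i') ≤ g y})) := by
                gcongr
                exact hgl' i'
            _ = _ := by
                rw [ENNReal.rpow_add _ _ (e2_pos _) (e2_top _), ENNReal.rpow_one]; ring
    _ ≤ (4 * lam0) ^ ε * S + (2 ^ ε - 1) * ((2 * C3) * (2 * (2 * c⁻¹) ^ (2:ℝ) * ∫⁻ y in Wρ', g y ^ (1 + ε))) := by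
        rw [ENNReal.tsum_mul_left]; gcongr
    _ = _ := by ring

end
end PW

namespace PW

section
variable {n : ℕ} {p γ θ : ℝ} {A : ℝ≥0∞} {w σ : XX n → ℝ≥0∞}

theorem rh (H : Wt n p γ θ A w σ) : ∃ (ε : ℝ) (C : ℝ≥0∞), 0 < ε ∧ ε ≤ 1 ∧ C ≠ ∞ ∧
    ∀ (A1 b1 b2 : ℝ) (j : ℤ) (z : XX n) (S : ℝ≥0∞), S = ∫⁻ y in WR p A1 b1 b2 j z 1, σ y → S ≠ ∞ →
    ∫⁻ y in WR p A1 b1 b2 j z 0, σ y ^ (1 + ε) ≤ C * ((S / mm n p j) ^ ε * S) := by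
  obtain ⟨C4, hC4, hstep⟩ := rh_step H
  obtain ⟨Cd, hCd, hCd0, hsh⟩ := mm_shift n p 1
  set D := 2 + Cd with hD
  have hDt : D ≠ ∞ := by simp [hD, hCd]
  have hD2 : 2 ≤ D := le_self_add
  set η : ℝ≥0∞ := (4 * (C4 + 1))⁻¹ with hη
  have hη0 : η ≠ 0 := by
    rw [hη]; exact ENNReal.inv_ne_zero.2 (ENNReal.mul_ne_top (by norm_num) (by simp [hC4]))
  have hη1 : η ≤ 1 := by
    rw [hη, ENNReal.inv_le_one]
    calc (1:ℝ≥0∞) = 1 * 1 := by simp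
      _ ≤ 4 * (C4 + 1) := by
        gcongr
        · norm_num
        · exact le_add_self
  obtain ⟨ε, hε, hε1, hDε⟩ := small_exp hDt hη0
  have hDε2 : D ^ ε ≤ 2 := hDε.trans (by
    calc 1 + η ≤ 1 + 1 := by gcongr
      _ = 2 := by norm_num)
  have h2ε : (2:ℝ≥0∞) ^ ε - 1 ≤ η := by
    rw [tsub_le_iff_left]
    exact (ENNReal.rpow_le_rpow hD2 hε.le).trans hDε
  have h4 : C4 * (2 ^ ε - 1) ≤ 4⁻¹ := by
    calc C4 * (2 ^ ε - 1) ≤ (C4 + 1) * η := by gcongr; exact le_self_add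
      _ = 4⁻¹ := by
        rw [hη, ENNReal.mul_inv (by simp) (by simp), mul_comm, mul_assoc,
          ENNReal.inv_mul_cancel (by simp) (by simp [hC4]), mul_one]
  have hmD : ∀ (κ : ℕ) (j : ℤ), mm n p j ≤ D ^ κ * mm n p (j - κ) := by
    intro κ
    induction κ with
    | zero => intro j; simp
    | succ κ ih =>
      intro j
      refine (ih j).trans ?_
      have h := hsh (j - (κ + 1 : ℕ))
      have e : j - (κ + 1 : ℕ) + 1 = j - κ := by push_cast; ring
      rw [e] at h
      rw [pow_succ, mul_assoc]
      gcongr D ^ κ * ?_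
      refine h.trans ?_
      gcongr
      exact le_add_self
  refine ⟨ε, 2 * (4 * D ^ (SS p γ + 3)) ^ ε, hε, hε1, ?_, ?_⟩
  · exact ENNReal.mul_ne_top (by norm_num) (ENNReal.rpow_ne_top_of_nonneg hε.le
      (ENNReal.mul_ne_top (by norm_num) (ENNReal.pow_ne_top hDt)))
  intro A1 b1 b2 j z S hS hSt
  by_cases hS0 : S = 0
  · have hv : volume (WR p A1 b1 b2 j z 1) = 0 := by
      by_contra h
      have := setLIntegral_pos H.hs H.s0 h
      rw [← hS] at this
      exact absurd hS0 (by first | exact this | exact this.ne')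
    have hv0 : volume (WR p A1 b1 b2 j z 0) = 0 :=
      measure_mono_null (WR_mono (by norm_num)) hv
    rw [Measure.restrict_eq_zero.2 hv0]; simp
  set m := mm n p j with hm
  have hm0 : m ≠ 0 := mm_pos _ _ _
  have hmt : m ≠ ∞ := mm_top _ _ _
  set B := (4 * D ^ (SS p γ + 3)) ^ ε * ((S / m) ^ ε * S) with hB
  have hBt : ∀ K : ℕ, ∫⁻ y in WR p A1 b1 b2 j z 0, (min (σ y) K) ^ (1 + ε) ≤ 2 * B := by
    intro K
    set Φ : ℕ → ℝ≥0∞ := fun i => ∫⁻ y in WR p A1 b1 b2 j z (1 - (1/2) ^ i), (min (σ y) K) ^ (1 + ε) with hΦ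
    have hrec : ∀ i, Φ i ≤ B * 2 ^ i + 4⁻¹ * Φ (i + 1) := by
      intro i
      have h1 := hstep A1 b1 b2 K (by simp) j z (1 - (1/2) ^ i) (i + 1) (by
        have : (0:ℝ) < (1/2) ^ i := by positivity
        rw [pow_succ]; linarith) ε hε hε1 S hS hS0 hSt
      have e : (1 - (1/2:ℝ) ^ i) + (1/2) ^ (i + 1) = 1 - (1/2) ^ (i + 1) := by rw [pow_succ]; ring
      rw [e] at h1
      refine h1.trans (add_le_add ?_ ?_)
      · have hκ := hmD (i + 1 + (SS p γ + 2)) j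
        set m' := mm n p (j - (i + 1 + (SS p γ + 2) : ℕ)) with hm'
        have hm0' : m' ≠ 0 := mm_pos _ _ _
        have hmt' : m' ≠ ∞ := mm_top _ _ _
        have h2 : S / m' ≤ D ^ (i + (SS p γ + 3)) * (S / m) := by
          rw [ENNReal.div_le_iff hm0' hmt']
          calc S = S / m * m := (ENNReal.div_mul_cancel hm0 hmt).symm
            _ ≤ S / m * (D ^ (i + 1 + (SS p γ + 2)) * m') := by gcongr
            _ = _ := by
              have : i + 1 + (SS p γ + 2) = i + (SS p γ + 3) := by ring
              rw [this]; ring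
        calc (4 * (S / m')) ^ ε * S ≤ (4 * (D ^ (i + (SS p γ + 3)) * (S / m))) ^ ε * S := by gcongr
          _ = ((4 * D ^ (SS p γ + 3)) * (S / m) * D ^ i) ^ ε * S := by congr 2; rw [pow_add]; ring
          _ = (4 * D ^ (SS p γ + 3)) ^ ε * (S / m) ^ ε * (D ^ ε) ^ i * S := by
              rw [ENNReal.mul_rpow_of_nonneg _ _ hε.le, ENNReal.mul_rpow_of_nonneg _ _ hε.le]
              congr 2
              rw [← ENNReal.rpow_natCast, ← ENNReal.rpow_mul, mul_comm, ENNReal.rpow_mul, ENNReal.rpow_natCast]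
          _ ≤ (4 * D ^ (SS p γ + 3)) ^ ε * (S / m) ^ ε * 2 ^ i * S := by gcongr
          _ = _ := by rw [hB]; ring
      · gcongr
    have hsumN : ∀ N : ℕ, Φ 0 ≤ B * (∑ i ∈ Finset.range N, 2⁻¹ ^ i) + 4⁻¹ ^ N * Φ N := by
      intro N
      induction N with
      | zero => simp
      | succ N ih =>
        refine ih.trans ?_
        rw [Finset.sum_range_succ]
        calc _ ≤ B * (∑ i ∈ Finset.range N, 2⁻¹ ^ i) + 4⁻¹ ^ N * (B * 2 ^ N + 4⁻¹ * Φ (N + 1)) := by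
              gcongr; exact hrec N
          _ = B * (∑ i ∈ Finset.range N, 2⁻¹ ^ i) + (B * (4⁻¹ * 2) ^ N + 4⁻¹ ^ (N + 1) * Φ (N + 1)) := by
              rw [mul_pow]; ring
          _ = _ := by
              have : (4⁻¹ * 2 : ℝ≥0∞) = 2⁻¹ := by
                have e4 : (4:ℝ≥0∞) = 2 * 2 := by norm_num
                rw [e4, ENNReal.mul_inv (by simp) (by simp), mul_assoc,
                  ENNReal.inv_mul_cancel (by simp) (by simp), mul_one]
              rw [this]; ring
    have hΦT : ∀ N, Φ N ≤ (K:ℝ≥0∞) ^ ε * S := by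
      intro N
      have hr : WR p A1 b1 b2 j z (1 - (1/2) ^ N) ⊆ WR p A1 b1 b2 j z 1 := WR_mono (by
        have : (0:ℝ) < (1/2) ^ N := by positivity
        linarith)
      refine (lintegral_mono_set hr).trans ?_
      rw [hS, ← lintegral_const_mul' _ _ (ENNReal.rpow_ne_top_of_nonneg hε.le (by simp))]
      refine lintegral_mono fun y => ?_
      rw [add_comm, ENNReal.rpow_add_of_nonneg _ _ hε.le (by norm_num), ENNReal.rpow_one]
      gcongr
      · exact min_le_right _ _
      · exact min_le_left _ _
    have hgeo : ∀ N : ℕ, ∑ i ∈ Finset.range N, (2⁻¹ : ℝ≥0∞) ^ i ≤ 2 := by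
      intro N
      refine (ENNReal.sum_le_tsum _).trans ?_
      rw [ENNReal.tsum_geometric, ENNReal.one_sub_inv_two, inv_inv]
    have hfin : ∀ N : ℕ, Φ 0 ≤ 2 * B + 4⁻¹ ^ N * ((K:ℝ≥0∞) ^ ε * S) := by
      intro N
      refine (hsumN N).trans ?_
      rw [mul_comm B]
      gcongr
      · exact hgeo N
      · exact hΦT N
    have hlim : Filter.Tendsto (fun N : ℕ => 2 * B + (4⁻¹:ℝ≥0∞) ^ N * ((K:ℝ≥0∞) ^ ε * S)) Filter.atTop
        (nhds (2 * B + 0 * ((K:ℝ≥0∞) ^ ε * S))) := by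
      refine tendsto_const_nhds.add ?_
      refine ENNReal.Tendsto.mul_const ?_ (Or.inr ?_)
      · apply ENNReal.tendsto_pow_atTop_nhds_zero_of_lt_one
        rw [ENNReal.inv_lt_one]; norm_num
      · exact ENNReal.mul_ne_top (ENNReal.rpow_ne_top_of_nonneg hε.le (by simp)) hSt
    have h0 := ge_of_tendsto' hlim hfin
    rw [zero_mul, add_zero] at h0
    have e0 : Φ 0 = ∫⁻ y in WR p A1 b1 b2 j z 0, (min (σ y) K) ^ (1 + ε) := by
      simp [hΦ]
    rwa [e0] at h0
  have hconv := lintegral_tendsto_of_tendsto_of_monotone (μ := volume.restrict (WR p A1 b1 b2 j z 0))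
    (f := fun (K : ℕ) y => (min (σ y) (K:ℝ≥0∞)) ^ (1 + ε)) (F := fun y => σ y ^ (1 + ε))
    (fun K => ((H.hs.min measurable_const).pow_const _).aemeasurable)
    (ae_of_all _ (fun y a b hab => by
      have : 0 ≤ 1 + ε := by linarith
      dsimp only
      gcongr))
    (ae_of_all _ (fun y => by
      have h1 : Filter.Tendsto (fun K : ℕ => min (σ y) (K:ℝ≥0∞)) Filter.atTop (nhds (min (σ y) ∞)) :=
        tendsto_const_nhds.min ENNReal.tendsto_nat_nhds_top
      rw [min_eq_left le_top] at h1
      exact ((ENNReal.continuous_rpow_const).tendsto _).comp h1))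
  have := le_of_tendsto' hconv hBt
  rw [hB, ← mul_assoc] at this
  exact this

end
end PW

namespace PW

section
variable {n : ℕ} {p γ θ : ℝ} {A : ℝ≥0∞} {w σ : XX n → ℝ≥0∞}

theorem floor_diff {a b l c : ℝ} (hl : 0 < l) (h1 : |a - b| ≤ c * l) :
    |⌊a / l⌋ - ⌊b / l⌋| ≤ ⌈c⌉ + 1 := by
  have h2 : |a / l - b / l| ≤ c := by
    rw [← _root_.sub_div, abs_div, abs_of_pos hl, div_le_iff₀ hl]; exact h1
  rw [abs_le] at h2 ⊢
  have hc := Int.le_ceil c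
  have e1 := Int.floor_le (a / l)
  have e2 := Int.lt_floor_add_one (a / l)
  have e3 := Int.floor_le (b / l)
  have e4 := Int.lt_floor_add_one (b / l)
  constructor
  · have : (-(⌈c⌉ + 1 : ℤ) : ℝ) < (⌊a / l⌋ - ⌊b / l⌋ : ℤ) + 1 := by push_cast; linarith
    have : -(⌈c⌉ + 1 : ℤ) < (⌊a / l⌋ - ⌊b / l⌋ : ℤ) + 1 := by exact_mod_cast this
    omega
  · have : ((⌊a / l⌋ - ⌊b / l⌋ : ℤ) : ℝ) < (⌈c⌉ + 1 : ℤ) := by push_cast; linarith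
    have : (⌊a / l⌋ - ⌊b / l⌋ : ℤ) < (⌈c⌉ + 1 : ℤ) := by exact_mod_cast this
    omega

theorem vlink (H : Wt n p γ θ A w σ) (A1 b1 b2 : ℝ)
    (hcond : K0 p γ * (⌈A1⌉₊ + 1) ≤ b1 - 1 - SS p γ) :
    ∃ C : ℝ≥0∞, C ≠ ∞ ∧ ∀ (j : ℤ) (z : XX n),
    (∫⁻ y in cell p j (sh p j (SS p γ) z), w y) * (∫⁻ y in WR p A1 b1 b2 j z 1, σ y) ^ θ ≤
      C * mm n p j ^ (1 + θ) := by
  have hθ := H.th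
  obtain ⟨C, hC, hl⟩ := link H ⌈A1⌉₊ (b2 + 1)
  set c1 := ⌈A1 + 1⌉ + 1 with hc1
  set c2 := ⌈|b1 - 1| + |b2 + 1|⌉ + 1 with hc2
  set T : Finset ((Fin n → ℤ) × ℤ) := insert 0 (Finset.Icc (fun _ => -c1) (fun _ => c1) ×ˢ Finset.Icc (-c2) c2) with hT
  refine ⟨C * (T.card : ℝ≥0∞) ^ θ, ENNReal.mul_ne_top hC (ENNReal.rpow_ne_top_of_nonneg hθ.le (by simp)), ?_⟩
  intro j z
  have hτ := tau_pos p j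
  have hln := len_pos j
  set W1 := WR p A1 b1 b2 j z 1 with hW1
  set X : ((Fin n → ℤ) × ℤ) → ℝ≥0∞ := fun d => ∫⁻ y in W1 ∩ {y | idx p j y = idx p j z + d}, σ y with hX
  have hXd : ∀ d, (∫⁻ y in cell p j (sh p j (SS p γ) z), w y) * X d ^ θ ≤ C * mm n p j ^ (1 + θ) := by
    intro d
    rcases (W1 ∩ {y | idx p j y = idx p j z + d}).eq_empty_or_nonempty with h | ⟨y0, hy0, hy1⟩
    · simp [hX, h, hθ]
    · have hs : W1 ∩ {y | idx p j y = idx p j z + d} ⊆ NB p y0 j 1 := by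
        refine Subset.trans ?_ (cell_sub_NB p j y0)
        rintro y ⟨-, hy⟩
        show idx p j y = idx p j y0
        exact Eq.trans hy (Eq.symm hy1)
      obtain ⟨g1, g2, g3⟩ := hy0
      refine le_trans ?_ (hl j (sh p j (SS p γ) z) y0 ?_ ?_ ?_)
      · gcongr
        · exact cell_sub_NB _ _ _
        · exact lintegral_mono_set hs
      · refine le_trans (by simpa [sh] using g1) ?_
        gcongr
        exact Nat.le_ceil _
      · simp only [sh, Int.cast_natCast]
        nlinarith
      · simp only [sh, Int.cast_natCast]
        have : (0:ℝ) ≤ SS p γ * tau p j := by positivity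
        linarith
  have hcov : W1 ⊆ ⋃ d : T, (W1 ∩ {y | idx p j y = idx p j z + d.1}) := by
    intro y hy
    have hy' := hy
    obtain ⟨g1, g2, g3⟩ := hy'
    simp only [mem_iUnion]
    refine ⟨⟨idx p j y - idx p j z, ?_⟩, hy, ?_⟩
    · rw [hT]
      apply Finset.mem_insert_of_mem
      have hfst : ∀ i, |⌊y.1 i / len j⌋ - ⌊z.1 i / len j⌋| ≤ c1 := by
        intro i
        refine floor_diff hln (le_trans ?_ g1)
        exact norm_le_pi_norm (y.1 - z.1) i
      have hsnd : |⌊y.2 / tau p j⌋ - ⌊z.2 / tau p j⌋| ≤ c2 := by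
        refine floor_diff hτ ?_
        have e1 := neg_abs_le (b1 - 1)
        have e2 := le_abs_self (b2 + 1)
        have e3 := abs_nonneg (b1 - 1)
        have e4 := abs_nonneg (b2 + 1)
        rw [abs_le]
        constructor <;> nlinarith
      rw [Finset.mem_product, Finset.mem_Icc, Finset.mem_Icc]
      refine ⟨⟨fun i => ?_, fun i => ?_⟩, ⟨?_, ?_⟩⟩
      · exact (abs_le.1 (hfst i)).1
      · exact (abs_le.1 (hfst i)).2
      · exact (abs_le.1 hsnd).1
      · exact (abs_le.1 hsnd).2
    · show idx p j y = idx p j z + (idx p j y - idx p j z)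
      abel
  have hsum : ∫⁻ y in W1, σ y ≤ ∑ d ∈ T, X d :=
    (lintegral_mono_set hcov).trans (by
      refine (lintegral_iUnion_le _ σ).trans ?_
      rw [tsum_fintype]
      exact (Finset.sum_coe_sort T X).le)
  obtain ⟨d, hd, hmax⟩ := T.exists_max_image X ⟨0, Finset.mem_insert_self _ _⟩
  have hsum2 : ∫⁻ y in W1, σ y ≤ T.card * X d := by
    refine hsum.trans ?_
    have := Finset.sum_le_card_nsmul T X (X d) hmax
    simpa using this
  calc _ ≤ (∫⁻ y in cell p j (sh p j (SS p γ) z), w y) * (T.card * X d) ^ θ := by gcongr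
    _ = (T.card : ℝ≥0∞) ^ θ * ((∫⁻ y in cell p j (sh p j (SS p γ) z), w y) * X d ^ θ) := by
      rw [ENNReal.mul_rpow_of_nonneg _ _ hθ.le]; ring
    _ ≤ (T.card : ℝ≥0∞) ^ θ * (C * mm n p j ^ (1 + θ)) := by
      gcongr (T.card : ℝ≥0∞) ^ θ * ?_
      exact hXd d
    _ = _ := by ring

end
end PW

namespace PW

section
variable {n : ℕ} {p γ θ : ℝ} {A : ℝ≥0∞} {w σ : XX n → ℝ≥0∞}

/-- average over the cell -/
def aa (w : XX n → ℝ≥0∞) (p : ℝ) (j : ℤ) (z : XX n) : ℝ≥0∞ := (∫⁻ y in cell p j z, w y) / mm n p j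

/-- infimum over the shifted cell -/
def xx (F : XX n → ℝ≥0∞) (p : ℝ) (s j : ℤ) (z : XX n) : ℝ≥0∞ := ⨅ y ∈ cell p j (sh p j s z), F y

/-- class of scales -/
def Cls (w : XX n → ℝ≥0∞) (p : ℝ) (s k l j : ℤ) (z : XX n) : Prop :=
  (e2 k < aa w p j z ∧ aa w p j z ≤ e2 (k + 1)) ∧
    (e2 l < aa w p j (sh p j s z) ∧ aa w p j (sh p j s z) ≤ e2 (l + 1))

open Classical in
/-- class sup -/
def SK (w F : XX n → ℝ≥0∞) (p : ℝ) (s k l : ℤ) (z : XX n) : ℝ≥0∞ :=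
  ⨆ j : ℤ, if Cls w p s k l j z then xx F p s j z else 0

theorem aa_congr {j : ℤ} {z z' : XX n} (h : z' ∈ cell p j z) : aa w p j z' = aa w p j z := by
  unfold aa; rw [cell_congr h]

theorem aa_sh_congr {j s : ℤ} {z z' : XX n} (h : z' ∈ cell p j z) :
    aa w p j (sh p j s z') = aa w p j (sh p j s z) := by
  unfold aa; rw [cell_sh_congr s h]

theorem xx_congr {F : XX n → ℝ≥0∞} {j s : ℤ} {z z' : XX n} (h : z' ∈ cell p j z) :
    xx F p s j z' = xx F p s j z := by
  unfold xx; rw [cell_sh_congr s h]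

theorem Cls_congr {k l j s : ℤ} {z z' : XX n} (h : z' ∈ cell p j z) :
    Cls w p s k l j z' ↔ Cls w p s k l j z := by
  unfold Cls; rw [aa_congr h, aa_sh_congr h]

theorem SK_measurable (w F : XX n → ℝ≥0∞) (p : ℝ) (s k l : ℤ) : Measurable (SK w F p s k l) := by
  classical
  unfold SK
  refine Measurable.iSup fun j => ?_
  refine fun_measurable (p := p) (j := j) fun z z' h => ?_
  simp only [Cls_congr h, xx_congr h]

theorem sh_cell_sub_NB (p : ℝ) (s : ℕ) (j : ℤ) (z : XX n) :
    cell p j (sh p j s z) ⊆ NB p z j ((s:ℝ) + 1) := by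
  intro y hy
  obtain ⟨h1, h2⟩ := cell_sub_NB p j _ hy
  have hl := len_pos j
  have ht := tau_pos p j
  refine ⟨?_, ?_⟩
  · simp only [sh] at h1
    refine h1.trans ?_
    have : (0:ℝ) ≤ s * len j := by positivity
    linarith
  · simp only [sh, Int.cast_natCast] at h2
    have : (0:ℝ) ≤ s * tau p j := by positivity
    rw [abs_le] at h2 ⊢
    constructor <;> linarith

theorem SK_w (H : Wt n p γ θ A w σ) : ∃ C : ℝ≥0∞, C ≠ ∞ ∧ ∀ (F : XX n → ℝ≥0∞) (s k l : ℤ),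
    ∫⁻ z, SK w F p s k l z * w z ≤ C * e2 k * ∫⁻ z, SK w F p s k l z := by
  classical
  obtain ⟨C, hC, hC0, hlev⟩ := lev_lintegral_le (X := XX n) (s := 1) (by norm_num)
  refine ⟨2 * 2 * C, ENNReal.mul_ne_top (by norm_num) hC, fun F s k l => ?_⟩
  set S := SK w F p s k l with hS
  have hSm : Measurable S := SK_measurable _ _ _ _ _ _
  set μ := (volume : Measure (XX n)).withDensity w with hμ
  have h1 : ∫⁻ z, S z * w z = ∫⁻ z, S z ^ (1:ℝ) ∂μ := by
    simp only [ENNReal.rpow_one]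
    rw [hμ, lintegral_withDensity_eq_lintegral_mul _ H.hw hSm]
    simp [mul_comm]
  have hlevel : ∀ t, μ {z | t < S z} ≤ e2 (k + 1) * volume {z | t < S z} := by
    intro t
    have e : {z | t < S z} = ⋃ j : ℤ, {z | t < if Cls w p s k l j z then xx F p s j z else 0} := by
      ext z
      simp only [mem_iUnion]
      show t < S z ↔ _
      rw [hS, SK, lt_iSup_iff]
      rfl
    rw [e]
    have := czg (p := p) (by linarith [H.hp]) μ (e2 (k + 1) • volume)
      (fun j : ℤ => {z | t < if Cls w p s k l j z then xx F p s j z else 0}) ?_ ?_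
    · simpa using this
    · intro j z z' hz hz'
      show t < if Cls w p s k l j z' then xx F p s j z' else 0
      simp only [Cls_congr hz', xx_congr hz']
      exact hz
    · intro j z hz
      have hcl : Cls w p s k l j z := by
        by_contra hcon
        have hz : t < if Cls w p s k l j z then xx F p s j z else 0 := hz
        rw [if_neg hcon] at hz
        exact not_lt_bot hz
      rw [hμ, withDensity_apply _ (cell_measurable p j z), Measure.smul_apply, vol_cell, smul_eq_mul]
      have := hcl.1.2
      unfold aa at this
      rwa [ENNReal.div_le_iff (mm_pos _ _ _) (mm_top _ _ _)] at this
  rw [h1]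
  calc _ ≤ 2 ^ (1:ℝ) * ∑' i : ℤ, e2 i ^ (1:ℝ) * μ {z | e2 i < S z} :=
        lintegral_le_lev μ (by norm_num) hSm
    _ ≤ 2 ^ (1:ℝ) * ∑' i : ℤ, e2 i ^ (1:ℝ) * (e2 (k + 1) * volume {z | e2 i < S z}) := by
        gcongr; exact hlevel _
    _ = 2 * e2 (k + 1) * ∑' i : ℤ, e2 i ^ (1:ℝ) * volume {z | e2 i < S z} := by
        rw [ENNReal.rpow_one, mul_assoc, ← ENNReal.tsum_mul_left (a := e2 (k+1))]
        congr 2; funext i; ring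
    _ ≤ 2 * e2 (k + 1) * (C * ∫⁻ z, S z ^ (1:ℝ)) := by
        gcongr
        exact hlev volume S hSm
    _ = _ := by
        simp only [ENNReal.rpow_one]
        rw [e2_succ]; ring

theorem SK_le (H : Wt n p γ θ A w σ) {c : ℝ≥0∞}
    (hc : ∀ (j : ℤ) (z : XX n) (a : ℝ≥0∞), a * mm n p j ≤ ∫⁻ y in cell p j z, w y →
      volume ({y | w y < c * a} ∩ cell p j (sh p j (SS p γ) z)) ≤ mm n p j / 4)
    (F : XX n → ℝ≥0∞) (k l : ℤ) (z : XX n) :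
    SK w F p (SS p γ) k l z ≤ (2 * MM p ((SS p γ:ℝ) + 1)
      ({y | c * e2 k ≤ w y ∧ w y ≤ e2 (l + 3)}.indicator (fun y => F y ^ (1/2:ℝ))) z) ^ (2:ℝ) := by
  classical
  set E := {y | c * e2 k ≤ w y ∧ w y ≤ e2 (l + 3)} with hE
  set u := E.indicator (fun y => F y ^ (1/2:ℝ)) with hu
  set s := SS p γ with hs
  have hEm : MeasurableSet E := (measurableSet_le measurable_const H.hw).inter
    (measurableSet_le H.hw measurable_const)
  refine iSup_le fun j => ?_
  split_ifs with hcl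
  swap; · exact bot_le
  set Q := cell p j (sh p j s z) with hQ
  set m := mm n p j with hm
  have hm0 : m ≠ 0 := mm_pos _ _ _
  have hmt : m ≠ ∞ := mm_top _ _ _
  obtain ⟨⟨h1, h2⟩, h3, h4⟩ := hcl
  have hv1 : volume ({y | w y < c * e2 k} ∩ Q) ≤ m / 4 := by
    apply hc
    unfold aa at h1
    rw [ENNReal.lt_div_iff_mul_lt (Or.inl hm0) (Or.inl hmt)] at h1
    exact h1.le
  have hv2 : volume ({y | e2 (l + 3) < w y} ∩ Q) ≤ m / 4 := by
    have hmk : e2 (l + 3) * volume ({y | e2 (l + 3) < w y} ∩ Q) ≤ ∫⁻ y in Q, w y := by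
      have hms : MeasurableSet {y | e2 (l + 3) < w y} := measurableSet_lt measurable_const H.hw
      have := mul_meas_ge_le_lintegral (μ := volume.restrict Q) H.hw (e2 (l + 3))
      refine le_trans ?_ this
      gcongr e2 (l + 3) * ?_
      rw [← Measure.restrict_apply hms]
      apply measure_mono
      intro y hy
      have hy : e2 (l + 3) < w y := hy
      show e2 (l + 3) ≤ w y
      exact hy.le
    unfold aa at h4
    rw [ENNReal.div_le_iff hm0 hmt] at h4
    have h5 := hmk.trans h4
    have e : e2 (l + 3) = e2 (l + 1) * 4 := by
      rw [show l + 3 = l + 1 + 1 + 1 by ring, e2_succ, e2_succ]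
      rw [← mul_assoc, mul_comm]; norm_num
    set V := volume ({y | e2 (l + 3) < w y} ∩ Q) with hV
    rw [e, mul_assoc, ENNReal.mul_le_mul_iff_right (e2_pos _) (e2_top _)] at h5
    rw [ENNReal.le_div_iff_mul_le (by simp) (by simp), mul_comm]
    exact h5
  have hv : m ≤ volume (E ∩ Q) + (m / 4 + m / 4) := by
    calc m = volume Q := (vol_cell _ _ _).symm
      _ ≤ volume ((E ∩ Q) ∪ (({y | w y < c * e2 k} ∩ Q) ∪ ({y | e2 (l + 3) < w y} ∩ Q))) := by
        apply measure_mono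
        intro y hy
        by_cases g1 : w y < c * e2 k
        · right; left; exact ⟨g1, hy⟩
        by_cases g2 : e2 (l + 3) < w y
        · right; right; exact ⟨g2, hy⟩
        · left; exact ⟨⟨not_lt.1 g1, not_lt.1 g2⟩, hy⟩
      _ ≤ _ := by
        refine (measure_union_le _ _).trans ?_
        gcongr
        refine (measure_union_le _ _).trans ?_
        gcongr
  have h44 : m / 4 + m / 4 = m / 2 := by
    have e4 : m / 4 = m / 2 / 2 := by
      rw [div_eq_mul_inv, div_eq_mul_inv, div_eq_mul_inv, mul_assoc,
        ← ENNReal.mul_inv (by simp) (by simp)]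
      norm_num
    rw [e4, ENNReal.add_halves]
  have hhalf : m / 2 ≤ volume (E ∩ Q) := by
    rw [h44] at hv
    have h6 : m / 2 + m / 2 ≤ volume (E ∩ Q) + m / 2 := by rw [ENNReal.add_halves]; exact hv
    exact (ENNReal.add_le_add_iff_right (ENNReal.div_ne_top hmt (by norm_num))).1 h6
  set x := xx F p s j z with hx
  have hIn0 : x ^ (1/2:ℝ) * (m / 2) ≤ MM p ((s:ℝ) + 1) u z * m := by
    refine le_trans ?_ (le_MM p _ _ z j)
    refine le_trans ?_ (lintegral_mono_set (sh_cell_sub_NB p s j z))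
    rw [← hQ, hu, lintegral_indicator hEm, Measure.restrict_restrict hEm]
    calc x ^ (1/2:ℝ) * (m / 2) ≤ x ^ (1/2:ℝ) * volume (E ∩ Q) := by gcongr
      _ = ∫⁻ y in E ∩ Q, x ^ (1/2:ℝ) := by rw [setLIntegral_const]
      _ ≤ _ := by
        apply setLIntegral_mono' (hEm.inter (cell_measurable _ _ _))
        intro y hy
        gcongr
        exact iInf₂_le y hy.2
  have h7 : x ^ (1/2:ℝ) ≤ 2 * MM p ((s:ℝ) + 1) u z := by
    have h8 : x ^ (1/2:ℝ) * m ≤ (2 * MM p ((s:ℝ) + 1) u z) * m := by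
      calc x ^ (1/2:ℝ) * m = 2 * (x ^ (1/2:ℝ) * (m / 2)) := by
            rw [mul_left_comm, ENNReal.mul_div_cancel (by norm_num) (by norm_num)]
        _ ≤ 2 * (MM p ((s:ℝ) + 1) u z * m) := by gcongr
        _ = _ := by ring
    exact (ENNReal.mul_le_mul_iff_left hm0 hmt).1 h8
  calc x = (x ^ (1/2:ℝ)) ^ (2:ℝ) := by rw [← ENNReal.rpow_mul]; norm_num
    _ ≤ _ := by gcongr

theorem sum_kl {c : ℝ≥0∞} (hc0 : c ≠ 0) (hct : c ≠ ∞) {x : ℝ≥0∞} (hx : x ≠ ∞) :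
    ∑' k : ℤ, ∑' l : ℤ, (if c * e2 k ≤ x ∧ x ≤ e2 (l + 3) then e2 k * e2 (-l) else 0) ≤ 128 * c⁻¹ := by
  by_cases hx0 : x = 0
  · have : ∀ k l : ℤ, ¬ (c * e2 k ≤ x ∧ x ≤ e2 (l + 3)) := by
      rintro k l ⟨h, -⟩
      rw [hx0] at h
      have := le_bot_iff.1 h
      simp [hc0, e2_pos] at this
    simp [this]
  have h1 : ∀ k l : ℤ, (if c * e2 k ≤ x ∧ x ≤ e2 (l + 3) then e2 k * e2 (-l) else 0) ≤
      (if e2 k < 2 * c⁻¹ * x then e2 k ^ (1:ℝ) else 0) * (if e2 (-l) < 16 * x⁻¹ then e2 (-l) ^ (1:ℝ) else 0) := by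
    intro k l
    split_ifs with h g1 g2 g2
    · simp
    · exfalso
      apply g2
      have h2 : e2 (-l) ≤ 8 * x⁻¹ := by
        rw [← div_eq_mul_inv, ENNReal.le_div_iff_mul_le (Or.inl hx0) (Or.inl hx)]
        calc e2 (-l) * x ≤ e2 (-l) * e2 (l + 3) := by gcongr; exact h.2
          _ = 8 := by
            rw [← e2_add, show -l + (l + 3) = (0:ℤ) + 1 + 1 + 1 by ring, e2_succ, e2_succ, e2_succ]
            simp [e2]; norm_num
      refine lt_of_le_of_lt h2 ?_
      rw [ENNReal.mul_lt_mul_iff_left (by simp [hx]) (by simp [hx0])]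
      norm_num
    · exfalso
      apply g1
      have h2 : e2 k ≤ c⁻¹ * x := by
        rw [mul_comm, ← div_eq_mul_inv, ENNReal.le_div_iff_mul_le (Or.inl hc0) (Or.inl hct), mul_comm]
        exact h.1
      refine lt_of_le_of_lt h2 ?_
      rw [mul_assoc, two_mul]
      apply ENNReal.lt_add_right
      · exact ENNReal.mul_ne_top (by simp [hc0]) hx
      · simp [hct, hx0]
    · exfalso
      apply g1
      have h2 : e2 k ≤ c⁻¹ * x := by
        rw [mul_comm, ← div_eq_mul_inv, ENNReal.le_div_iff_mul_le (Or.inl hc0) (Or.inl hct), mul_comm]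
        exact h.1
      refine lt_of_le_of_lt h2 ?_
      rw [mul_assoc, two_mul]
      apply ENNReal.lt_add_right
      · exact ENNReal.mul_ne_top (by simp [hc0]) hx
      · simp [hct, hx0]
    all_goals exact bot_le
  calc _ ≤ ∑' k : ℤ, ∑' l : ℤ, (if e2 k < 2 * c⁻¹ * x then e2 k ^ (1:ℝ) else 0) *
        (if e2 (-l) < 16 * x⁻¹ then e2 (-l) ^ (1:ℝ) else 0) :=
        ENNReal.tsum_le_tsum fun k => ENNReal.tsum_le_tsum fun l => h1 k l
    _ = lev 1 (2 * c⁻¹ * x) * lev 1 (16 * x⁻¹) := by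
        simp only [ENNReal.tsum_mul_left, ENNReal.tsum_mul_right]
        unfold lev
        congr 1
        exact (Equiv.neg ℤ).tsum_eq (fun l => if e2 l < 16 * x⁻¹ then e2 l ^ (1:ℝ) else 0)
    _ ≤ (2 * (2 * c⁻¹ * x) ^ (1:ℝ)) * (2 * (16 * x⁻¹) ^ (1:ℝ)) := by
        gcongr
        · exact lev_le_two le_rfl _
        · exact lev_le_two le_rfl _
    _ = (2 * 2 * 2 * 16) * c⁻¹ * (x * x⁻¹) := by simp only [ENNReal.rpow_one]; ring
    _ = 128 * c⁻¹ := by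
        rw [ENNReal.mul_inv_cancel hx0 hx, mul_one]; norm_num

theorem aa_ne (H : Wt n p γ θ A w σ) : ∀ᵐ z, w z ≠ 0 → ∀ j : ℤ, aa w p j z ≠ 0 := by
    set G : ℤ → Set (XX n) := fun j => {z | aa w p j z = 0} with hG
    have hGm : ∀ j, MeasurableSet (G j) := fun j =>
      (fun_measurable (p := p) (j := j) (g := aa w p j) fun z z' h => aa_congr h) (measurableSet_singleton 0)
    have hz := czg (p := p) (by linarith [H.hp]) ((volume : Measure (XX n)).withDensity w) 0 G
      (fun j z z' hz h => by
        show aa w p j z' = 0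
        rw [aa_congr h]; exact hz)
      (fun j z hz => by
        have hz : aa w p j z = 0 := hz
        rw [withDensity_apply _ (cell_measurable p j z)]
        unfold aa at hz
        rw [ENNReal.div_eq_zero_iff] at hz
        rcases hz with h | h
        · rw [h]; simp
        · exact absurd h (mm_top _ _ _))
    have hz : (volume : Measure (XX n)).withDensity w (⋃ j, G j) = 0 := by simpa using hz
    rw [withDensity_apply _ (MeasurableSet.iUnion hGm),
      setLIntegral_eq_zero_iff (MeasurableSet.iUnion hGm) H.hw] at hz
    filter_upwards [hz] with z hz hw j hj
    exact hw (hz (mem_iUnion.2 ⟨j, hj⟩))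

theorem ash_ne (H : Wt n p γ θ A w σ) : ∀ (j : ℤ) (z : XX n), aa w p j z ≠ 0 → aa w p j (sh p j (SS p γ) z) ≠ 0 := by
  obtain ⟨c, hc0, hct, hc⟩ := lem_i H
  intro j z hz h0
  have hm0 := mm_pos n p j
  have hmt := mm_top n p j
  have h3 := hc j z (aa w p j z) (by rw [aa, ENNReal.div_mul_cancel hm0 hmt])
  have h4 : ∫⁻ y in cell p j (sh p j (SS p γ) z), w y = 0 := by
    rw [aa, ENNReal.div_eq_zero_iff] at h0
    exact h0.resolve_right hmt
  rw [setLIntegral_eq_zero_iff (cell_measurable _ _ _) H.hw] at h4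
  have h5 : volume (cell p j (sh p j (SS p γ) z)) ≤
      volume ({y | w y < c * aa w p j z} ∩ cell p j (sh p j (SS p γ) z)) := by
    apply measure_mono_ae
    filter_upwards [h4] with y hy hyc
    refine ⟨?_, hyc⟩
    show w y < c * aa w p j z
    rw [hy hyc]
    exact pos_iff_ne_zero.2 (mul_ne_zero hc0 hz)
  rw [vol_cell] at h5
  have h6 := h5.trans h3
  rw [ENNReal.le_div_iff_mul_le (by simp) (by simp)] at h6
  have h7 : mm n p j * 1 < mm n p j * 4 := (ENNReal.mul_lt_mul_iff_right hm0 hmt).2 (by norm_num)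
  rw [mul_one] at h7
  exact absurd h6 (not_le.2 h7)

theorem lemW (H : Wt n p γ θ A w σ) : ∃ C : ℝ≥0∞, C ≠ ∞ ∧ ∀ F : XX n → ℝ≥0∞, Measurable F →
    ∫⁻ z, (⨆ j : ℤ, xx F p (SS p γ) j z / aa w p j (sh p j (SS p γ) z)) * w z ≤ C * ∫⁻ z, F z := by
  classical
  obtain ⟨c, hc0, hct, hc⟩ := lem_i H
  obtain ⟨C1, hC1, h1⟩ := SK_w H
  have hA : (0:ℝ) < (SS p γ : ℝ) + 1 := by positivity
  obtain ⟨C2, hC2, hC20, h2⟩ := MM_strong (n := n) (p := p) H.hp.le hA (s := 2) (by norm_num)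
  refine ⟨C1 * (2 ^ (2:ℝ) * C2) * (128 * c⁻¹), ?_, fun F hF => ?_⟩
  · refine ENNReal.mul_ne_top (ENNReal.mul_ne_top hC1 (ENNReal.mul_ne_top ?_ hC2)) (ENNReal.mul_ne_top (by norm_num) (by simp [hc0]))
    exact ENNReal.rpow_ne_top_of_nonneg (by norm_num) (by norm_num)
  have hnull := aa_ne H
  have hatop : ∀ j z, aa w p j z ≠ ∞ := fun j z => ENNReal.div_ne_top (wcell_fin H j z) (mm_pos _ _ _)
  have hash := ash_ne H
  have hpt : ∀ᵐ z, (⨆ j : ℤ, xx F p (SS p γ) j z / aa w p j (sh p j (SS p γ) z)) * w z ≤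
      ∑' k : ℤ, ∑' l : ℤ, e2 (-l) * (SK w F p (SS p γ) k l z * w z) := by
    filter_upwards [hnull] with z hz
    by_cases hw0 : w z = 0
    · simp [hw0]
    have hz := hz hw0
    simp only [← mul_assoc, ENNReal.tsum_mul_right]
    gcongr
    refine iSup_le fun j => ?_
    obtain ⟨k, hk⟩ := e2_exists (hz j) (hatop j z)
    obtain ⟨l, hl⟩ := e2_exists (hash j z (hz j)) (hatop j (sh p j (SS p γ) z))
    have hcl : Cls w p (SS p γ) k l j z := ⟨hk, hl⟩
    calc xx F p (SS p γ) j z / aa w p j (sh p j (SS p γ) z) ≤ e2 (-l) * SK w F p (SS p γ) k l z := by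
          rw [div_eq_mul_inv, mul_comm, e2_neg]
          gcongr ?_ * ?_
          · exact ENNReal.inv_le_inv.2 hl.1.le
          · refine le_trans ?_ (le_iSup _ j)
            rw [if_pos hcl]
      _ ≤ ∑' l : ℤ, e2 (-l) * SK w F p (SS p γ) k l z :=
          ENNReal.le_tsum (f := fun l : ℤ => e2 (-l) * SK w F p (SS p γ) k l z) l
      _ ≤ _ := ENNReal.le_tsum (f := fun k : ℤ => ∑' l : ℤ, e2 (-l) * SK w F p (SS p γ) k l z) k
  have hSKm : ∀ k l : ℤ, Measurable fun z => SK w F p (SS p γ) k l z * w z := fun k l =>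
    (SK_measurable _ _ _ _ _ _).mul H.hw
  set E : ℤ → ℤ → Set (XX n) := fun k l => {y | c * e2 k ≤ w y ∧ w y ≤ e2 (l + 3)} with hE
  have hEm : ∀ k l, MeasurableSet (E k l) := fun k l => (measurableSet_le measurable_const H.hw).inter
    (measurableSet_le H.hw measurable_const)
  have hSK : ∀ k l : ℤ, ∫⁻ z, SK w F p (SS p γ) k l z ≤ 2 ^ (2:ℝ) * C2 * ∫⁻ z, (E k l).indicator F z := by
    intro k l
    calc _ ≤ ∫⁻ z, (2 * MM p ((SS p γ:ℝ) + 1) ((E k l).indicator (fun y => F y ^ (1/2:ℝ))) z) ^ (2:ℝ) :=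
          lintegral_mono fun z => SK_le H hc F k l z
      _ = 2 ^ (2:ℝ) * ∫⁻ z, (MM p ((SS p γ:ℝ) + 1) ((E k l).indicator (fun y => F y ^ (1/2:ℝ))) z) ^ (2:ℝ) := by
          rw [← lintegral_const_mul' _ _ (ENNReal.rpow_ne_top_of_nonneg (by norm_num) (by norm_num))]
          congr 1; funext z
          rw [ENNReal.mul_rpow_of_nonneg _ _ (by norm_num)]
      _ ≤ 2 ^ (2:ℝ) * (C2 * ∫⁻ z, ((E k l).indicator (fun y => F y ^ (1/2:ℝ)) z) ^ (2:ℝ)) := by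
          gcongr
          exact h2 _ ((hF.pow_const _).indicator (hEm k l))
      _ = _ := by
          rw [mul_assoc]
          congr 3; funext z
          by_cases hz : z ∈ E k l
          · rw [indicator_of_mem hz, indicator_of_mem hz, ← ENNReal.rpow_mul]; norm_num
          · rw [indicator_of_notMem hz, indicator_of_notMem hz]; simp
  calc _ ≤ ∫⁻ z, ∑' k : ℤ, ∑' l : ℤ, e2 (-l) * (SK w F p (SS p γ) k l z * w z) := lintegral_mono_ae hpt
    _ = ∑' k : ℤ, ∑' l : ℤ, e2 (-l) * ∫⁻ z, SK w F p (SS p γ) k l z * w z := by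
        rw [lintegral_tsum fun k => (Measurable.tsum fun l => (hSKm k l).const_mul _).aemeasurable]
        congr 1; funext k
        rw [lintegral_tsum fun l => ((hSKm k l).const_mul _).aemeasurable]
        congr 1; funext l
        rw [lintegral_const_mul _ (hSKm k l)]
    _ ≤ ∑' k : ℤ, ∑' l : ℤ, C1 * (2 ^ (2:ℝ) * C2) * ∫⁻ z, e2 k * e2 (-l) * (E k l).indicator F z := by
        refine ENNReal.tsum_le_tsum fun k => ENNReal.tsum_le_tsum fun l => ?_
        rw [lintegral_const_mul' _ _ (ENNReal.mul_ne_top (e2_top _) (e2_top _))]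
        calc _ ≤ e2 (-l) * (C1 * e2 k * (2 ^ (2:ℝ) * C2 * ∫⁻ z, (E k l).indicator F z)) := by
              gcongr e2 (-l) * ?_
              refine (h1 F (SS p γ) k l).trans ?_
              gcongr C1 * e2 k * ?_
              exact hSK k l
          _ = _ := by ring
    _ = C1 * (2 ^ (2:ℝ) * C2) * ∫⁻ z, ∑' k : ℤ, ∑' l : ℤ, e2 k * e2 (-l) * (E k l).indicator F z := by
        have hm : ∀ k l : ℤ, Measurable fun z => e2 k * e2 (-l) * (E k l).indicator F z := fun k l =>
          (hF.indicator (hEm k l)).const_mul _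
        rw [lintegral_tsum fun k => (Measurable.tsum fun l => hm k l).aemeasurable]
        simp only [ENNReal.tsum_mul_left]
        congr 2; funext k
        rw [lintegral_tsum fun l => (hm k l).aemeasurable]
    _ ≤ C1 * (2 ^ (2:ℝ) * C2) * ∫⁻ z, 128 * c⁻¹ * F z := by
        gcongr C1 * (2 ^ (2:ℝ) * C2) * ?_
        refine lintegral_mono fun z => ?_
        calc _ = ∑' k : ℤ, ∑' l : ℤ, (if c * e2 k ≤ w z ∧ w z ≤ e2 (l + 3) then e2 k * e2 (-l) else 0) * F z := by
              congr 1; funext k; congr 1; funext l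
              by_cases hz : c * e2 k ≤ w z ∧ w z ≤ e2 (l + 3)
              · rw [if_pos hz, indicator_of_mem (by exact hz)]
              · rw [if_neg hz, indicator_of_notMem (by exact hz)]; simp
          _ ≤ _ := by
              simp only [ENNReal.tsum_mul_right]
              gcongr ?_ * _
              exact sum_kl hc0 hct (H.wtop z)
    _ = _ := by
        rw [lintegral_const_mul' _ _ (ENNReal.mul_ne_top (by norm_num) (by simp [hc0]))]; ring

end
end PW

namespace PW

section
variable {n : ℕ} {p γ θ : ℝ} {A : ℝ≥0∞} {w σ : XX n → ℝ≥0∞}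

theorem est (H : Wt n p γ θ A w σ) {r r' q : ℝ} (hc : r.HolderConjugate r') (hq : 0 < q)
    (hθq : θ = q / r') (A1 b1 b2 : ℝ)
    (hcond : K0 p γ * (⌈A1⌉₊ + 1) ≤ b1 - 1 - SS p γ) :
    ∃ (s : ℝ) (C : ℝ≥0∞), 1 < s ∧ s < r ∧ C ≠ ∞ ∧ ∀ h g : XX n → ℝ≥0∞, Measurable h →
      (∀ z, σ z ≠ ∞ → g z = h z * σ z ^ (1 / r')) → ∀ (j : ℤ) (z : XX n),
      aa w p j (sh p j (SS p γ) z) ≠ 0 →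
      ((∫⁻ y in WR p A1 b1 b2 j z 0, g y) / mm n p j) ^ q ≤
        C * ((∫⁻ y in WR p A1 b1 b2 j z 0, h y ^ s) / mm n p j) ^ (q / s) /
          aa w p j (sh p j (SS p γ) z) := by
  obtain ⟨ε, C1, hε, hε1, hC1, hrh⟩ := rh H
  obtain ⟨C2, hC2, hvl⟩ := vlink H A1 b1 b2 hcond
  have hθ := H.th
  have hr1 := hc.lt
  have hr1' := hc.symm.lt
  have hr0' : 0 < r' := by linarith
  set s' := r' * (1 + ε) with hs'
  have hs'1 : 1 < s' := by rw [hs']; nlinarith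
  have hs'0 : 0 < s' := by linarith
  have hs'r : r' < s' := by rw [hs']; nlinarith
  set s := Real.conjExponent s' with hs
  have hss : s'.HolderConjugate s := Real.HolderConjugate.conjExponent hs'1
  have hs1 : 1 < s := hss.symm.lt
  have hs0 : 0 < s := by linarith
  have hsr : s < r := by
    have e1 := hss.inv_add_inv_eq_one
    have e2 := hc.inv_add_inv_eq_one
    have e3 : s'⁻¹ < r'⁻¹ := (inv_lt_inv₀ hs'0 hr0').2 hs'r
    have e4 : r⁻¹ < s⁻¹ := by linarith
    exact (inv_lt_inv₀ (by linarith) hs0).1 e4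
  refine ⟨s, C1 ^ (q / s') * C2, hs1, hsr, ENNReal.mul_ne_top
    (ENNReal.rpow_ne_top_of_nonneg (by positivity) hC1) hC2, ?_⟩
  intro h g hh hgh j z ha
  set m := mm n p j with hm
  have hm0 : m ≠ 0 := mm_pos _ _ _
  have hmt : m ≠ ∞ := mm_top _ _ _
  set a := aa w p j (sh p j (SS p γ) z) with haa
  have hat : a ≠ ∞ := ENNReal.div_ne_top (wcell_fin H _ _) hm0
  set S := ∫⁻ y in WR p A1 b1 b2 j z 1, σ y with hS
  set y := S / m with hy
  have hSy : S = y * m := (ENNReal.div_mul_cancel hm0 hmt).symm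
  have hay : y ^ θ ≤ C2 / a := by
    have h1 := hvl j z
    rw [← hS] at h1
    have e : ∫⁻ y in cell p j (sh p j (SS p γ) z), w y = a * m := (ENNReal.div_mul_cancel hm0 hmt).symm
    rw [e, hSy, ENNReal.mul_rpow_of_nonneg _ _ hθ.le, ENNReal.rpow_add _ _ hm0 hmt, ENNReal.rpow_one,
      show a * m * (y ^ θ * m ^ θ) = (y ^ θ * a) * (m * m ^ θ) by ring,
      ENNReal.mul_le_mul_iff_left (mul_ne_zero hm0 (rpow_ne0 hm0 hmt))
        (ENNReal.mul_ne_top hmt (rpow_neTop hm0 hmt))] at h1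
    rwa [ENNReal.le_div_iff_mul_le (Or.inl ha) (Or.inl hat)]
  have hyt : y ≠ ∞ := by
    intro h
    rw [h, ENNReal.top_rpow_of_pos hθ] at hay
    exact ENNReal.div_ne_top hC2 ha (top_le_iff.1 hay)
  have hSt : S ≠ ∞ := by rw [hSy]; exact ENNReal.mul_ne_top hyt hmt
  set V := WR p A1 b1 b2 j z 0 with hV
  have hσae : ∀ᵐ x ∂(volume.restrict V), σ x < ∞ := by
    refine ae_lt_top H.hs (ne_top_of_le_ne_top hSt (lintegral_mono_set (WR_mono (by norm_num))))
  have hR := hrh A1 b1 b2 j z S hS hSt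
  set I := ∫⁻ x in V, h x ^ s with hI
  set U := I / m with hU
  have hIU : I = U * m := (ENNReal.div_mul_cancel hm0 hmt).symm
  have hR2 : (∫⁻ x in V, (σ x ^ (1 / r')) ^ s') ^ (1 / s') ≤ C1 ^ (1 / s') * (y ^ (1 / r') * m ^ (1 / s')) := by
    have e1 : ∀ x, (σ x ^ (1 / r')) ^ s' = σ x ^ (1 + ε) := by
      intro x
      rw [← ENNReal.rpow_mul, hs']; congr 1; try field_simp
    simp only [e1]
    calc _ ≤ (C1 * (y ^ ε * S)) ^ (1 / s') := by gcongr
      _ = (C1 * (y ^ (1 + ε) * m)) ^ (1 / s') := by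
        rw [hSy, ENNReal.rpow_add_of_nonneg _ _ (by norm_num) hε.le, ENNReal.rpow_one]
        congr 1; ring
      _ = _ := by
        rw [ENNReal.mul_rpow_of_nonneg _ _ (by positivity), ENNReal.mul_rpow_of_nonneg _ _ (by positivity),
          ← ENNReal.rpow_mul]
        congr 3
        rw [hs']; field_simp
  have hG : ∫⁻ x in V, g x ≤ (C1 ^ (1 / s') * (U ^ (1 / s) * y ^ (1 / r'))) * m := by
    calc ∫⁻ x in V, g x = ∫⁻ x in V, (h * fun x => σ x ^ (1 / r')) x := by
          apply lintegral_congr_ae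
          filter_upwards [hσae] with x hx
          rw [hgh x hx.ne]; rfl
      _ ≤ I ^ (1 / s) * (∫⁻ x in V, (σ x ^ (1 / r')) ^ s') ^ (1 / s') :=
          ENNReal.lintegral_mul_le_Lp_mul_Lq _ hss.symm hh.aemeasurable (H.hs.pow_const _).aemeasurable
      _ ≤ (U * m) ^ (1 / s) * (C1 ^ (1 / s') * (y ^ (1 / r') * m ^ (1 / s'))) := by
          rw [← hIU]; gcongr
      _ = (C1 ^ (1 / s') * (U ^ (1 / s) * y ^ (1 / r'))) * (m ^ (1 / s) * m ^ (1 / s')) := by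
          rw [ENNReal.mul_rpow_of_nonneg _ _ (by positivity)]; ring
      _ = _ := by
          rw [← ENNReal.rpow_add _ _ hm0 hmt, one_div, one_div, add_comm, hss.inv_add_inv_eq_one, ENNReal.rpow_one]
  have hG2 : (∫⁻ x in V, g x) / m ≤ C1 ^ (1 / s') * (U ^ (1 / s) * y ^ (1 / r')) := by
    rw [ENNReal.div_le_iff hm0 hmt]; exact hG
  calc _ ≤ (C1 ^ (1 / s') * (U ^ (1 / s) * y ^ (1 / r'))) ^ q := by gcongr
    _ = C1 ^ (q / s') * (U ^ (q / s) * y ^ θ) := by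
      rw [ENNReal.mul_rpow_of_nonneg _ _ hq.le, ENNReal.mul_rpow_of_nonneg _ _ hq.le,
        ← ENNReal.rpow_mul, ← ENNReal.rpow_mul, ← ENNReal.rpow_mul, hθq,
        one_div_mul_eq_div, one_div_mul_eq_div, one_div_mul_eq_div]
    _ ≤ C1 ^ (q / s') * (U ^ (q / s) * (C2 / a)) := by gcongr
    _ = _ := by
      rw [div_eq_mul_inv C2, div_eq_mul_inv _ a]; ring

theorem exists_i (hp : 1 < p) (hg : 0 < γ) (K S : ℝ) (hK : 0 ≤ K) (hS : 0 ≤ S) :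
    ∃ i : ℕ, K * (⌈(4 * 2 ^ i : ℝ)⌉₊ + 1) ≤ 2 * γ * 2 ^ ((i:ℝ) * p) - 1 - S := by
  have h1 : (1:ℝ) < 2 ^ (p - 1) := Real.one_lt_rpow (by norm_num) (by linarith)
  obtain ⟨i, hi⟩ := pow_unbounded_of_one_lt ((5 * K + 1 + S) / (2 * γ)) h1
  refine ⟨i, ?_⟩
  have e : (⌈(4 * 2 ^ i : ℝ)⌉₊ : ℝ) = 4 * 2 ^ i := by
    have : (4 * 2 ^ i : ℝ) = ((4 * 2 ^ i : ℕ) : ℝ) := by push_cast; rfl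
    rw [this, Nat.ceil_natCast]
  rw [e]
  have e2 : (2:ℝ) ^ ((i:ℝ) * p) = (2 ^ (p - 1)) ^ i * 2 ^ i := by
    rw [← Real.rpow_natCast, ← Real.rpow_mul (by norm_num), ← Real.rpow_natCast 2 i,
      ← Real.rpow_add (by norm_num)]
    congr 1; ring
  rw [e2]
  rw [div_lt_iff₀ (by positivity)] at hi
  have h2 : (1:ℝ) ≤ 2 ^ i := one_le_pow₀ (by norm_num)
  nlinarith [mul_le_mul_of_nonneg_right hi.le (by positivity : (0:ℝ) ≤ 2 ^ i)]

theorem geo (hp : 1 < p) (g0 : 0 < γ) (g1 : γ < 1) (i : ℕ) {x : Fin n → ℝ} {t L : ℝ} (hL : 0 < L)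
    {z : XX n} (hz : z ∈ parLow n p x t L γ) : ∃ j : ℤ,
    parUp n p x t L γ ⊆ WR p (4 * 2 ^ i) (2 * γ * 2 ^ ((i:ℝ) * p)) (4 * 2 ^ (((i:ℝ) + 1) * p)) j z 0 ∧
    ENNReal.ofReal (1 - γ) * mm n p j ≤ volume (parUp n p x t L γ) := by
  obtain ⟨k, hk1, hk2⟩ := exists_mem_Ico_zpow (x := L) (y := (2:ℝ)) hL (by norm_num)
  refine ⟨k - i, ?_⟩
  set j := k - (i:ℤ) with hj
  have hlen : (2:ℝ) ^ k = len j * 2 ^ i := by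
    rw [len, ← zpow_natCast, ← zpow_add₀ (by norm_num)]; congr 1; omega
  have hl0 := len_pos j
  have hτ := tau_pos p j
  have hrp : ((2:ℝ) ^ k) ^ p = 2 ^ ((j:ℝ) * p) * 2 ^ ((i:ℝ) * p) := by
    rw [← Real.rpow_intCast, ← Real.rpow_mul (by norm_num), ← Real.rpow_add (by norm_num)]
    congr 1
    rw [hj]; push_cast; ring
  have hrp2 : ((2:ℝ) ^ (k + 1)) ^ p = 2 ^ ((j:ℝ) * p) * 2 ^ (((i:ℝ) + 1) * p) := by
    rw [← Real.rpow_intCast, ← Real.rpow_mul (by norm_num), ← Real.rpow_add (by norm_num)]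
    congr 1
    rw [hj]; push_cast; ring
  have hlow : ((2:ℝ) ^ k) ^ p ≤ L ^ p := Real.rpow_le_rpow (by positivity) hk1 (by linarith)
  have hup : L ^ p ≤ ((2:ℝ) ^ (k + 1)) ^ p := Real.rpow_le_rpow hL.le hk2.le (by linarith)
  rw [hrp] at hlow
  rw [hrp2] at hup
  have h1i : (1:ℝ) ≤ 2 ^ ((i:ℝ) * p) := Real.one_le_rpow (by norm_num) (by positivity)
  have h1ip : (0:ℝ) < 2 ^ (((i:ℝ) + 1) * p) := by positivity
  have t1 := tau_le p j
  have t2 := le_tau p j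
  have hlow2 : tau p j * 2 ^ ((i:ℝ) * p) ≤ L ^ p := le_trans (by gcongr) hlow
  have hup2 : L ^ p ≤ 2 * tau p j * 2 ^ (((i:ℝ) + 1) * p) := hup.trans (by gcongr)
  constructor
  · rintro y ⟨hy1, hy2, hy3⟩
    obtain ⟨hz1, hz2, hz3⟩ := hz
    have hk3 : L < 2 * (len j * 2 ^ i) := by
      rw [← hlen]; rw [zpow_add₀ (by norm_num)] at hk2; simpa [mul_comm] using hk2
    refine ⟨?_, ?_, ?_⟩
    · have : ‖y.1 - z.1‖ ≤ ‖y.1 - x‖ + ‖z.1 - x‖ := by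
        have e : y.1 - z.1 = (y.1 - x) - (z.1 - x) := by abel
        rw [e]; exact norm_sub_le _ _
      nlinarith
    · have : 2 * γ * (tau p j * 2 ^ ((i:ℝ) * p)) ≤ 2 * γ * L ^ p := by gcongr
      nlinarith
    · nlinarith
  · rw [vol_parUp n p x t hL.le γ, mm, ← ENNReal.ofReal_mul (by linarith)]
    apply ENNReal.ofReal_le_ofReal
    have hlL : len j ≤ 2 * L := by
      have : (1:ℝ) ≤ 2 ^ i := one_le_pow₀ (by norm_num)
      rw [hlen] at hk1; nlinarith
    have htL : tau p j ≤ L ^ p := by nlinarith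
    have : len j ^ n ≤ (2 * L) ^ n := by gcongr
    have g : 0 ≤ 1 - γ := by linarith
    calc (1 - γ) * (len j ^ n * tau p j) ≤ (1 - γ) * ((2 * L) ^ n * L ^ p) := by gcongr
      _ = _ := by ring

end
end PW

namespace PW

section
variable {n : ℕ} {p γ θ : ℝ} {A : ℝ≥0∞} {w σ : XX n → ℝ≥0∞}

theorem rpow_anti {a b : ℝ≥0∞} {e : ℝ} (he : e ≤ 0) (hab : a ≤ b) : b ^ e ≤ a ^ e := by
  rw [← neg_neg e, ENNReal.rpow_neg b, ENNReal.rpow_neg a]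
  exact ENNReal.inv_le_inv.2 (ENNReal.rpow_le_rpow hab (by linarith))

theorem alg1 {v m κ I J : ℝ≥0∞} {β q : ℝ} (hm : m ≠ 0) (hm' : m ≠ ∞) (hκ : κ ≠ 0) (hκ' : κ ≠ ∞)
    (hv : v ≠ 0) (hv' : v ≠ ∞) (hβ : β < 1) (hq : 0 < q) (hkv : κ * m ≤ v) (hJ : J ≤ I) :
    (v ^ β * (J / v)) ^ q ≤ (κ ^ (β - 1)) ^ q * (m ^ (β * q) * (I / m) ^ q) := by
  have e : ∀ x : ℝ≥0∞, x ≠ 0 → x ≠ ∞ → ∀ K, x ^ β * (K / x) = x ^ (β - 1) * K := by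
    intro x h0 ht K
    rw [ENNReal.rpow_sub _ _ h0 ht, ENNReal.rpow_one, ENNReal.div_eq_inv_mul, ENNReal.div_eq_inv_mul]
    ring
  have h1 : v ^ (β - 1) ≤ κ ^ (β - 1) * m ^ (β - 1) := by
    rw [← ENNReal.mul_rpow_of_ne_zero hκ hm]
    exact rpow_anti (by linarith) hkv
  rw [ENNReal.rpow_mul, ← ENNReal.mul_rpow_of_nonneg _ _ hq.le, ← ENNReal.mul_rpow_of_nonneg _ _ hq.le,
    e v hv hv', e m hm hm']
  apply ENNReal.rpow_le_rpow _ hq.le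
  calc _ ≤ κ ^ (β - 1) * m ^ (β - 1) * I := by gcongr
    _ = _ := by ring

theorem alg2 {m U : ℝ≥0∞} {β q r s : ℝ} (hs : 0 < s) (hr : 0 < r) (hrq : r ≤ q)
    (hβ : β = 1 / r - 1 / q) :
    m ^ (β * q) * U ^ (q / s) = U ^ (r / s) * (m * U ^ (r / s)) ^ (q / r - 1) := by
  have hq : 0 < q := by linarith
  have h0 : 0 ≤ q / r - 1 := by
    have : 1 ≤ q / r := (one_le_div hr).2 hrq
    linarith
  have e1 : β * q = q / r - 1 := by rw [hβ]; field_simp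
  rw [ENNReal.mul_rpow_of_nonneg _ _ h0, ← ENNReal.rpow_mul, e1]
  have e2 : q / s = r / s + r / s * (q / r - 1) := by field_simp; ring
  rw [e2, ENNReal.rpow_add_of_nonneg _ _ (by positivity) (by positivity)]
  ring

theorem alg3 {V : Set (XX n)} {u : XX n → ℝ≥0∞} (hu : Measurable u) {t : ℝ} (ht : 1 < t)
    {c m : ℝ≥0∞} (hm : m ≠ 0) (hm' : m ≠ ∞) (hV : volume V ≤ c * m) :
    m * ((∫⁻ y in V, u y) / m) ^ t ≤ c ^ (t - 1) * ∫⁻ y in V, u y ^ t := by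
  have hc : t.HolderConjugate (Real.conjExponent t) := Real.HolderConjugate.conjExponent ht
  set t' := Real.conjExponent t
  have h1 := ENNReal.lintegral_mul_le_Lp_mul_Lq (volume.restrict V) hc hu.aemeasurable
    (g := fun _ => 1) aemeasurable_const
  simp only [Pi.mul_apply, mul_one, ENNReal.one_rpow, lintegral_one, Measure.restrict_apply_univ] at h1
  have ht0 : 0 < t := by linarith
  have ht0' : 0 < t' := hc.symm.pos
  have e : 1 / t' * t = t - 1 := by
    have := hc.inv_add_inv_eq_one
    have : t'⁻¹ = 1 - t⁻¹ := by linarith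
    rw [one_div, this]; field_simp
  have h2 : (∫⁻ y in V, u y) ^ t ≤ (∫⁻ y in V, u y ^ t) * (c * m) ^ (t - 1) := by
    calc _ ≤ ((∫⁻ y in V, u y ^ t) ^ (1 / t) * (volume V) ^ (1 / t')) ^ t := by gcongr
      _ = (∫⁻ y in V, u y ^ t) * (volume V) ^ (t - 1) := by
        rw [ENNReal.mul_rpow_of_nonneg _ _ ht0.le, ← ENNReal.rpow_mul, ← ENNReal.rpow_mul, e,
          one_div, inv_mul_cancel₀ ht0.ne', ENNReal.rpow_one]
      _ ≤ _ := by
        gcongr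
  have e2 : m * m ^ (t - 1) = m ^ t := by
    rw [ENNReal.rpow_sub _ _ hm hm', ENNReal.rpow_one, ENNReal.mul_div_cancel hm hm']
  rw [ENNReal.div_rpow_of_nonneg _ _ ht0.le, ← mul_div_assoc,
    ENNReal.div_le_iff (rpow_ne0 hm hm') (rpow_neTop hm hm')]
  calc _ ≤ m * ((∫⁻ y in V, u y ^ t) * (c * m) ^ (t - 1)) := by gcongr
    _ = m * ((∫⁻ y in V, u y ^ t) * (c ^ (t-1) * m ^ (t - 1))) := by
      rw [ENNReal.mul_rpow_of_nonneg _ _ (by linarith)]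
    _ = _ := by rw [← e2]; ring

theorem WR_sub_NB {A1 b1 b2 : ℝ} (S : ℕ) {j : ℤ} {z y : XX n} (hb1 : 0 ≤ b1)
    (hb2 : 0 ≤ b2) (hy : y ∈ NB p z j ((S:ℝ) + 1)) :
    WR p A1 b1 b2 j z 0 ⊆ NB p y j (|A1| + b1 + b2 + S + 1) := by
  intro x hx
  obtain ⟨h1, h2, h3⟩ : ‖x.1 - z.1‖ ≤ (A1 + 0) * len j ∧ (b1 - 0) * tau p j ≤ x.2 - z.2 ∧
    x.2 - z.2 ≤ (b2 + 0) * tau p j := hx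
  obtain ⟨h4, h5⟩ : ‖y.1 - z.1‖ ≤ ((S:ℝ)+1) * len j ∧ |y.2 - z.2| ≤ ((S:ℝ)+1) * tau p j := hy
  have hl := len_pos j
  have ht := tau_pos p j
  show ‖x.1 - y.1‖ ≤ (|A1| + b1 + b2 + S + 1) * len j ∧ |x.2 - y.2| ≤ (|A1| + b1 + b2 + S + 1) * tau p j
  constructor
  · have : ‖x.1 - y.1‖ ≤ ‖x.1 - z.1‖ + ‖y.1 - z.1‖ := by
      have e : x.1 - y.1 = (x.1 - z.1) - (y.1 - z.1) := by abel
      rw [e]; exact norm_sub_le _ _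
    have a1 : A1 * len j ≤ |A1| * len j := by gcongr; exact le_abs_self _
    have a2 := mul_nonneg hb1 hl.le
    have a3 := mul_nonneg hb2 hl.le
    nlinarith
  · rw [abs_le] at h5 ⊢
    have a1 := mul_nonneg (abs_nonneg A1) ht.le
    have a2 := mul_nonneg hb1 ht.le
    have a3 := mul_nonneg hb2 ht.le
    constructor <;> nlinarith

/-- the main sufficiency estimate, abstract form -/
theorem suff (H : Wt n p γ θ A w σ) {r r' q β : ℝ} (hc : r.HolderConjugate r')
    (hθq : θ = q / r') (hrq : r ≤ q) (hβ1 : β < 1) (hβ : β = 1 / r - 1 / q) :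
    ∃ K : ℝ≥0∞, K ≠ ∞ ∧ ∀ h g : XX n → ℝ≥0∞, Measurable h →
      ∫⁻ z, h z ^ r ≠ ∞ →
      (∀ z, σ z ≠ ∞ → g z = h z * σ z ^ (1 / r')) →
      ∫⁻ z, (⨆ (x : Fin n → ℝ) (t : ℝ) (L : ℝ) (_ : 0 < L) (_ : z ∈ parLow n p x t L γ),
        volume (parUp n p x t L γ) ^ β * ((∫⁻ y in parUp n p x t L γ, g y) /
          volume (parUp n p x t L γ))) ^ q * w z ≤ K * (∫⁻ z, h z ^ r) ^ (q / r) := by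
  have hr1 : 1 < r := hc.lt
  have hr0 : 0 < r := by linarith
  have hq : 0 < q := by linarith
  have hγ0 := H.g0
  have hγ1 := H.g1
  have hK0 : 0 ≤ K0 p γ := by
    unfold K0
    have : 0 < 1 - γ := by linarith
    positivity
  obtain ⟨i, hi⟩ := exists_i H.hp H.g0 (K0 p γ) (SS p γ) hK0 (by positivity)
  obtain ⟨s, C1, hs1, hsr, hC1, hest⟩ := est H hc hq hθq _ _ (4 * 2 ^ (((i:ℝ) + 1) * p)) hi
  set A1 : ℝ := 4 * 2 ^ i with hA1
  set b1 : ℝ := 2 * γ * 2 ^ ((i:ℝ) * p) with hb1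
  set b2 : ℝ := 4 * 2 ^ (((i:ℝ) + 1) * p) with hb2
  have hb10 : 0 ≤ b1 := by positivity
  have hb20 : 0 ≤ b2 := by positivity
  have hs0 : 0 < s := by linarith
  set A' : ℝ := |A1| + b1 + b2 + SS p γ + 1 with hA'
  have hA'0 : 0 < A' := by positivity
  have ht1 : 1 < r / s := (one_lt_div hs0).2 hsr
  obtain ⟨C2, hC2, hW⟩ := lemW H
  obtain ⟨C3, hC3, -, hMM⟩ := MM_strong (n := n) (p := p) H.hp.le hA'0 ht1
  set κ := ENNReal.ofReal (1 - γ) with hκ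
  have hκ0 : κ ≠ 0 := by rw [hκ]; simpa using hγ1
  have hκt : κ ≠ ∞ := ENNReal.ofReal_ne_top
  set c := ENNReal.ofReal ((2 * A') ^ (n + 1)) with hcc
  have hct : c ≠ ∞ := ENNReal.ofReal_ne_top
  have hqr : 0 ≤ q / r - 1 := by
    have : 1 ≤ q / r := (one_le_div hr0).2 hrq
    linarith
  set D := (κ ^ (β - 1)) ^ q * (C1 * (c ^ (r / s - 1)) ^ (q / r - 1)) with hD
  have hDt : D ≠ ∞ := by
    refine ENNReal.mul_ne_top (ENNReal.rpow_ne_top_of_nonneg hq.le (rpow_neTop hκ0 hκt))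
      (ENNReal.mul_ne_top hC1 (ENNReal.rpow_ne_top_of_nonneg hqr
        (ENNReal.rpow_ne_top_of_nonneg (by linarith) hct)))
  refine ⟨D * (C2 * C3), ENNReal.mul_ne_top hDt (ENNReal.mul_ne_top hC2 hC3), ?_⟩
  intro h g hh hNt hg
  set N := ∫⁻ z, h z ^ r with hN
  set u : XX n → ℝ≥0∞ := fun z => h z ^ s with hu
  have hum : Measurable u := hh.pow_const _
  have hur : ∀ z, u z ^ (r / s) = h z ^ r := by
    intro z; rw [hu]; simp only; rw [← ENNReal.rpow_mul]; congr 1; field_simp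
  set F : XX n → ℝ≥0∞ := fun y => MM p A' u y ^ (r / s) with hF
  have hFm : Measurable F := (MM_measurable p A' hum).pow_const _
  -- pointwise
  have key : ∀ j z, aa w p j z ≠ 0 → ∀ x t L, 0 < L →
      parUp n p x t L γ ⊆ WR p A1 b1 b2 j z 0 →
      κ * mm n p j ≤ volume (parUp n p x t L γ) →
      (volume (parUp n p x t L γ) ^ β * ((∫⁻ y in parUp n p x t L γ, g y) /
          volume (parUp n p x t L γ))) ^ q ≤ D * N ^ (q / r - 1) *
            (xx F p (SS p γ) j z / aa w p j (sh p j (SS p γ) z)) := by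
    intro j z ha x t L hL hsub hvol
    have hm0 := mm_pos n p j
    have hmt := mm_top n p j
    have hv0 : volume (parUp n p x t L γ) ≠ 0 := by
      intro h0
      rw [h0] at hvol
      exact mul_ne_zero hκ0 hm0 (le_zero_iff.1 hvol)
    have hvt : volume (parUp n p x t L γ) ≠ ∞ := by
      rw [vol_parUp n p x t hL.le]; exact ENNReal.ofReal_ne_top
    have ha' := ash_ne H j z ha
    have h1 := alg1 (I := ∫⁻ y in WR p A1 b1 b2 j z 0, g y) hm0 hmt hκ0 hκt hv0 hvt hβ1 hq hvol
      (lintegral_mono_set hsub)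
    have h2 := hest h g hh hg j z ha'
    set a := aa w p j (sh p j (SS p γ) z) with haa
    set m := mm n p j with hm
    set V := WR p A1 b1 b2 j z 0 with hV
    set U := (∫⁻ y in V, h y ^ s) / m with hU
    have hVN : ∀ y ∈ cell p j (sh p j (SS p γ) z), V ⊆ NB p y j A' := by
      intro y hy
      exact WR_sub_NB (SS p γ) hb10 hb20 (sh_cell_sub_NB p (SS p γ) j z hy)
    have hVc : volume V ≤ c * m := by
      rw [hcc, hm, ← vol_NB p (sh p j (SS p γ) z) j hA'0.le]
      exact measure_mono (hVN _ (mem_cell _ _ _))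
    have h3 : m * U ^ (r / s) ≤ c ^ (r / s - 1) * N := by
      refine (alg3 hum ht1 hm0 hmt hVc).trans ?_
      gcongr
      simp only [hur]
      exact setLIntegral_le_lintegral _ _
    have h4 : U ^ (r / s) ≤ xx F p (SS p γ) j z := by
      unfold xx
      refine le_iInf₂ fun y hy => ?_
      show U ^ (r / s) ≤ MM p A' u y ^ (r / s)
      gcongr
      rw [hU, ENNReal.div_le_iff hm0 hmt]
      exact (lintegral_mono_set (hVN y hy)).trans (le_MM p A' u y j)
    calc _ ≤ _ := h1
      _ ≤ (κ ^ (β - 1)) ^ q * (m ^ (β * q) * (C1 * U ^ (q / s) / a)) := by gcongr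
      _ = (κ ^ (β - 1)) ^ q * (C1 * (m ^ (β * q) * U ^ (q / s)) / a) := by
        simp only [div_eq_mul_inv]; ring
      _ = (κ ^ (β - 1)) ^ q * (C1 * (U ^ (r / s) * (m * U ^ (r / s)) ^ (q / r - 1)) / a) := by
        rw [alg2 hs0 hr0 hrq hβ]
      _ ≤ (κ ^ (β - 1)) ^ q * (C1 * (xx F p (SS p γ) j z * (c ^ (r / s - 1) * N) ^ (q / r - 1)) / a) := by
        gcongr
      _ = _ := by
        rw [ENNReal.mul_rpow_of_nonneg _ _ hqr, hD]
        simp only [div_eq_mul_inv]; ring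
  -- integrate
  have hpt : ∀ᵐ z, (⨆ (x : Fin n → ℝ) (t : ℝ) (L : ℝ) (_ : 0 < L) (_ : z ∈ parLow n p x t L γ),
        volume (parUp n p x t L γ) ^ β * ((∫⁻ y in parUp n p x t L γ, g y) /
          volume (parUp n p x t L γ))) ^ q * w z ≤ D * N ^ (q / r - 1) *
          ((⨆ j : ℤ, xx F p (SS p γ) j z / aa w p j (sh p j (SS p γ) z)) * w z) := by
    filter_upwards [aa_ne H] with z hz
    by_cases hw0 : w z = 0
    · rw [hw0]; simp
    rw [← mul_assoc]
    gcongr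
    rw [← ENNReal.le_rpow_inv_iff hq]
    refine iSup_le fun x => iSup_le fun t => iSup_le fun L => iSup_le fun hL => iSup_le fun hzz => ?_
    rw [ENNReal.le_rpow_inv_iff hq]
    obtain ⟨j, hj1, hj2⟩ := geo H.hp H.g0 H.g1 i hL hzz
    refine (key j z (hz hw0 j) x t L hL hj1 hj2).trans ?_
    gcongr
    exact le_iSup (fun j : ℤ => xx F p (SS p γ) j z / aa w p j (sh p j (SS p γ) z)) j
  have hDN : D * N ^ (q / r - 1) ≠ ∞ := ENNReal.mul_ne_top hDt (ENNReal.rpow_ne_top_of_nonneg hqr hNt)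
  calc _ ≤ _ := lintegral_mono_ae hpt
    _ = D * N ^ (q / r - 1) * ∫⁻ z, (⨆ j : ℤ, xx F p (SS p γ) j z / aa w p j (sh p j (SS p γ) z)) * w z :=
      lintegral_const_mul' _ _ hDN
    _ ≤ D * N ^ (q / r - 1) * (C2 * (C3 * N)) := by
      gcongr
      refine (hW F hFm).trans ?_
      gcongr
      refine (hMM u hum).trans ?_
      simp only [hur]; rfl
    _ = D * (C2 * C3) * (N ^ (q / r - 1) * N ^ (1:ℝ)) := by rw [ENNReal.rpow_one]; ring
    _ = _ := by
      rw [← ENNReal.rpow_add_of_nonneg _ _ hqr (by norm_num)]; congr 2; ring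

end
end PW

namespace PW

section

theorem parUp_meas (n : ℕ) (p : ℝ) (x : Fin n → ℝ) (t L γ : ℝ) : MeasurableSet (parUp n p x t L γ) := by
  have : parUp n p x t L γ = Metric.closedBall x L ×ˢ Ioo (t + γ * L ^ p) (t + L ^ p) := by
    ext y; simp [parUp, dist_eq_norm]
  rw [this]
  exact Metric.isClosed_closedBall.measurableSet.prod measurableSet_Ioo

theorem parLow_meas (n : ℕ) (p : ℝ) (x : Fin n → ℝ) (t L γ : ℝ) : MeasurableSet (parLow n p x t L γ) := by
  have : parLow n p x t L γ = Metric.closedBall x L ×ˢ Ioo (t - L ^ p) (t - γ * L ^ p) := by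
    ext y; simp [parLow, dist_eq_norm]
  rw [this]
  exact Metric.isClosed_closedBall.measurableSet.prod measurableSet_Ioo

theorem nec {n : ℕ} {p γ β r q C : ℝ} {ω : XX n → ℝ} (hγ1 : γ < 1) (hr : 1 < r) (hrq : r ≤ q)
    (hβ : β = 1 / r - 1 / q) (hω : Measurable ω) (hω0 : ∀ z, 0 ≤ ω z)
    (h : ∀ f : XX n → ℝ, Measurable f → wLp r ω f < ∞ →
        wLpE q ω (uMax n p γ β f) ≤ ENNReal.ofReal C * wLp r ω f) :
    TArq n p γ r q ω ω ≤ ENNReal.ofReal C ^ q := by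
  have hr0 : 0 < r := by linarith
  have hq : 0 < q := by linarith
  have hr1 : 0 < r - 1 := by linarith
  unfold TArq
  refine iSup_le fun x => iSup_le fun t => iSup_le fun L => iSup_le fun hL => ?_
  have hvv : volume (parLow n p x t L γ) = volume (parUp n p x t L γ) := by
    rw [vol_parUp n p x t hL.le, vol_parLow n p x t hL.le]
  have hv0 : volume (parUp n p x t L γ) ≠ 0 := by
    rw [vol_parUp n p x t hL.le]
    have : 0 < 1 - γ := by linarith
    have : 0 < (2 * L) ^ n * ((1 - γ) * L ^ p) := by positivity
    simpa using this
  have hvt : volume (parUp n p x t L γ) ≠ ∞ := by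
    rw [vol_parUp n p x t hL.le]; exact ENNReal.ofReal_ne_top
  unfold setAvg
  rw [hvv]
  set P := parUp n p x t L γ with hP
  set v := volume P with hv
  have hPm : MeasurableSet P := parUp_meas _ _ _ _ _ _
  have hLm : MeasurableSet (parLow n p x t L γ) := parLow_meas _ _ _ _ _ _
  set W := ∫⁻ z in parLow n p x t L γ, ENNReal.ofReal (ω z) ^ q with hW
  set r' := r / (r - 1) with hr'
  have hr'0 : 0 < r' := by positivity
  set θ := q / r' with hθ
  have hθ0 : 0 < θ := by positivity
  -- basic testing inequality
  have test : ∀ f : XX n → ℝ, Measurable f → wLp r ω f < ∞ →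
      (v ^ β * ((∫⁻ y in P, ENNReal.ofReal |f y|) / v)) ^ q * W ≤
        ENNReal.ofReal C ^ q * (∫⁻ z, ENNReal.ofReal |f z| ^ r * ENNReal.ofReal (ω z) ^ r) ^ (q / r) := by
    intro f hf hf2
    have h1 := h f hf hf2
    unfold wLpE wLp at h1
    have h2 := ENNReal.rpow_le_rpow h1 hq.le
    rw [ENNReal.mul_rpow_of_nonneg _ _ hq.le, ← ENNReal.rpow_mul, ← ENNReal.rpow_mul,
      one_div_mul_cancel hq.ne', ENNReal.rpow_one, one_div_mul_eq_div] at h2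
    refine le_trans ?_ h2
    have hWm : Measurable fun z => ENNReal.ofReal (ω z) ^ q := hω.ennreal_ofReal.pow_const _
    rw [hW, ← lintegral_const_mul _ hWm]
    refine (setLIntegral_mono' hLm ?_).trans (setLIntegral_le_lintegral _ _)
    intro z hz
    gcongr
    unfold uMax setAvg
    exact le_iSup_of_le x (le_iSup_of_le t (le_iSup_of_le L (le_iSup_of_le hL (le_iSup_of_le hz le_rfl))))
  set I := ∫⁻ z in P, ENNReal.ofReal (ω z) ^ (-r') with hI
  -- truncated functions
  set E : ℕ → Set (XX n) := fun k => P ∩ {z | 1 / ((k:ℝ) + 1) < ω z} with hE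
  have hEm : ∀ k, MeasurableSet (E k) := fun k => hPm.inter (measurableSet_lt measurable_const hω)
  set f : ℕ → XX n → ℝ := fun k => (E k).indicator (fun z => ω z ^ (-r')) with hf
  have hfm : ∀ k, Measurable (f k) := fun k => (hω.pow_const _).indicator (hEm k)
  have hpos : ∀ k, ∀ z ∈ E k, 0 < ω z := by
    intro k z hz
    have h1 : 1 / ((k:ℝ) + 1) < ω z := hz.2
    have : 0 < 1 / ((k:ℝ) + 1) := by positivity
    linarith
  have hfa : ∀ k z, ENNReal.ofReal |f k z| = (E k).indicator (fun z => ENNReal.ofReal (ω z) ^ (-r')) z := by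
    intro k z
    by_cases hz : z ∈ E k
    · have hz' := hpos k z hz
      simp only [hf, Set.indicator_of_mem hz]
      rw [abs_of_nonneg (by positivity), ENNReal.ofReal_rpow_of_pos hz']
    · simp [hf, Set.indicator_of_notMem hz]
  have hfr : ∀ k z, ENNReal.ofReal |f k z| ^ r * ENNReal.ofReal (ω z) ^ r = ENNReal.ofReal |f k z| := by
    intro k z
    rw [hfa]
    by_cases hz : z ∈ E k
    · have hz' : ENNReal.ofReal (ω z) ≠ 0 := by simpa using hpos k z hz
      simp only [Set.indicator_of_mem hz]
      rw [← ENNReal.rpow_mul, ← ENNReal.rpow_add _ _ hz' ENNReal.ofReal_ne_top]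
      congr 1
      rw [hr']; field_simp; ring
    · simp only [Set.indicator_of_notMem hz]
      rw [ENNReal.zero_rpow_of_pos hr0, zero_mul]
  set J : ℕ → ℝ≥0∞ := fun k => ∫⁻ z in E k, ENNReal.ofReal (ω z) ^ (-r') with hJ
  have hJf : ∀ k, ∫⁻ z, ENNReal.ofReal |f k z| = J k := by
    intro k
    simp only [hfa]
    rw [lintegral_indicator (hEm k)]
  have hJP : ∀ k, ∫⁻ z in P, ENNReal.ofReal |f k z| = J k := by
    intro k
    simp only [hfa]
    rw [lintegral_indicator (hEm k), Measure.restrict_restrict (hEm k),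
      Set.inter_eq_left.2 (Set.inter_subset_left)]
  have hJt : ∀ k, J k ≠ ∞ := by
    intro k
    have : J k ≤ ∫⁻ z in E k, ENNReal.ofReal (1 / ((k:ℝ) + 1)) ^ (-r') := by
      refine setLIntegral_mono' (hEm k) fun z hz => ?_
      have h1 : 1 / ((k:ℝ) + 1) < ω z := hz.2
      exact rpow_anti (by linarith) (ENNReal.ofReal_le_ofReal h1.le)
    refine ne_top_of_le_ne_top ?_ this
    rw [setLIntegral_const]
    refine ENNReal.mul_ne_top (rpow_neTop ?_ ENNReal.ofReal_ne_top)
      (ne_top_of_le_ne_top hvt (measure_mono Set.inter_subset_left))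
    have : 0 < 1 / ((k:ℝ) + 1) := by positivity
    simpa using this
  have hev : ∀ K : ℝ≥0∞, v ^ β * (K / v) = v ^ (β - 1) * K := by
    intro K
    rw [ENNReal.rpow_sub _ _ hv0 hvt, ENNReal.rpow_one, ENNReal.div_eq_inv_mul, ENNReal.div_eq_inv_mul]
    ring
  have hex : (β - 1) * q = -(1 + θ) := by
    rw [hβ, hθ, hr']; field_simp; ring
  have hJle : ∀ k, W * J k ^ θ ≤ ENNReal.ofReal C ^ q * v ^ (1 + θ) := by
    intro k
    by_cases hJ0 : J k = 0
    · rw [hJ0, ENNReal.zero_rpow_of_pos hθ0, mul_zero]; exact zero_le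
    have hNk : ∫⁻ z, ENNReal.ofReal |f k z| ^ r * ENNReal.ofReal (ω z) ^ r = J k := by
      simp only [hfr]; exact hJf k
    have h1 := test (f k) (hfm k) (by
      unfold wLp
      rw [hNk]
      exact (ENNReal.rpow_ne_top_of_nonneg (by positivity) (hJt k)).lt_top)
    rw [hNk, hJP, hev, ENNReal.mul_rpow_of_nonneg _ _ hq.le, ← ENNReal.rpow_mul, hex, ENNReal.rpow_neg] at h1
    have e : q = θ + q / r := by rw [hθ, hr']; field_simp; ring
    have e' : J k ^ q = J k ^ θ * J k ^ (q / r) := by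
      conv_lhs => rw [e]
      rw [ENNReal.rpow_add _ _ hJ0 (hJt k)]
    rw [e'] at h1
    have h2 : W * J k ^ θ * (v ^ (1 + θ))⁻¹ ≤ ENNReal.ofReal C ^ q := by
      rw [← ENNReal.mul_le_mul_iff_left (rpow_ne0 hJ0 (hJt k)) (rpow_neTop hJ0 (hJt k)) (c := J k ^ (q / r))]
      refine le_trans (le_of_eq ?_) h1
      ring
    rwa [← div_eq_mul_inv, ENNReal.div_le_iff (rpow_ne0 hv0 hvt) (rpow_neTop hv0 hvt)] at h2
  have goal2 : W * I ^ θ ≤ ENNReal.ofReal C ^ q * v ^ (1 + θ) := by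
    set Z := P ∩ {z | ω z = 0} with hZ
    have hZm : MeasurableSet Z := hPm.inter (measurableSet_eq_fun hω measurable_const)
    by_cases hZ0 : volume Z = 0
    · have hsup : I ≤ ⨆ k, J k := by
        have e1 : I = ∫⁻ z, ⨆ k, (E k).indicator (fun z => ENNReal.ofReal (ω z) ^ (-r')) z := by
          rw [hI, ← lintegral_indicator hPm]
          refine lintegral_congr_ae ?_
          have : ∀ᵐ z, z ∉ Z := measure_eq_zero_iff_ae_notMem.1 hZ0
          filter_upwards [this] with z hz
          by_cases hzP : z ∈ P
          · have hz0 : 0 < ω z := by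
              rcases (hω0 z).lt_or_eq with h | h
              · exact h
              · exact absurd ⟨hzP, h.symm⟩ hz
            obtain ⟨k, hk⟩ := exists_nat_one_div_lt hz0
            apply le_antisymm
            · refine le_iSup_of_le k ?_
              have : z ∈ E k := ⟨hzP, hk⟩
              rw [Set.indicator_of_mem hzP, Set.indicator_of_mem this]
            · refine iSup_le fun k => ?_
              rw [Set.indicator_of_mem hzP]
              exact Set.indicator_le_self _ _ _
          · rw [Set.indicator_of_notMem hzP]
            symm
            simp only [ENNReal.iSup_eq_zero]
            intro k
            exact Set.indicator_of_notMem (fun h => hzP h.1) _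
        rw [e1, lintegral_iSup]
        · refine iSup_mono fun k => ?_
          rw [lintegral_indicator (hEm k)]
        · intro k
          exact (hω.ennreal_ofReal.pow_const _).indicator (hEm k)
        · intro a b hab z
          refine Set.indicator_le_indicator_of_subset ?_ (fun _ => zero_le) z
          intro z hz
          refine ⟨hz.1, ?_⟩
          have h1 : 1 / ((a:ℝ) + 1) < ω z := hz.2
          show 1 / ((b:ℝ) + 1) < ω z
          refine lt_of_le_of_lt ?_ h1
          gcongr
      have hJmono : Monotone J := by
        intro a b hab
        refine lintegral_mono_set ?_
        intro z hz
        refine ⟨hz.1, ?_⟩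
        have h1 : 1 / ((a:ℝ) + 1) < ω z := hz.2
        show 1 / ((b:ℝ) + 1) < ω z
        refine lt_of_le_of_lt ?_ h1
        gcongr
      have hlim := (tendsto_atTop_iSup hJmono)
      have hlim2 := ((ENNReal.continuous_rpow_const (y := θ)).tendsto _).comp hlim
      have : (⨆ k, J k) ^ θ ≤ ⨆ k, J k ^ θ := by
        refine le_of_tendsto' hlim2 fun k => ?_
        exact le_iSup (fun k => J k ^ θ) k
      calc W * I ^ θ ≤ W * ⨆ k, J k ^ θ := by
            gcongr
            exact le_trans (ENNReal.rpow_le_rpow hsup hθ0.le) this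
        _ ≤ _ := by
          rw [ENNReal.mul_iSup]
          exact iSup_le hJle
    · have hfZ : ∀ z, ENNReal.ofReal |Z.indicator (fun _ => (1:ℝ)) z| = Z.indicator 1 z := by
        intro z
        by_cases hz : z ∈ Z <;> simp [hz]
      have hN : ∫⁻ z, ENNReal.ofReal |Z.indicator (fun _ => (1:ℝ)) z| ^ r * ENNReal.ofReal (ω z) ^ r = 0 := by
        rw [← lintegral_zero (μ := (volume : Measure (XX n)))]
        congr 1
        funext z
        by_cases hz : z ∈ Z
        · have : ω z = 0 := hz.2
          rw [this, ENNReal.ofReal_zero, ENNReal.zero_rpow_of_pos hr0, mul_zero]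
        · rw [hfZ, Set.indicator_of_notMem hz, ENNReal.zero_rpow_of_pos hr0, zero_mul]
      have h1 := test (Z.indicator fun _ => (1:ℝ)) (measurable_const.indicator hZm) (by
        unfold wLp
        rw [hN, ENNReal.zero_rpow_of_pos (by positivity)]; simp)
      rw [hN, ENNReal.zero_rpow_of_pos (by positivity), mul_zero] at h1
      simp only [hfZ] at h1
      rw [lintegral_indicator_one hZm, Measure.restrict_apply hZm,
        Set.inter_eq_left.2 (Set.inter_subset_left), hev] at h1
      have h2 := le_zero_iff.1 h1
      have hW0 : W = 0 := by
        rcases mul_eq_zero.1 h2 with h3 | h3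
        · exfalso
          have h4 := (ENNReal.rpow_eq_zero_iff_of_pos hq).1 h3
          rcases mul_eq_zero.1 h4 with h5 | h5
          · exact rpow_ne0 hv0 hvt h5
          · exact hZ0 h5
        · exact h3
      rw [hW0, zero_mul]; exact zero_le
  rw [ENNReal.div_rpow_of_nonneg _ _ hθ0.le]
  have e : W / v * (I ^ θ / v ^ θ) = W * I ^ θ / v ^ (1 + θ) := by
    rw [ENNReal.rpow_add _ _ hv0 hvt, ENNReal.rpow_one]
    simp only [ENNReal.div_eq_inv_mul]
    rw [ENNReal.mul_inv (Or.inl hv0) (Or.inl hvt)]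
    ring
  rw [e, ENNReal.div_le_iff (rpow_ne0 hv0 hvt) (rpow_neTop hv0 hvt)]
  exact goal2

end
end PW

/-- Strong-type one-weight characterization for the uncentered parabolic fractional
maximal operator `M_β^{γ+}` with time lag. -/
theorem Arq_strong_type_uncentered (n : ℕ) (hn : 1 ≤ n) (p : ℝ) (hp : 1 < p)
    (γ β r q : ℝ) (hγ : γ ∈ Set.Ioo (0 : ℝ) 1) (hβ : β ∈ Set.Ico (0 : ℝ) 1)
    (hr : 1 < r) (hrq : r ≤ q) (hβrq : β = 1 / r - 1 / q)
    (ω : ((Fin n → ℝ) × ℝ) → ℝ) (hω : Measurable ω) (hω0 : ∀ z, 0 ≤ ω z)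
    (hωloc : LocallyIntegrable ω volume) :
    TArq n p γ r q ω ω < ∞ ↔
      ∃ C : ℝ, 0 < C ∧ ∀ f : ((Fin n → ℝ) × ℝ) → ℝ, Measurable f → wLp r ω f < ∞ →
        wLpE q ω (uMax n p γ β f) ≤ ENNReal.ofReal C * wLp r ω f := by
  obtain ⟨hγ0, hγ1⟩ := hγ
  have hr0 : 0 < r := by linarith
  have hq : 0 < q := by linarith
  have hr1 : 0 < r - 1 := by linarith
  have hr'0 : 0 < r / (r - 1) := by positivity
  constructor
  · intro hA
    have hc : r.HolderConjugate (r / (r - 1)) := Real.HolderConjugate.conjExponent hr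
    have H : PW.Wt n p γ (q / (r / (r - 1))) (TArq n p γ r q ω ω)
        (fun z => ENNReal.ofReal (ω z) ^ q) (fun z => ENNReal.ofReal (ω z) ^ (-(r / (r - 1)))) := by
      refine ⟨hω.ennreal_ofReal.pow_const _, hω.ennreal_ofReal.pow_const _, ?_, ?_, ?_, by positivity,
        hA.ne, hp, hγ0, hγ1, ?_⟩
      · intro z
        exact ENNReal.rpow_ne_top_of_nonneg hq.le ENNReal.ofReal_ne_top
      · intro z h0
        rw [ENNReal.rpow_neg, ENNReal.inv_eq_zero] at h0
        exact ENNReal.rpow_ne_top_of_nonneg hr'0.le ENNReal.ofReal_ne_top h0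
      · intro z hz
        have h0 : ENNReal.ofReal (ω z) ≠ 0 := by
          intro h0
          apply hz
          simp only [h0]
          exact ENNReal.zero_rpow_of_neg (by linarith)
        rw [← ENNReal.rpow_mul, ← ENNReal.rpow_add _ _ h0 ENNReal.ofReal_ne_top]
        have : q + -(r / (r - 1)) * (q / (r / (r - 1))) = 0 := by field_simp; ring
        rw [this, ENNReal.rpow_zero]
      · intro x t L hL
        have hvv : volume (parUp n p x t L γ) = volume (parLow n p x t L γ) := by
          rw [PW.vol_parUp n p x t hL.le, PW.vol_parLow n p x t hL.le]
        have hv0 : volume (parLow n p x t L γ) ≠ 0 := by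
          rw [PW.vol_parLow n p x t hL.le]
          have : 0 < 1 - γ := by linarith
          have : 0 < (2 * L) ^ n * ((1 - γ) * L ^ p) := by positivity
          simpa using this
        have hvt : volume (parLow n p x t L γ) ≠ ∞ := by
          rw [PW.vol_parLow n p x t hL.le]; exact ENNReal.ofReal_ne_top
        have h1 : setAvg (parLow n p x t L γ) (fun z => ENNReal.ofReal (ω z) ^ q) *
            (setAvg (parUp n p x t L γ)
              (fun z => ENNReal.ofReal (ω z) ^ (-(r / (r - 1))))) ^ (q / (r / (r - 1))) ≤
            TArq n p γ r q ω ω := by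
          unfold TArq
          exact le_iSup_of_le x (le_iSup_of_le t (le_iSup_of_le L (le_iSup_of_le hL le_rfl)))
        generalize TArq n p γ r q ω ω = A at h1 ⊢
        unfold setAvg at h1
        rw [hvv] at h1
        have hθ0 : 0 < q / (r / (r - 1)) := by positivity
        generalize q / (r / (r - 1)) = θ at h1 hθ0 ⊢
        generalize volume (parLow n p x t L γ) = v at h1 hv0 hvt ⊢
        rw [ENNReal.div_rpow_of_nonneg _ _ hθ0.le] at h1
        generalize (∫⁻ z in parLow n p x t L γ, ENNReal.ofReal (ω z) ^ q) = W at h1 ⊢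
        generalize (∫⁻ z in parUp n p x t L γ, ENNReal.ofReal (ω z) ^ (-(r / (r - 1)))) ^ θ = S at h1 ⊢
        have e : W / v * (S / v ^ θ) = W * S / v ^ (1 + θ) := by
          rw [ENNReal.rpow_add _ _ hv0 hvt, ENNReal.rpow_one]
          simp only [ENNReal.div_eq_inv_mul]
          rw [ENNReal.mul_inv (Or.inl hv0) (Or.inl hvt)]
          ring
        rwa [e, ENNReal.div_le_iff (PW.rpow_ne0 hv0 hvt) (PW.rpow_neTop hv0 hvt)] at h1
    obtain ⟨K, hK, hmain⟩ := PW.suff H hc rfl hrq hβ.2 hβrq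
    have hKq : K ^ (1 / q) ≠ ∞ := ENNReal.rpow_ne_top_of_nonneg (by positivity) hK
    refine ⟨(K ^ (1 / q)).toReal + 1, by positivity, ?_⟩
    intro f hf hfN
    have hNe : ∫⁻ z, ENNReal.ofReal |f z| ^ r * ENNReal.ofReal (ω z) ^ r =
        ∫⁻ z, (ENNReal.ofReal |f z| * ENNReal.ofReal (ω z)) ^ r := by
      simp only [ENNReal.mul_rpow_of_nonneg _ _ hr0.le]
    have hN : ∫⁻ z, (ENNReal.ofReal |f z| * ENNReal.ofReal (ω z)) ^ r ≠ ∞ := by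
      intro h
      unfold wLp at hfN
      rw [hNe, h, ENNReal.top_rpow_of_pos (by positivity)] at hfN
      exact lt_irrefl _ hfN
    have habs : Measurable fun z => |f z| := by fun_prop
    have h1 := hmain (fun z => ENNReal.ofReal |f z| * ENNReal.ofReal (ω z))
      (fun z => ENNReal.ofReal |f z|) (habs.ennreal_ofReal.mul hω.ennreal_ofReal) hN (by
        intro z hz
        have h0 : ENNReal.ofReal (ω z) ≠ 0 := by
          intro h0
          apply hz
          simp only [h0]
          exact ENNReal.zero_rpow_of_neg (by linarith)
        rw [← ENNReal.rpow_mul]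
        have : -(r / (r - 1)) * (1 / (r / (r - 1))) = -1 := by field_simp
        rw [this, ENNReal.rpow_neg_one, mul_assoc, ENNReal.mul_inv_cancel h0 ENNReal.ofReal_ne_top,
          mul_one])
    unfold wLpE wLp
    rw [hNe]
    have h2 := ENNReal.rpow_le_rpow h1 (z := 1 / q) (by positivity)
    refine le_trans h2 ?_
    rw [ENNReal.mul_rpow_of_nonneg _ _ (by positivity), ← ENNReal.rpow_mul]
    have e : q / r * (1 / q) = 1 / r := by field_simp
    rw [e]
    gcongr
    rw [← ENNReal.ofReal_toReal hKq]
    apply ENNReal.ofReal_le_ofReal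
    rw [ENNReal.toReal_ofReal ENNReal.toReal_nonneg]
    linarith
  · rintro ⟨C, hC, h⟩
    exact lt_of_le_of_lt (PW.nec hγ1 hr hrq hβrq hω hω0 h)
      (ENNReal.rpow_ne_top_of_nonneg hq.le ENNReal.ofReal_ne_top).lt_top
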